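/- Let l, n ∈ ℕ, t ∈ ℝ₊, z ∈ ℝⁿ. Let A : ℝ₊ × ℝⁿ × ℝˡ → ℝⁿ, a : ℝ₊ × ℝⁿ × ℝˡ → ℝˡ, and c : ℝ₊ × ℝⁿ × ℝˡ → ℝ^{l×l} (symmetric values) be measurable functions satisfying: A_s(u,x) is continuous in (u,x), bounded on every set {s ≤ T, |u| ≤ N, x ∈ ℝˡ}, and sup_{s≤T} sup_x sup_u uᵀA_s(u,x)/(1+|u|²) < ∞ for each T; a_s(u,x) is locally bounded, Lipschitz continuous in x locally uniformly in (s,u), continuous in u locally uniformly in s and uniformly in x, and for all T, N: lim_{|x|→∞} sup_{s≤T} sup_{|u|≤N} a_s(u,x)·x/|x| = −∞; c_s(u,x) is bounded on every set {s ≤ T, |u| ≤ N, x ∈ ℝˡ}, positive definite uniformly in x and locally uniformly in (s,u), continuous in u locally uniformly in s and uniformly in x, and of class C¹ in x with first partial derivatives bounded and Lipschitz continuous in x locally uniformly in (s,u). Then there exist a locally Lipschitz continuous function X† : ℝ₊ → ℝⁿ with X†₀ = z and a measurable function m† : ℝ₊ × ℝˡ → [0,∞) such that for almost every s: m†_s(·)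 is a probability density on ℝˡ with m†_s ∈ W^{1,1}_loc(ℝˡ) and √(m†_s) ∈ W^{1,2}(ℝˡ); the paths solve dX†_s/ds = ∫_{ℝˡ} A_{s+t}(X†_s, x) m†_s(x) dx for almost all s; and ∫_{ℝˡ} ( ½ tr( c_{s+t}(X†_s, x) D²p(x) ) + a_{s+t}(X†_s, x)·Dp(x) ) m†_s(x) dx = 0 for every p ∈ C_c^∞(ℝˡ). -/

import Mathlib

open MeasureTheory Filter Set Topology RealInnerProductSpace

variable {l : ℕ}

/-- `g` is the weak (Sobolev) gradient of `f` on `ℝˡ`; in particular `f ∈ W^{1,1}_loc`. -/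
def HasWeakGrad (f : EuclideanSpace ℝ (Fin l) → ℝ)
    (g : EuclideanSpace ℝ (Fin l) → EuclideanSpace ℝ (Fin l)) : Prop :=
  LocallyIntegrable f volume ∧ LocallyIntegrable g volume ∧
    ∀ p : EuclideanSpace ℝ (Fin l) → ℝ, ContDiff ℝ (⊤ : ℕ∞) p → HasCompactSupport p →
      ∀ v : EuclideanSpace ℝ (Fin l),
        (∫ x, f x * fderiv ℝ p x v) = - ∫ x, ⟪g x, v⟫ * p x

section Averaging

local notation "𝔼" => EuclideanSpace ℝ (Fin l)

/-- The second-order differential operator `p ↦ ½ tr(c D²p) + ⟪a, Dp⟫`. -/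
noncomputable def diffGen (c : 𝔼 → (𝔼 →L[ℝ] 𝔼)) (a : 𝔼 → 𝔼) (p : 𝔼 → ℝ) (x : 𝔼) : ℝ :=
  ((1 : ℝ) / 2) *
    (LinearMap.trace ℝ 𝔼 ((c x).comp (fderiv ℝ (fun y => gradient p y) x)).toLinearMap) +
    ⟪a x, gradient p x⟫

/-- The trace functional on continuous linear endomorphisms, as a continuous linear map. -/
noncomputable def traceL : (𝔼 →L[ℝ] 𝔼) →L[ℝ] ℝ :=
  LinearMap.toContinuousLinearMap
    ((LinearMap.trace ℝ 𝔼).comp (ContinuousLinearMap.coeLM ℝ))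

theorem traceL_apply (T : 𝔼 →L[ℝ] 𝔼) :
    traceL T = LinearMap.trace ℝ 𝔼 T.toLinearMap := rfl

theorem traceL_comp_smulRight (c : 𝔼 →L[ℝ] 𝔼) (φ : 𝔼 →L[ℝ] ℝ) (v : 𝔼) :
    traceL (c.comp (φ.smulRight v)) = φ (c v) := by
  have : (c.comp (φ.smulRight v)).toLinearMap = (φ.toLinearMap).smulRight (c v) := by ext; simp
  rw [traceL_apply, this, LinearMap.trace_smulRight]; rfl

theorem contDiff_gradient {p : 𝔼 → ℝ} (hp : ContDiff ℝ (⊤ : ℕ∞) p) :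
    ContDiff ℝ (⊤ : ℕ∞) (fun y => gradient p y) := by
  unfold gradient
  exact (InnerProductSpace.toDual ℝ 𝔼).symm.contDiff.comp (hp.fderiv_right (by simp))

theorem continuous_gradient {p : 𝔼 → ℝ} (hp : ContDiff ℝ 1 p) :
    Continuous (fun y => gradient p y) := by
  unfold gradient
  exact (InnerProductSpace.toDual ℝ 𝔼).symm.continuous.comp (hp.continuous_fderiv (by simp))

theorem hasCompactSupport_gradient {p : 𝔼 → ℝ} (hp : HasCompactSupport p) :
    HasCompactSupport (fun y => gradient p y) := by
  unfold gradient
  exact (hp.fderiv ℝ).comp_left (map_zero _)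

/-- The mollification of a test function and its first two derivatives. -/
theorem mollified_test {p ρ : 𝔼 → ℝ} (hp : ContDiff ℝ 1 p) (hpc : HasCompactSupport p)
    (hρ : ContDiff ℝ (⊤ : ℕ∞) ρ) (hρc : HasCompactSupport ρ) :
    ∃ P : 𝔼 → ℝ, ContDiff ℝ (⊤ : ℕ∞) P ∧ HasCompactSupport P ∧
      (∀ y, P y = ∫ x, p x * ρ (y - x)) ∧
      (∀ y, gradient P y = ∫ x, ρ (y - x) • gradient p x) ∧
      (∀ y, fderiv ℝ (fun y => gradient P y) y =
        ∫ x, (fderiv ℝ ρ (y - x)).smulRight (gradient p x)) := by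
  have hρ1 : ContDiff ℝ 1 ρ := hρ.of_le (by simp)
  set L := ContinuousLinearMap.mul ℝ ℝ
  set P : 𝔼 → ℝ := convolution p ρ L volume with hP
  have hpl : LocallyIntegrable p (volume : Measure 𝔼) := hp.continuous.locallyIntegrable
  have hgrad : ∀ y, gradient P y = ∫ x, ρ (y - x) • gradient p x := by
    intro y
    have h1 := hpc.hasFDerivAt_convolution_left (μ := (volume : Measure 𝔼)) L hp
      hρ.continuous.locallyIntegrable y
    unfold gradient
    rw [h1.fderiv]
    unfold convolution
    refine Eq.trans (ContinuousLinearMap.integral_comp_comm (𝕜 := ℝ)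
      ((InnerProductSpace.toDual ℝ 𝔼).symm.toContinuousLinearEquiv.toContinuousLinearMap)
      ?_).symm ?_
    rotate_left
    · congr 1
      ext1 x
      have : (((ContinuousLinearMap.precompL 𝔼 L) (fderiv ℝ p x)) (ρ (y - x))) =
          ρ (y - x) • fderiv ℝ p x := by
        ext v; simp [L, ContinuousLinearMap.precompL_apply, mul_comm]
      rw [this]; exact map_smul (InnerProductSpace.toDual ℝ 𝔼).symm _ _
    · exact (HasCompactSupport.convolutionExists_left _ (hpc.fderiv ℝ)
        (hp.continuous_fderiv (by simp)) hρ.continuous.locallyIntegrable y)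
  refine ⟨P, hρc.contDiff_convolution_right L hpl hρ, hpc.convolution L hρc,
    fun y => rfl, hgrad, fun y => ?_⟩
  have h2 := hρc.hasFDerivAt_convolution_right (μ := (volume : Measure 𝔼))
    ((ContinuousLinearMap.lsmul ℝ ℝ : ℝ →L[ℝ] 𝔼 →L[ℝ] 𝔼).flip)
    (continuous_gradient hp).locallyIntegrable hρ1 y
  have h3 : (fun y => gradient P y) = convolution (fun y => gradient p y) ρ
      ((ContinuousLinearMap.lsmul ℝ ℝ : ℝ →L[ℝ] 𝔼 →L[ℝ] 𝔼).flip) volume := by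
    ext1 y
    rw [hgrad]; rfl
  rw [h3, h2.fderiv]
  unfold convolution
  rfl

/-- The smoothed density `x ↦ ∫ ρ(y - x) dμ(y)` of a measure. -/
noncomputable def smoothed (μ : Measure 𝔼) (ρ : 𝔼 → ℝ) (x : 𝔼) : ℝ := ∫ y, ρ (y - x) ∂μ

theorem exists_bound_of_compactSupport {F : Type*} [NormedAddCommGroup F] {ρ : 𝔼 → F}
    (hρ : Continuous ρ) (hρc : HasCompactSupport ρ) : ∃ C, 0 ≤ C ∧ ∀ x, ‖ρ x‖ ≤ C := by
  obtain ⟨C, hC⟩ := hρc.exists_bound_of_continuous hρ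
  exact ⟨C, (norm_nonneg _).trans (hC 0), hC⟩

theorem integrable_translate_of_compactSupport {F : Type*} [NormedAddCommGroup F]
    {μ : Measure 𝔼} [IsFiniteMeasure μ] {ρ : 𝔼 → F}
    (hρ : Continuous ρ) (hρc : HasCompactSupport ρ) (x : 𝔼) :
    Integrable (fun y => ρ (y - x)) μ := by
  obtain ⟨C, -, hC⟩ := exists_bound_of_compactSupport hρ hρc
  exact Integrable.of_bound (hρ.comp (continuous_id.sub continuous_const)
    |>.stronglyMeasurable_of_hasCompactSupport
      (hρc.comp_homeomorph (Homeomorph.subRight x))).aestronglyMeasurable C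
    (ae_of_all _ fun y => hC _)

theorem continuous_smoothed {F : Type*} [NormedAddCommGroup F] [NormedSpace ℝ F]
    {μ : Measure 𝔼} [IsFiniteMeasure μ] {ρ : 𝔼 → F}
    (hρ : Continuous ρ) (hρc : HasCompactSupport ρ) :
    Continuous (fun x => ∫ y, ρ (y - x) ∂μ) := by
  obtain ⟨C, -, hC⟩ := exists_bound_of_compactSupport hρ hρc
  refine continuous_of_dominated (bound := fun _ => C)
    (fun x => (integrable_translate_of_compactSupport hρ hρc x).aestronglyMeasurable)
    (fun x => ae_of_all _ fun y => hC _) (integrable_const _)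
    (ae_of_all _ fun y => by fun_prop)

theorem tendsto_smoothed {μ : Measure 𝔼} [IsFiniteMeasure μ] {ρ : 𝔼 → ℝ}
    (hρ : Continuous ρ) (hρc : HasCompactSupport ρ) :
    Tendsto (smoothed μ ρ) (cocompact 𝔼) (𝓝 0) := by
  obtain ⟨C, -, hC⟩ := exists_bound_of_compactSupport hρ hρc
  have : (cocompact 𝔼).IsCountablyGenerated := by
    rw [← Metric.cobounded_eq_cocompact, ← comap_norm_atTop]; infer_instance
  have h0 : (0 : ℝ) = ∫ y : 𝔼, (0 : ℝ) ∂μ := by simp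
  rw [h0]
  refine tendsto_integral_filter_of_dominated_convergence (fun _ => C)
    (Eventually.of_forall fun x =>
      (integrable_translate_of_compactSupport hρ hρc x).aestronglyMeasurable)
    (Eventually.of_forall fun x => ae_of_all _ fun y => hC _) (integrable_const _)
    (ae_of_all _ fun y => ?_)
  have h1 : Tendsto ρ (cocompact 𝔼) (𝓝 0) := hρc.is_zero_at_infty
  exact h1.comp (Homeomorph.subLeft y).isClosedEmbedding.tendsto_cocompact

theorem hasFDerivAt_smoothed {μ : Measure 𝔼} [IsFiniteMeasure μ] {ρ : 𝔼 → ℝ}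
    (hρ : ContDiff ℝ 1 ρ) (hρc : HasCompactSupport ρ) (x : 𝔼) :
    HasFDerivAt (smoothed μ ρ) (∫ y, -fderiv ℝ ρ (y - x) ∂μ) x := by
  have hd : Continuous (fderiv ℝ ρ) := hρ.continuous_fderiv (by simp)
  have hdc : HasCompactSupport (fderiv ℝ ρ) := hρc.fderiv ℝ
  obtain ⟨C, -, hC⟩ := exists_bound_of_compactSupport hd hdc
  unfold smoothed
  refine hasFDerivAt_integral_of_dominated_of_fderiv_le (s := univ)
    (F' := fun x y => -fderiv ℝ ρ (y - x)) (bound := fun _ => C)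
    univ_mem
    (Eventually.of_forall fun x =>
      (integrable_translate_of_compactSupport hρ.continuous hρc x).aestronglyMeasurable)
    (integrable_translate_of_compactSupport hρ.continuous hρc x)
    (integrable_translate_of_compactSupport hd hdc x).neg.aestronglyMeasurable
    (ae_of_all _ fun y x _ => by simpa using hC _) (integrable_const _)
    (ae_of_all _ fun y x _ => ?_)
  have h1 : HasFDerivAt ρ (fderiv ℝ ρ (y - x)) (y - x) :=
    (hρ.differentiable (by simp) _).hasFDerivAt
  have h2 : HasFDerivAt (fun x : 𝔼 => y - x) (-ContinuousLinearMap.id ℝ 𝔼) x :=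
    (hasFDerivAt_id x).const_sub y
  have h3 := h1.comp x h2
  rw [show (fderiv ℝ ρ (y - x)).comp (-ContinuousLinearMap.id ℝ 𝔼) = -fderiv ℝ ρ (y - x) by
    ext; simp] at h3
  exact h3

theorem fderiv_smoothed {μ : Measure 𝔼} [IsFiniteMeasure μ] {ρ : 𝔼 → ℝ}
    (hρ : ContDiff ℝ 1 ρ) (hρc : HasCompactSupport ρ) (x v : 𝔼) :
    fderiv ℝ (smoothed μ ρ) x v = - ∫ y, fderiv ℝ ρ (y - x) v ∂μ := by
  have hd : Continuous (fderiv ℝ ρ) := hρ.continuous_fderiv (by simp)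
  have hdc : HasCompactSupport (fderiv ℝ ρ) := hρc.fderiv ℝ
  rw [(hasFDerivAt_smoothed hρ hρc x).fderiv, integral_neg, neg_apply,
    ContinuousLinearMap.integral_apply (integrable_translate_of_compactSupport hd hdc x)]

theorem contDiff_smoothed {μ : Measure 𝔼} [IsFiniteMeasure μ] {ρ : 𝔼 → ℝ}
    (hρ : ContDiff ℝ 1 ρ) (hρc : HasCompactSupport ρ) :
    ContDiff ℝ 1 (smoothed μ ρ) := by
  have hd : Continuous (fderiv ℝ ρ) := hρ.continuous_fderiv (by simp)
  have hdc : HasCompactSupport (fderiv ℝ ρ) := hρc.fderiv ℝ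
  rw [contDiff_one_iff_fderiv]
  refine ⟨fun x => (hasFDerivAt_smoothed hρ hρc x).differentiableAt, ?_⟩
  have : fderiv ℝ (smoothed μ ρ) = fun x => - ∫ y, fderiv ℝ ρ (y - x) ∂μ := by
    ext1 x
    rw [(hasFDerivAt_smoothed hρ hρc x).fderiv, integral_neg]
  rw [this]
  exact (continuous_smoothed hd hdc).neg

theorem smoothed_nonneg {μ : Measure 𝔼} {ρ : 𝔼 → ℝ} (h0 : ∀ x, 0 ≤ ρ x) (x : 𝔼) :
    0 ≤ smoothed μ ρ x := integral_nonneg fun _ => h0 _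

/-- Integrability of `w(y - x) b(y)` on the product space. -/
theorem integrable_prod_translate {μ : Measure 𝔼} [IsFiniteMeasure μ] {w b : 𝔼 → ℝ}
    (hw : Integrable w volume) (hb : Integrable b μ) :
    Integrable (fun q : 𝔼 × 𝔼 => w (q.2 - q.1) * b q.2) (volume.prod μ) := by
  have := hb.convolution_integrand (ContinuousLinearMap.mul ℝ ℝ) hw.comp_neg
  refine this.congr (ae_of_all _ fun q => ?_)
  simp [mul_comm]

theorem integral_prod_translate {μ : Measure 𝔼} [IsFiniteMeasure μ] {w b : 𝔼 → ℝ}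
    (hw : Integrable w volume) (hb : Integrable b μ) :
    ∫ q : 𝔼 × 𝔼, w (q.2 - q.1) * b q.2 ∂(volume.prod μ) = (∫ z, w z) * ∫ y, b y ∂μ := by
  rw [integral_prod_symm _ (integrable_prod_translate hw hb), ← integral_const_mul]
  congr 1
  ext1 y
  simp only
  rw [integral_mul_const, integral_sub_left_eq_self w volume y]

theorem integrable_of_compactSupport {F : Type*} [NormedAddCommGroup F] {ρ : 𝔼 → F}
    (hρ : Continuous ρ) (hρc : HasCompactSupport ρ) : Integrable ρ volume :=
  hρ.integrable_of_hasCompactSupport hρc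

theorem integrable_smoothed {μ : Measure 𝔼} [IsFiniteMeasure μ] {ρ : 𝔼 → ℝ}
    (hρ : Continuous ρ) (hρc : HasCompactSupport ρ) :
    Integrable (smoothed μ ρ) volume := by
  have := (integrable_prod_translate (μ := μ) (integrable_of_compactSupport hρ hρc)
    (integrable_const (1 : ℝ))).integral_prod_left
  simp only [mul_one] at this
  exact this

theorem integral_mul_smoothed {μ : Measure 𝔼} [IsFiniteMeasure μ] {ρ η : 𝔼 → ℝ}
    (hρ : Continuous ρ) (hρc : HasCompactSupport ρ) (hη : Continuous η)
    (hηc : HasCompactSupport η) :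
    ∫ x, η x * smoothed μ ρ x = ∫ y, ∫ x, η x * ρ (y - x) ∂volume ∂μ := by
  obtain ⟨C, -, hC⟩ := exists_bound_of_compactSupport hρ hρc
  have h1 : Integrable (fun q : 𝔼 × 𝔼 => η q.1 * ρ (q.2 - q.1)) (volume.prod μ) := by
    have := (integrable_of_compactSupport hη hηc).mul_prod (integrable_const (1 : ℝ) (μ := μ))
    simp only [mul_one] at this
    exact this.mul_bdd (c := C) (Continuous.aestronglyMeasurable (by fun_prop)) (ae_of_all _ fun q => hC _)
  rw [← integral_prod_symm _ h1, integral_prod _ h1]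
  simp only [integral_const_mul, smoothed]

theorem diffGen_mollified {c : 𝔼 → (𝔼 →L[ℝ] 𝔼)} {a : 𝔼 → 𝔼} {p ρ P : 𝔼 → ℝ} (hp : ContDiff ℝ 1 p)
    (hpc : HasCompactSupport p) (hρ : ContDiff ℝ (⊤ : ℕ∞) ρ)
    (h1 : ∀ y, gradient P y = ∫ x, ρ (y - x) • gradient p x)
    (h2 : ∀ y, fderiv ℝ (fun y => gradient P y) y =
        ∫ x, (fderiv ℝ ρ (y - x)).smulRight (gradient p x)) (y : 𝔼) :
    diffGen c a P y = ∫ x, ((1 / 2) * fderiv ℝ ρ (y - x) (c y (gradient p x)) +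
      ρ (y - x) * ⟪a y, gradient p x⟫) := by
  have hg := continuous_gradient hp
  have hgc := hasCompactSupport_gradient hpc
  have hd : Continuous (fderiv ℝ ρ) := hρ.continuous_fderiv (by simp)
  have hρ' := hρ.continuous
  have i1 : Integrable (fun x => ρ (y - x) • gradient p x) volume := by
    refine integrable_of_compactSupport (by fun_prop) ?_
    refine hgc.mono fun x hx => ?_
    contrapose! hx
    simp only [Function.mem_support, not_not] at hx ⊢
    rw [hx, smul_zero]
  have i2c : Continuous (fun x => (fderiv ℝ ρ (y - x)).smulRight (gradient p x)) := by
    have h3 : Continuous (fun x => fderiv ℝ ρ (y - x)) := by fun_prop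
    have h4 : Continuous fun q : (𝔼 →L[ℝ] ℝ) × 𝔼 => q.1.smulRight q.2 :=
      (ContinuousLinearMap.smulRightL ℝ 𝔼 𝔼).continuous₂
    exact h4.comp (h3.prodMk hg)
  have i2 : Integrable (fun x => (fderiv ℝ ρ (y - x)).smulRight (gradient p x)) volume := by
    refine integrable_of_compactSupport i2c ?_
    · refine hgc.mono fun x hx => ?_
      contrapose! hx
      simp only [Function.mem_support, not_not] at hx ⊢
      rw [hx]; ext; simp
  have e1 := (((traceL (l := l)).comp ((ContinuousLinearMap.compL ℝ 𝔼 𝔼 𝔼) (c y))).integral_comp_comm i2)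
  have e2 := ((innerSL ℝ (a y)).integral_comp_comm i1)
  unfold diffGen
  rw [h1, h2, ← traceL_apply]
  have e1' : traceL ((c y).comp (∫ x, (fderiv ℝ ρ (y - x)).smulRight (gradient p x))) =
      ∫ x, fderiv ℝ ρ (y - x) (c y (gradient p x)) := by
    refine e1.symm.trans ?_
    congr 1; ext1 x
    exact traceL_comp_smulRight _ _ _
  have e2' : ⟪a y, ∫ x, ρ (y - x) • gradient p x⟫ = ∫ x, ρ (y - x) * ⟪a y, gradient p x⟫ := by
    refine e2.symm.trans ?_
    congr 1; ext1 x
    simp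
  rw [e1', e2', ← integral_const_mul, integral_add]
  · have i3 := ((traceL (l := l)).comp ((ContinuousLinearMap.compL ℝ 𝔼 𝔼 𝔼) (c y))).integrable_comp i2
    refine Integrable.const_mul (i3.congr (ae_of_all _ fun x => ?_)) _
    exact traceL_comp_smulRight _ _ _
  · refine ((innerSL ℝ (a y)).integrable_comp i1).congr (ae_of_all _ fun x => ?_)
    simp

theorem stationary_mollified_identity {μ : Measure 𝔼} [IsProbabilityMeasure μ]
    {c : 𝔼 → (𝔼 →L[ℝ] 𝔼)} {a : 𝔼 → 𝔼} (hc : Continuous c) {Cc : ℝ} (hCc : ∀ x, ‖c x‖ ≤ Cc)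
    (ha : Integrable a μ)
    (hst : ∀ p : 𝔼 → ℝ, ContDiff ℝ (⊤ : ℕ∞) p → HasCompactSupport p →
      ∫ x, diffGen c a p x ∂μ = 0)
    {ρ p : 𝔼 → ℝ} (hρ : ContDiff ℝ (⊤ : ℕ∞) ρ) (hρc : HasCompactSupport ρ)
    (hp : ContDiff ℝ 1 p) (hpc : HasCompactSupport p) :
    Integrable (fun q : 𝔼 × 𝔼 => (1 / 2) * fderiv ℝ ρ (q.2 - q.1) ((c q.2 - c q.1) (gradient p q.1))
      + ρ (q.2 - q.1) * ⟪a q.2, gradient p q.1⟫) (volume.prod μ) ∧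
    ∫ q : 𝔼 × 𝔼, ((1 / 2) * fderiv ℝ ρ (q.2 - q.1) ((c q.2 - c q.1) (gradient p q.1))
      + ρ (q.2 - q.1) * ⟪a q.2, gradient p q.1⟫) ∂(volume.prod μ) =
    (1 / 2) * ∫ x, fderiv ℝ (smoothed μ ρ) x (c x (gradient p x)) := by
  have hg := continuous_gradient hp
  have hgc := hasCompactSupport_gradient hpc
  have hρ1 : ContDiff ℝ 1 ρ := hρ.of_le (by simp)
  have hd : Continuous (fderiv ℝ ρ) := hρ.continuous_fderiv (by simp)
  have hρ' := hρ.continuous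
  have hdc : HasCompactSupport (fderiv ℝ ρ) := hρc.fderiv ℝ
  obtain ⟨C, hC0, hC⟩ := exists_bound_of_compactSupport hd hdc
  obtain ⟨C', hC0', hC'⟩ := exists_bound_of_compactSupport hρ' hρc
  obtain ⟨P, hP, hPc, -, h1, h2⟩ := mollified_test hp hpc hρ hρc
  have hgi := integrable_of_compactSupport hg hgc
  have hgn : Integrable (fun q : 𝔼 × 𝔼 => ‖gradient p q.1‖) (volume.prod μ) := by
    simpa only [mul_one] using hgi.norm.mul_prod (integrable_const (1 : ℝ) (μ := μ))
  have I1 : Integrable (fun q : 𝔼 × 𝔼 => fderiv ℝ ρ (q.2 - q.1) (c q.2 (gradient p q.1)))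
      (volume.prod μ) := by
    refine (hgn.const_mul (C * Cc)).mono' (Continuous.aestronglyMeasurable ?_)
      (ae_of_all _ fun q => ?_)
    · fun_prop
    · refine (ContinuousLinearMap.le_opNorm _ _).trans ?_
      rw [mul_assoc]
      exact mul_le_mul (hC _) ((ContinuousLinearMap.le_opNorm _ _).trans
        (mul_le_mul_of_nonneg_right (hCc _) (norm_nonneg _))) (norm_nonneg _) hC0
  have I3 : Integrable (fun q : 𝔼 × 𝔼 => fderiv ℝ ρ (q.2 - q.1) (c q.1 (gradient p q.1)))
      (volume.prod μ) := by
    refine (hgn.const_mul (C * Cc)).mono' (Continuous.aestronglyMeasurable ?_)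
      (ae_of_all _ fun q => ?_)
    · fun_prop
    · refine (ContinuousLinearMap.le_opNorm _ _).trans ?_
      rw [mul_assoc]
      exact mul_le_mul (hC _) ((ContinuousLinearMap.le_opNorm _ _).trans
        (mul_le_mul_of_nonneg_right (hCc _) (norm_nonneg _))) (norm_nonneg _) hC0
  have I2 : Integrable (fun q : 𝔼 × 𝔼 => ρ (q.2 - q.1) * ⟪a q.2, gradient p q.1⟫)
      (volume.prod μ) := by
    refine ((hgi.norm.mul_prod ha.norm).const_mul C').mono' ?_ (ae_of_all _ fun q => ?_)
    · refine AEStronglyMeasurable.mul (Continuous.aestronglyMeasurable (by fun_prop)) ?_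
      exact ha.aestronglyMeasurable.comp_snd.inner hgi.aestronglyMeasurable.comp_fst
    · rw [norm_mul]
      refine mul_le_mul (hC' _) ((norm_inner_le_norm _ _).trans (mul_comm _ _).le)
        (norm_nonneg _) hC0'
  have I12 : Integrable (fun q : 𝔼 × 𝔼 => (1 / 2) * fderiv ℝ ρ (q.2 - q.1)
      (c q.2 (gradient p q.1)) + ρ (q.2 - q.1) * ⟪a q.2, gradient p q.1⟫) (volume.prod μ) :=
    (I1.const_mul _).add I2
  have J12 : ∫ q : 𝔼 × 𝔼, ((1 / 2) * fderiv ℝ ρ (q.2 - q.1) (c q.2 (gradient p q.1)) +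
      ρ (q.2 - q.1) * ⟪a q.2, gradient p q.1⟫) ∂(volume.prod μ) = 0 := by
    rw [integral_prod_symm _ I12, ← hst P hP hPc]
    congr 1; ext1 y
    rw [diffGen_mollified hp hpc hρ h1 h2]
  have J3 : ∫ q : 𝔼 × 𝔼, fderiv ℝ ρ (q.2 - q.1) (c q.1 (gradient p q.1)) ∂(volume.prod μ)
      = - ∫ x, fderiv ℝ (smoothed μ ρ) x (c x (gradient p x)) := by
    rw [integral_prod _ I3, ← integral_neg]
    congr 1; ext1 x
    rw [fderiv_smoothed hρ1 hρc, neg_neg]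
  have key : (fun q : 𝔼 × 𝔼 => (1 / 2) * fderiv ℝ ρ (q.2 - q.1) ((c q.2 - c q.1) (gradient p q.1))
      + ρ (q.2 - q.1) * ⟪a q.2, gradient p q.1⟫) = fun q => ((1 / 2) * fderiv ℝ ρ (q.2 - q.1) (c q.2 (gradient p q.1)) +
      ρ (q.2 - q.1) * ⟪a q.2, gradient p q.1⟫) - (1 / 2) * fderiv ℝ ρ (q.2 - q.1) (c q.1 (gradient p q.1)) := by
    ext1 q
    rw [sub_apply, map_sub]; ring
  rw [key]
  refine ⟨I12.sub (I3.const_mul _), ?_⟩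
  rw [integral_sub I12 (I3.const_mul _)]
  rw [J12, integral_const_mul, J3]; ring

theorem integrable_mul_translate {μ : Measure 𝔼} [IsFiniteMeasure μ] {ρ b : 𝔼 → ℝ}
    (hρ : Continuous ρ) (hρc : HasCompactSupport ρ) (hb : Integrable b volume) :
    Integrable (fun q : 𝔼 × 𝔼 => b q.1 * ρ (q.2 - q.1)) (volume.prod μ) := by
  obtain ⟨C, -, hC⟩ := exists_bound_of_compactSupport hρ hρc
  have := hb.mul_prod (integrable_const (1 : ℝ) (μ := μ))
  simp only [mul_one] at this
  exact this.mul_bdd (c := C) (Continuous.aestronglyMeasurable (by fun_prop))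
    (ae_of_all _ fun q => hC _)

/-- Truncation of `τ ↦ 1 / τ²` vanishing for `τ ≤ δ`. -/
noncomputable def invSqCut (δ τ : ℝ) : ℝ := max (τ - δ) 0 / (max τ δ) ^ 3

theorem continuous_invSqCut {δ : ℝ} (hδ : 0 < δ) : Continuous (invSqCut δ) := by
  unfold invSqCut
  refine Continuous.div (by fun_prop) (by fun_prop) fun τ => ?_
  have : 0 < max τ δ := lt_max_of_lt_right hδ
  positivity

theorem invSqCut_nonneg {δ : ℝ} (hδ : 0 < δ) (τ : ℝ) : 0 ≤ invSqCut δ τ := by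
  unfold invSqCut
  have : 0 < max τ δ := lt_max_of_lt_right hδ
  positivity

theorem invSqCut_eq_zero {δ τ : ℝ} (h : τ ≤ δ) : invSqCut δ τ = 0 := by
  unfold invSqCut
  rw [max_eq_right (by linarith)]; simp

theorem invSqCut_mul_sq_le {δ : ℝ} (hδ : 0 < δ) {τ : ℝ} : τ * invSqCut δ τ * τ ≤ 1 := by
  rcases le_total τ δ with h | h
  · rw [invSqCut_eq_zero h]; simp
  · have hτ : 0 < τ := hδ.trans_le h
    unfold invSqCut
    rw [max_eq_left h, max_eq_left (by linarith)]
    have : τ * ((τ - δ) / τ ^ 3) * τ = (τ - δ) / τ := by field_simp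
    rw [this, div_le_one hτ]; linarith

/-- A compactly supported `C¹` function of a smoothed density with prescribed gradient. -/
theorem exists_cut_log {m : 𝔼 → ℝ} (hm : ContDiff ℝ 1 m)
    (hm0 : Tendsto m (cocompact 𝔼) (𝓝 0)) {δ : ℝ} (hδ : 0 < δ) :
    ∃ p : 𝔼 → ℝ, ContDiff ℝ 1 p ∧ HasCompactSupport p ∧
      ∀ x, gradient p x = (m x * invSqCut δ (m x)) • gradient m x := by
  have hc : Continuous fun τ => τ * invSqCut δ τ := continuous_id.mul (continuous_invSqCut hδ)
  set F : ℝ → ℝ := fun τ => ∫ r in (0 : ℝ)..τ, r * invSqCut δ r with hF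
  have hFd : ∀ τ, HasDerivAt F (τ * invSqCut δ τ) τ := fun τ =>
    intervalIntegral.integral_hasDerivAt_right (hc.intervalIntegrable _ _)
      (hc.stronglyMeasurableAtFilter _ _) hc.continuousAt
  have hF1 : ContDiff ℝ 1 F := by
    rw [contDiff_one_iff_deriv]
    refine ⟨fun τ => (hFd τ).differentiableAt, ?_⟩
    rw [show deriv F = _ from funext fun τ => (hFd τ).deriv]
    exact hc
  have hF0 : ∀ τ, τ ≤ δ → F τ = 0 := fun τ hτ => by
    rw [hF]
    refine intervalIntegral.integral_zero_ae (ae_of_all _ fun r hr => ?_)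
    rw [invSqCut_eq_zero, mul_zero]
    rcases Set.mem_uIoc.1 hr with h | h <;> linarith [h.1, h.2]
  refine ⟨fun x => F (m x), hF1.comp hm, ?_, fun x => ?_⟩
  · have h1 : ∀ᶠ x in cocompact 𝔼, m x < δ := hm0.eventually_lt_const hδ
    obtain ⟨S, hS, hS'⟩ := mem_cocompact.1 h1
    refine HasCompactSupport.intro hS fun x hx => hF0 _ ?_
    exact le_of_lt (hS' hx)
  · have h2 := (hFd (m x)).comp_hasFDerivAt x (hm.differentiable (by simp) x).hasFDerivAt
    unfold gradient
    have h3 : fderiv ℝ (fun x => F (m x)) x = (m x * invSqCut δ (m x)) • fderiv ℝ m x := h2.fderiv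
    rw [h3]
    exact map_smul (InnerProductSpace.toDual ℝ 𝔼).symm _ _

theorem fisher_pointwise {θ f m G z H : ℝ} (hθ : 0 < θ) (hf : 0 ≤ f)
    (hfm : m * f * m ≤ 1) :
    (m * f) * G * z * H ≤ θ / 4 * (f * G ^ 2) * z ^ 2 + 1 / θ * H ^ 2 := by
  have h1 : (m * f) * G * z * H ≤ θ / 4 * (f * G ^ 2) * z ^ 2 + 1 / θ * (m * f * m) * H ^ 2 := by
    have : θ / 4 * (f * G ^ 2) * z ^ 2 + 1 / θ * (m * f * m) * H ^ 2 - (m * f) * G * z * H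
      = f / θ * (θ / 2 * G * z - m * H) ^ 2 := by field_simp; ring
    have h2 : 0 ≤ f / θ * (θ / 2 * G * z - m * H) ^ 2 := by positivity
    linarith
  have h3 : 1 / θ * (m * f * m) * H ^ 2 ≤ 1 / θ * 1 * H ^ 2 := by gcongr
  linarith

/-- Bound on the (truncated) Fisher information of a smoothed stationary measure. -/
theorem fisher_bound {μ : Measure 𝔼} [IsProbabilityMeasure μ]
    {c : 𝔼 → (𝔼 →L[ℝ] 𝔼)} {a : 𝔼 → 𝔼} {Cc K θ : ℝ} (hCc : ∀ x, ‖c x‖ ≤ Cc)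
    (hK : ∀ x y, ‖c y - c x‖ ≤ K * ‖y - x‖) (hc : Continuous c)
    (hθ : 0 < θ) (hell : ∀ x v, θ * ‖v‖ ^ 2 ≤ ⟪c x v, v⟫)
    (ha : Integrable a μ) (ha2 : Integrable (fun x => ‖a x‖ ^ 2) μ)
    (hst : ∀ p : 𝔼 → ℝ, ContDiff ℝ (⊤ : ℕ∞) p → HasCompactSupport p →
      ∫ x, diffGen c a p x ∂μ = 0)
    {ζ : 𝔼 → ℝ} (hζ : ContDiff ℝ (⊤ : ℕ∞) ζ) (hζc : HasCompactSupport ζ) {δ : ℝ} (hδ : 0 < δ) :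
    let m := smoothed μ (fun x => ζ x ^ 2)
    Integrable (fun x => m x * invSqCut δ (m x) * ‖gradient m x‖ ^ 2) ∧
    ∫ x, m x * invSqCut δ (m x) * ‖gradient m x‖ ^ 2 ≤
      4 / θ ^ 2 * (2 * K ^ 2 * (∫ z, ‖z‖ ^ 2 * ‖fderiv ℝ ζ z‖ ^ 2) +
        2 * ((∫ z, ζ z ^ 2) * ∫ x, ‖a x‖ ^ 2 ∂μ)) := by
  intro m
  set ρ : 𝔼 → ℝ := fun x => ζ x ^ 2 with hρdef
  have hζ1 : ContDiff ℝ 1 ζ := hζ.of_le (by simp)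
  have hζC := hζ.continuous
  have hdζ : Continuous (fderiv ℝ ζ) := hζ.continuous_fderiv (by simp)
  have hdζc : HasCompactSupport (fderiv ℝ ζ) := hζc.fderiv ℝ
  have hρ : ContDiff ℝ (⊤ : ℕ∞) ρ := hζ.pow 2
  have hρ1 : ContDiff ℝ 1 ρ := hρ.of_le (by simp)
  have hρc : HasCompactSupport ρ := hζc.comp_left (g := fun t => t ^ 2) (by simp)
  have hρi := integrable_of_compactSupport hρ.continuous hρc
  have hm : ContDiff ℝ 1 m := contDiff_smoothed hρ1 hρc
  have hmC := hm.continuous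
  have hm0 : ∀ x, 0 ≤ m x := smoothed_nonneg fun x => sq_nonneg _
  have hG : Continuous (fun x => gradient m x) := continuous_gradient hm
  obtain ⟨p, hp, hpc, hpg⟩ := exists_cut_log hm (tendsto_smoothed hρ.continuous hρc) hδ
  obtain ⟨hint, hid⟩ := stationary_mollified_identity hc hCc ha hst hρ hρc hp hpc
  have hfC : Continuous fun x => invSqCut δ (m x) := (continuous_invSqCut hδ).comp hmC
  have hfc : HasCompactSupport fun x => invSqCut δ (m x) := by
    have h1 : ∀ᶠ x in cocompact 𝔼, m x < δ :=
      (tendsto_smoothed hρ.continuous hρc).eventually_lt_const hδ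
    obtain ⟨S, hS, hS'⟩ := mem_cocompact.1 h1
    exact HasCompactSupport.intro hS fun x hx => invSqCut_eq_zero (le_of_lt (hS' hx))
  set b : 𝔼 → ℝ := fun x => invSqCut δ (m x) * ‖gradient m x‖ ^ 2 with hb
  have hbi : Integrable b volume :=
    integrable_of_compactSupport (by fun_prop) hfc.mul_right
  have hbmi : Integrable (fun x => b x * m x) volume :=
    integrable_of_compactSupport (by fun_prop) hfc.mul_right.mul_right
  have hfun : (fun x => m x * invSqCut δ (m x) * ‖gradient m x‖ ^ 2) = fun x => b x * m x := by
    ext x; simp only [hb]; ring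
  rw [hfun]
  refine ⟨hbmi, ?_⟩
  set W : 𝔼 → ℝ := fun z => ‖z‖ ^ 2 * ‖fderiv ℝ ζ z‖ ^ 2 with hW
  have hWi : Integrable W volume := by
    refine integrable_of_compactSupport (by fun_prop) ?_
    refine hdζc.mono fun x hx => ?_
    contrapose! hx
    simp only [Function.mem_support, not_not] at hx ⊢
    simp [hW, hx]
  -- lower bound of the left-hand side
  have hlow : θ * ∫ x, b x * m x ≤ ∫ x, fderiv ℝ m x (c x (gradient p x)) := by
    rw [← integral_const_mul]
    have hfd : ∀ x, fderiv ℝ m x (c x (gradient p x)) =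
        (m x * invSqCut δ (m x)) * ⟪c x (gradient m x), gradient m x⟫ := fun x => by
      rw [hpg, map_smul, map_smul, smul_eq_mul, real_inner_comm, inner_gradient_left]
    simp only [hfd]
    refine integral_mono (hbmi.const_mul _) ?_ fun x => ?_
    · refine integrable_of_compactSupport (by fun_prop) ?_
      exact (hfc.mul_left (f := m)).mul_right
    · have h0 : 0 ≤ m x * invSqCut δ (m x) := mul_nonneg (hm0 x) (invSqCut_nonneg hδ _)
      have := mul_le_mul_of_nonneg_left (hell x (gradient m x)) h0
      simp only [hb]
      linarith
  -- upper bound of the right-hand side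
  have T1 : Integrable (fun q : 𝔼 × 𝔼 => b q.1 * ρ (q.2 - q.1)) (volume.prod μ) :=
    integrable_mul_translate hρ.continuous hρc hbi
  have T2 : Integrable (fun q : 𝔼 × 𝔼 => W (q.2 - q.1) * 1) (volume.prod μ) :=
    integrable_prod_translate hWi (integrable_const 1)
  have T3 : Integrable (fun q : 𝔼 × 𝔼 => ρ (q.2 - q.1) * ‖a q.2‖ ^ 2) (volume.prod μ) :=
    integrable_prod_translate hρi ha2
  have e1 : ∫ q : 𝔼 × 𝔼, b q.1 * ρ (q.2 - q.1) ∂(volume.prod μ) = ∫ x, b x * m x := by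
    rw [integral_prod _ T1]
    simp only [integral_const_mul]; rfl
  have e2 := integral_prod_translate (μ := μ) hWi (integrable_const (1 : ℝ))
  have e3 := integral_prod_translate (μ := μ) hρi ha2
  have hup : ∫ q : 𝔼 × 𝔼, ((1 / 2) * fderiv ℝ ρ (q.2 - q.1) ((c q.2 - c q.1) (gradient p q.1))
      + ρ (q.2 - q.1) * ⟪a q.2, gradient p q.1⟫) ∂(volume.prod μ) ≤
      ∫ q : 𝔼 × 𝔼, (θ / 4 * (b q.1 * ρ (q.2 - q.1)) + (2 * K ^ 2 / θ * (W (q.2 - q.1) * 1) +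
        2 / θ * (ρ (q.2 - q.1) * ‖a q.2‖ ^ 2))) ∂(volume.prod μ) := by
    refine integral_mono hint ((T1.const_mul _).add ((T2.const_mul _).add (T3.const_mul _)))
      fun q => ?_
    obtain ⟨x, y⟩ := q
    simp only
    set w := y - x with hw
    have hdρ : ∀ v, fderiv ℝ ρ w v = 2 * ζ w * fderiv ℝ ζ w v := fun v => by
      have h1 := (hζ1.differentiable (by simp) w).hasFDerivAt.pow 2
      rw [show fderiv ℝ ρ w = _ from h1.fderiv]
      simp
    set f := invSqCut δ (m x)
    have hf0 : 0 ≤ f := invSqCut_nonneg hδ _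
    set G := gradient m x
    have hL : (1 / 2) * fderiv ℝ ρ w ((c y - c x) (gradient p x)) + ρ w * ⟪a y, gradient p x⟫ ≤
        (m x * f) * ‖G‖ * |ζ w| * (K * ‖w‖ * ‖fderiv ℝ ζ w‖ + |ζ w| * ‖a y‖) := by
      rw [hdρ, hpg, map_smul, map_smul, inner_smul_right, smul_eq_mul]
      have h0 : 0 ≤ m x * f := mul_nonneg (hm0 x) hf0
      have s1 : ζ w * fderiv ℝ ζ w ((c y - c x) G) ≤ |ζ w| * (‖fderiv ℝ ζ w‖ * (K * ‖w‖ * ‖G‖)) := by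
        refine (le_abs_self _).trans ?_
        rw [abs_mul]
        refine mul_le_mul_of_nonneg_left ?_ (abs_nonneg _)
        refine ((fderiv ℝ ζ w).le_opNorm _).trans ?_
        refine mul_le_mul_of_nonneg_left ?_ (norm_nonneg _)
        exact ((c y - c x).le_opNorm _).trans (mul_le_mul_of_nonneg_right (hK _ _) (norm_nonneg _))
      have s2 : ρ w * ⟪a y, G⟫ ≤ |ζ w| ^ 2 * (‖a y‖ * ‖G‖) := by
        rw [sq_abs]
        exact mul_le_mul_of_nonneg_left (real_inner_le_norm _ _) (sq_nonneg _)
      have s3 := mul_le_mul_of_nonneg_left (add_le_add s1 s2) h0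
      refine le_trans (le_of_eq ?_) (s3.trans (le_of_eq ?_)) <;> ring
    refine hL.trans ((fisher_pointwise hθ hf0 (invSqCut_mul_sq_le hδ)).trans ?_)
    have hH : (K * ‖w‖ * ‖fderiv ℝ ζ w‖ + |ζ w| * ‖a y‖) ^ 2 ≤
        2 * K ^ 2 * W w + 2 * (ρ w * ‖a y‖ ^ 2) := by
      simp only [hW, hρdef]
      rw [← sq_abs (ζ w)]
      nlinarith [sq_nonneg (K * ‖w‖ * ‖fderiv ℝ ζ w‖ - |ζ w| * ‖a y‖)]
    have := mul_le_mul_of_nonneg_left hH (by positivity : 0 ≤ 1 / θ)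
    rw [sq_abs]
    simp only [hb, hρdef] at this ⊢
    refine (add_le_add_right this _).trans (le_of_eq ?_)
    ring
  have T23 : Integrable (fun q : 𝔼 × 𝔼 => 2 * K ^ 2 / θ * (W (q.2 - q.1) * 1) +
      2 / θ * (ρ (q.2 - q.1) * ‖a q.2‖ ^ 2)) (volume.prod μ) :=
    (T2.const_mul _).add (T3.const_mul _)
  rw [integral_add (T1.const_mul _) T23, integral_add (T2.const_mul _) (T3.const_mul _), integral_const_mul, integral_const_mul,
    integral_const_mul, e1, e2, e3, hid] at hup
  simp only [integral_const, smul_eq_mul, mul_one, probReal_univ] at hup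
  set I := ∫ x, b x * m x
  set A2 := ∫ x, ‖a x‖ ^ 2 ∂μ
  have h5 : θ / 4 * I ≤ 1 / θ * (2 * K ^ 2 * (∫ z, W z) + 2 * ((∫ z, ρ z) * A2)) := by
    have : 1 / θ * (2 * K ^ 2 * (∫ z, W z) + 2 * ((∫ z, ρ z) * A2)) =
      2 * K ^ 2 / θ * (∫ z, W z) + 2 / θ * ((∫ z, ρ z) * A2) := by ring
    rw [this]
    linarith
  have h6 := mul_le_mul_of_nonneg_left h5 (by positivity : 0 ≤ 4 / θ)
  have h7 : 4 / θ * (θ / 4 * I) = I := by field_simp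
  rw [h7] at h6
  refine h6.trans (le_of_eq ?_)
  field_simp

theorem tendsto_invSqCut {τ : ℝ} (hτ : 0 < τ) :
    Tendsto (fun n : ℕ => τ * invSqCut (1 / ((n : ℝ) + 1)) τ * τ) atTop (𝓝 1) := by
  have h1 : Tendsto (fun n : ℕ => (τ - 1 / ((n : ℝ) + 1)) / τ) atTop (𝓝 1) := by
    have := ((tendsto_const_nhds (x := τ)).sub (tendsto_one_div_add_atTop_nhds_zero_nat (𝕜 := ℝ))).div_const τ
    simpa [div_self hτ.ne'] using this
  refine h1.congr' ?_
  filter_upwards [(tendsto_one_div_add_atTop_nhds_zero_nat (𝕜 := ℝ)).eventually_lt_const hτ] with n hn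
  unfold invSqCut
  rw [max_eq_left hn.le, max_eq_left (by linarith)]
  field_simp

theorem fderiv_estimate_of_fisher {m : 𝔼 → ℝ} (hm : ContDiff ℝ 1 m) (hm0 : ∀ x, 0 ≤ m x) {I : ℝ}
    (hI : ∀ δ : ℝ, 0 < δ → Integrable (fun x => m x * invSqCut δ (m x) * ‖gradient m x‖ ^ 2) ∧
      ∫ x, m x * invSqCut δ (m x) * ‖gradient m x‖ ^ 2 ≤ I)
    {η : 𝔼 → ℝ} (hη : Continuous η) (hηc : HasCompactSupport η) (v : 𝔼) {κ : ℝ} (hκ : 0 < κ) :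
    ∫ x, η x * fderiv ℝ m x v ≤ κ * (∫ x, η x ^ 2 * m x) + ‖v‖ ^ 2 * I / (4 * κ) := by
  have hmC := hm.continuous
  have hd : Continuous (fderiv ℝ m) := hm.continuous_fderiv (by simp)
  have hi : Integrable (fun x => η x * fderiv ℝ m x v) volume :=
    integrable_of_compactSupport (by fun_prop) hηc.mul_right
  have hηsc : HasCompactSupport fun x => η x ^ 2 := hηc.comp_left (g := fun t => t ^ 2) (by simp)
  have hi2 : Integrable (fun x => η x ^ 2 * m x) volume :=
    integrable_of_compactSupport (by fun_prop) hηsc.mul_right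
  set δ : ℕ → ℝ := fun n => 1 / ((n : ℝ) + 1) with hδ
  have hδ0 : ∀ n, 0 < δ n := fun n => by simp only [hδ]; positivity
  have hw1 : ∀ n x, |m x * invSqCut (δ n) (m x) * m x| ≤ 1 := fun n x => by
    rw [abs_of_nonneg]
    · exact invSqCut_mul_sq_le (hδ0 n)
    · exact mul_nonneg (mul_nonneg (hm0 x) (invSqCut_nonneg (hδ0 n) _)) (hm0 x)
  have hcn : ∀ n, Continuous fun x => m x * invSqCut (δ n) (m x) * m x := fun n =>
    (hmC.mul ((continuous_invSqCut (hδ0 n)).comp hmC)).mul hmC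
  have hlim : Tendsto (fun n => ∫ x, (m x * invSqCut (δ n) (m x) * m x) * (η x * fderiv ℝ m x v))
      atTop (𝓝 (∫ x, η x * fderiv ℝ m x v)) := by
    refine tendsto_integral_of_dominated_convergence (fun x => ‖η x * fderiv ℝ m x v‖)
      (fun n => Continuous.aestronglyMeasurable ?_) hi.norm
      (fun n => ae_of_all _ fun x => ?_) (ae_of_all _ fun x => ?_)
    · exact (hcn n).mul (by fun_prop)
    · rw [norm_mul]
      exact mul_le_of_le_one_left (norm_nonneg _) (hw1 n x)
    · rcases (hm0 x).eq_or_lt with h | h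
      · have : fderiv ℝ m x = 0 := IsLocalMin.fderiv_eq_zero
          (Eventually.of_forall fun y => by rw [← h]; exact hm0 y)
        simp [this]
      · have h1 := (tendsto_invSqCut h).mul_const (η x * fderiv ℝ m x v)
        rw [one_mul] at h1
        exact h1
  refine le_of_tendsto' hlim fun n => ?_
  obtain ⟨h1, h2⟩ := hI (δ n) (hδ0 n)
  have h3 : ∫ x, (m x * invSqCut (δ n) (m x) * m x) * (η x * fderiv ℝ m x v) ≤
      ∫ x, (κ * (η x ^ 2 * m x) + ‖v‖ ^ 2 / (4 * κ) *
        (m x * invSqCut (δ n) (m x) * ‖gradient m x‖ ^ 2)) := by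
    refine integral_mono (hi.bdd_mul (c := 1) (hcn n).aestronglyMeasurable
      (ae_of_all _ (hw1 n))) ((hi2.const_mul _).add (h1.const_mul _)) fun x => ?_
    simp only
    set φ := m x * invSqCut (δ n) (m x) with hφ
    have hφ0 : 0 ≤ φ := mul_nonneg (hm0 x) (invSqCut_nonneg (hδ0 n) _)
    have hφm := (abs_le.1 (hw1 n x)).2
    have hD : |fderiv ℝ m x v| ≤ ‖gradient m x‖ * ‖v‖ := by
      rw [← inner_gradient_left]; exact abs_real_inner_le_norm _ _
    have hA : φ * m x * (η x * fderiv ℝ m x v) ≤ φ * m x * (|η x| * (‖gradient m x‖ * ‖v‖)) := by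
      refine mul_le_mul_of_nonneg_left ?_ (mul_nonneg hφ0 (hm0 x))
      refine (le_abs_self _).trans ?_
      rw [abs_mul]
      exact mul_le_mul_of_nonneg_left hD (abs_nonneg _)
    have hB : φ * m x * (|η x| * (‖gradient m x‖ * ‖v‖)) ≤
        κ * (|η x| ^ 2 * m x) * (φ * m x) + ‖v‖ ^ 2 / (4 * κ) * (φ * ‖gradient m x‖ ^ 2) := by
      have : κ * (|η x| ^ 2 * m x) * (φ * m x) + ‖v‖ ^ 2 / (4 * κ) * (φ * ‖gradient m x‖ ^ 2) -
        φ * m x * (|η x| * (‖gradient m x‖ * ‖v‖)) =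
        φ / κ * (κ * |η x| * m x - ‖v‖ * ‖gradient m x‖ / 2) ^ 2 := by field_simp; ring
      have h0 : 0 ≤ φ / κ * (κ * |η x| * m x - ‖v‖ * ‖gradient m x‖ / 2) ^ 2 := by positivity
      linarith
    have hC : κ * (|η x| ^ 2 * m x) * (φ * m x) ≤ κ * (|η x| ^ 2 * m x) * 1 :=
      mul_le_mul_of_nonneg_left hφm (mul_nonneg hκ.le (mul_nonneg (sq_nonneg _) (hm0 x)))
    rw [sq_abs] at hB hC
    linarith
  rw [integral_add (hi2.const_mul _) (h1.const_mul _), integral_const_mul, integral_const_mul] at h3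
  have h4 : ‖v‖ ^ 2 / (4 * κ) * ∫ x, m x * invSqCut (δ n) (m x) * ‖gradient m x‖ ^ 2 ≤
      ‖v‖ ^ 2 / (4 * κ) * I := mul_le_mul_of_nonneg_left h2 (by positivity)
  have h5 : ‖v‖ ^ 2 / (4 * κ) * I = ‖v‖ ^ 2 * I / (4 * κ) := by ring
  linarith

/-- Square-normalised mollifiers with scale-invariant first moment of the gradient. -/
theorem exists_sq_mollifier : ∃ M : ℝ, ∀ ε : ℝ, 0 < ε → ∃ ζ : 𝔼 → ℝ,
    ContDiff ℝ (⊤ : ℕ∞) ζ ∧ HasCompactSupport ζ ∧ (∀ z, ε ≤ ‖z‖ → ζ z = 0) ∧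
    (∫ z, ζ z ^ 2 = 1) ∧ ∫ z, ‖z‖ ^ 2 * ‖fderiv ℝ ζ z‖ ^ 2 ≤ M := by
  let B : ContDiffBump (0 : 𝔼) := ⟨1 / 2, 1, by norm_num, by norm_num⟩
  have hB : ContDiff ℝ (⊤ : ℕ∞) B := B.contDiff
  have hBc : HasCompactSupport B := B.hasCompactSupport
  have hBi : Integrable (fun z => B z ^ 2) volume :=
    integrable_of_compactSupport (B.continuous.pow 2) (hBc.comp_left (g := fun t => t ^ 2) (by simp))
  have hZ : 0 < ∫ z : 𝔼, B z ^ 2 := by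
    rw [integral_pos_iff_support_of_nonneg (fun z => sq_nonneg _) hBi]
    have hs : Function.support (fun z : 𝔼 => B z ^ 2) = Metric.ball 0 1 := by
      rw [← B.support_eq]; ext z; simp
    rw [hs]
    exact Metric.measure_ball_pos _ _ one_pos
  set Z := ∫ z : 𝔼, B z ^ 2 with hZdef
  set M := ∫ z : 𝔼, ‖z‖ ^ 2 * ‖fderiv ℝ B z‖ ^ 2 with hM
  refine ⟨M / Z, fun ε hε => ?_⟩
  set d := Module.finrank ℝ 𝔼
  set s := √(Z * ε ^ d) with hs
  have hs0 : 0 < s := Real.sqrt_pos.2 (by positivity)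
  have hs2 : s ^ 2 = Z * ε ^ d := Real.sq_sqrt (by positivity)
  have hBd : ∀ z, HasFDerivAt (fun z => s⁻¹ * B (ε⁻¹ • z)) ((s⁻¹ * ε⁻¹) • fderiv ℝ B (ε⁻¹ • z)) z := by
    intro z
    have h1 := (hB.differentiable (by simp) (ε⁻¹ • z)).hasFDerivAt
    have h2 : HasFDerivAt (fun z : 𝔼 => ε⁻¹ • z) (ε⁻¹ • ContinuousLinearMap.id ℝ 𝔼) z :=
      (ε⁻¹ • ContinuousLinearMap.id ℝ 𝔼).hasFDerivAt
    have h3 := (h1.comp z h2).const_mul s⁻¹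
    refine h3.congr_fderiv ?_
    ext v; simp; ring
  refine ⟨fun z => s⁻¹ * B (ε⁻¹ • z), ?_, ?_, ?_, ?_, ?_⟩
  · exact contDiff_const.mul (hB.comp (contDiff_const_smul _))
  · have : HasCompactSupport fun z : 𝔼 => B (ε⁻¹ • z) := hBc.comp_smul (inv_ne_zero hε.ne')
    exact this.mul_left
  · intro z hz
    show s⁻¹ * B (ε⁻¹ • z) = 0
    rw [B.zero_of_le_dist, mul_zero]
    rw [dist_zero_right, norm_smul, norm_inv, Real.norm_of_nonneg hε.le]
    show 1 ≤ ε⁻¹ * ‖z‖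
    rw [inv_mul_eq_div, le_div_iff₀ hε]; linarith
  · simp only [mul_pow]
    rw [integral_const_mul, Measure.integral_comp_inv_smul_of_nonneg volume (fun z => B z ^ 2) hε.le,
      inv_pow, hs2, smul_eq_mul, ← hZdef]
    have : ε ^ d ≠ 0 := by positivity
    field_simp
    rfl
  · refine le_of_eq ?_
    have h4 : ∀ z : 𝔼, ‖z‖ ^ 2 * ‖fderiv ℝ (fun z => s⁻¹ * B (ε⁻¹ • z)) z‖ ^ 2 =
        (s ^ 2)⁻¹ * (fun z : 𝔼 => ‖z‖ ^ 2 * ‖fderiv ℝ B z‖ ^ 2) (ε⁻¹ • z) := by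
      intro z
      rw [(hBd z).fderiv]
      simp only [norm_smul, norm_mul, norm_inv, Real.norm_of_nonneg hε.le, Real.norm_of_nonneg hs0.le]
      ring
    simp only [h4]
    rw [integral_const_mul, Measure.integral_comp_inv_smul_of_nonneg volume
      (fun z : 𝔼 => ‖z‖ ^ 2 * ‖fderiv ℝ B z‖ ^ 2) hε.le, hs2, smul_eq_mul, ← hM]
    have : ε ^ d ≠ 0 := by positivity
    field_simp
    rfl

/-- `μ` has mollifications with uniformly bounded Fisher information, in a dual formulation. -/
def FisherApprox (μ : Measure 𝔼) (C : ℝ) : Prop :=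
  ∀ ε : ℝ, 0 < ε → ∃ ρ : 𝔼 → ℝ, ContDiff ℝ (⊤ : ℕ∞) ρ ∧ HasCompactSupport ρ ∧ (∀ z, 0 ≤ ρ z) ∧
    (∀ z, ε ≤ ‖z‖ → ρ z = 0) ∧ (∫ z, ρ z = 1) ∧
    ∀ η : 𝔼 → ℝ, Continuous η → HasCompactSupport η → ∀ v : 𝔼, ∀ κ : ℝ, 0 < κ →
      ∫ x, η x * fderiv ℝ (smoothed μ ρ) x v ≤
        κ * (∫ x, η x ^ 2 * smoothed μ ρ x) + ‖v‖ ^ 2 * C / κ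

theorem exists_fisherApprox {μ : Measure 𝔼} [IsProbabilityMeasure μ]
    {c : 𝔼 → (𝔼 →L[ℝ] 𝔼)} {a : 𝔼 → 𝔼} {Cc K θ : ℝ} (hCc : ∀ x, ‖c x‖ ≤ Cc)
    (hK : ∀ x y, ‖c y - c x‖ ≤ K * ‖y - x‖) (hc : Continuous c)
    (hθ : 0 < θ) (hell : ∀ x v, θ * ‖v‖ ^ 2 ≤ ⟪c x v, v⟫)
    (ha : Integrable a μ) (ha2 : Integrable (fun x => ‖a x‖ ^ 2) μ)
    (hst : ∀ p : 𝔼 → ℝ, ContDiff ℝ (⊤ : ℕ∞) p → HasCompactSupport p →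
      ∫ x, diffGen c a p x ∂μ = 0) : ∃ C : ℝ, 0 ≤ C ∧ FisherApprox μ C := by
  obtain ⟨M, hM⟩ := exists_sq_mollifier (l := l)
  have hM0 : 0 ≤ M := by
    obtain ⟨ζ, -, -, -, -, h⟩ := hM 1 one_pos
    exact (integral_nonneg fun z => by positivity).trans h
  set A2 := ∫ x, ‖a x‖ ^ 2 ∂μ
  have hA2 : 0 ≤ A2 := integral_nonneg fun x => by positivity
  refine ⟨1 / θ ^ 2 * (2 * K ^ 2 * M + 2 * A2), by positivity, fun ε hε => ?_⟩
  obtain ⟨ζ, h1, h2, h3, h4, h5⟩ := hM ε hε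
  have hρ : ContDiff ℝ (⊤ : ℕ∞) fun z => ζ z ^ 2 := h1.pow 2
  have hρc : HasCompactSupport fun z => ζ z ^ 2 := h2.comp_left (g := fun t => t ^ 2) (by simp)
  refine ⟨fun z => ζ z ^ 2, hρ, hρc, fun z => sq_nonneg _, fun z hz => by simp [h3 z hz], h4,
    fun η hη hηc v κ hκ => ?_⟩
  have hm : ContDiff ℝ 1 (smoothed μ fun z => ζ z ^ 2) :=
    contDiff_smoothed (hρ.of_le (by simp)) hρc
  refine (fderiv_estimate_of_fisher hm (smoothed_nonneg fun z => sq_nonneg _)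
    (I := 4 / θ ^ 2 * (2 * K ^ 2 * M + 2 * A2)) (fun δ hδ => ?_) hη hηc v hκ).trans
    (le_of_eq ?_)
  · obtain ⟨i1, i2⟩ := fisher_bound hCc hK hc hθ hell ha ha2 hst h1 h2 hδ
    refine ⟨i1, i2.trans ?_⟩
    rw [h4, one_mul]
    gcongr
  · field_simp

theorem integral_fderiv_mul_eq {m η : 𝔼 → ℝ} (hm : ContDiff ℝ 1 m) (hη : ContDiff ℝ 1 η)
    (hηc : HasCompactSupport η) (v : 𝔼) :
    ∫ x, m x * fderiv ℝ η x v = - ∫ x, η x * fderiv ℝ m x v := by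
  have hmC := hm.continuous
  have hηC := hη.continuous
  have hd : Continuous (fderiv ℝ m) := hm.continuous_fderiv (by simp)
  have hdη : Continuous (fderiv ℝ η) := hη.continuous_fderiv (by simp)
  have hdηc : HasCompactSupport fun x => fderiv ℝ η x v :=
    (hηc.fderiv ℝ).comp_left (g := fun (L : 𝔼 →L[ℝ] ℝ) => L v) (by simp)
  rw [integral_mul_fderiv_eq_neg_fderiv_mul_of_integrable]
  · simp only [mul_comm]
  · exact integrable_of_compactSupport (by fun_prop) hηc.mul_left
  · exact integrable_of_compactSupport (by fun_prop) hdηc.mul_left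
  · exact integrable_of_compactSupport (by fun_prop) hηc.mul_left
  · exact fun x _ => hm.differentiable (by simp) x
  · exact fun x _ => hη.differentiable (by simp) x

/-- Mollification converges on Lipschitz test functions. -/
theorem abs_integral_smoothed_sub_le {μ : Measure 𝔼} [IsProbabilityMeasure μ] {ρ η : 𝔼 → ℝ} {ε : ℝ}
    (hρ : Continuous ρ) (hρc : HasCompactSupport ρ) (hρ0 : ∀ z, 0 ≤ ρ z)
    (hρε : ∀ z, ε ≤ ‖z‖ → ρ z = 0) (hρ1 : ∫ z, ρ z = 1) (hη : Continuous η)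
    (hηc : HasCompactSupport η) {b : ℝ} (hb : ∀ x y, ‖y - x‖ ≤ ε → |η x - η y| ≤ b) :
    |(∫ x, η x * smoothed μ ρ x) - ∫ x, η x ∂μ| ≤ b := by
  have hηi : Integrable η μ := by
    simpa using integrable_translate_of_compactSupport (μ := μ) hη hηc 0
  have hi : Integrable (fun q : 𝔼 × 𝔼 => η q.1 * ρ (q.2 - q.1)) (volume.prod μ) :=
    integrable_mul_translate hρ hρc (integrable_of_compactSupport hη hηc)
  rw [integral_mul_smoothed hρ hρc hη hηc, ← integral_sub hi.integral_prod_right hηi]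
  have hpt : ∀ y, |(∫ x, η x * ρ (y - x)) - η y| ≤ b := by
    intro y
    have hρi : Integrable (fun x => ρ (y - x)) volume :=
      (integrable_of_compactSupport hρ hρc).comp_sub_left y
    have h1 : ∫ x, ρ (y - x) = 1 := by rw [integral_sub_left_eq_self ρ volume y, hρ1]
    have hci : Integrable (fun x => η x * ρ (y - x)) volume :=
      integrable_of_compactSupport (by fun_prop) hηc.mul_right
    have h2 : (∫ x, η x * ρ (y - x)) - η y = ∫ x, (η x - η y) * ρ (y - x) := by
      simp only [sub_mul]
      rw [integral_sub hci (hρi.const_mul _), integral_const_mul, h1, mul_one]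
    have hci' : Integrable (fun x => (η x - η y) * ρ (y - x)) volume := by
      simp only [sub_mul]; exact hci.sub (hρi.const_mul _)
    rw [h2]
    refine (abs_integral_le_integral_abs).trans ?_
    have h3 : ∫ x, |(η x - η y) * ρ (y - x)| ≤ ∫ x, b * ρ (y - x) := by
      refine integral_mono hci'.abs (hρi.const_mul _) fun x => ?_
      simp only [abs_mul, abs_of_nonneg (hρ0 _)]
      rcases le_total ε ‖y - x‖ with h | h
      · rw [hρε _ h]; simp
      · exact mul_le_mul_of_nonneg_right (hb _ _ h) (hρ0 _)
    rwa [integral_const_mul, h1, mul_one] at h3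
  have := norm_integral_le_of_norm_le_const (μ := μ) (f := fun y => (∫ x, η x * ρ (y - x)) - η y)
    (C := b) (ae_of_all _ hpt)
  simpa using this

theorem exists_uniform_modulus {η : 𝔼 → ℝ} (hη : Continuous η) (hηc : HasCompactSupport η)
    {b : ℝ} (hb : 0 < b) : ∃ ε : ℝ, 0 < ε ∧ ∀ x y, ‖y - x‖ ≤ ε → |η x - η y| ≤ b := by
  obtain ⟨ε, hε, h⟩ := Metric.uniformContinuous_iff.1
    (hηc.uniformContinuous_of_continuous hη) b hb
  refine ⟨ε / 2, by positivity, fun x y hxy => ?_⟩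
  have := h (a := x) (b := y) (by rw [dist_comm, dist_eq_norm]; linarith)
  rw [Real.dist_eq] at this
  exact this.le

theorem FisherApprox.fderiv_le {μ : Measure 𝔼} [IsProbabilityMeasure μ] {C : ℝ}
    (h : FisherApprox μ C) {η : 𝔼 → ℝ} (hη : ContDiff ℝ 1 η) (hηc : HasCompactSupport η)
    (v : 𝔼) {κ : ℝ} (hκ : 0 < κ) :
    ∫ x, fderiv ℝ η x v ∂μ ≤ κ * (∫ x, η x ^ 2 ∂μ) + ‖v‖ ^ 2 * C / κ := by
  have hd : Continuous (fderiv ℝ η) := hη.continuous_fderiv (by simp)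
  have hdη : Continuous fun x => fderiv ℝ η x v := by fun_prop
  have hdηc : HasCompactSupport fun x => fderiv ℝ η x v :=
    (hηc.fderiv ℝ).comp_left (g := fun (L : 𝔼 →L[ℝ] ℝ) => L v) (by simp)
  have hη2 : Continuous fun x => η x ^ 2 := hη.continuous.pow 2
  have hη2c : HasCompactSupport fun x => η x ^ 2 := hηc.comp_left (g := fun t => t ^ 2) (by simp)
  refine le_of_forall_pos_le_add fun b hb => ?_
  obtain ⟨ε1, hε1, h3⟩ := exists_uniform_modulus hdη hdηc (half_pos hb)
  obtain ⟨ε2, hε2, h4⟩ := exists_uniform_modulus hη2 hη2c (b := b / 2 / κ) (by positivity)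
  obtain ⟨ρ, hρ, hρc, hρ0, hρε, hρ1, hF⟩ := h (min ε1 ε2) (lt_min hε1 hε2)
  have hm : ContDiff ℝ 1 (smoothed μ ρ) := contDiff_smoothed (hρ.of_le (by simp)) hρc
  have h1 := hF η hη.continuous hηc (-v) κ hκ
  have h2 := integral_fderiv_mul_eq hm hη hηc v
  simp only [map_neg, mul_neg, norm_neg, integral_neg] at h1
  have h3 := abs_le.1 (abs_integral_smoothed_sub_le (μ := μ) hρ.continuous hρc hρ0 hρε hρ1
    hdη hdηc fun x y hxy => h3 x y (hxy.trans (min_le_left _ _)))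
  have h4 := abs_le.1 (abs_integral_smoothed_sub_le (μ := μ) hρ.continuous hρc hρ0 hρε hρ1
    hη2 hη2c fun x y hxy => h4 x y (hxy.trans (min_le_right _ _)))
  have h5 := mul_le_mul_of_nonneg_left h4.2 hκ.le
  have h6 : ∫ x, fderiv ℝ η x v * smoothed μ ρ x = ∫ x, smoothed μ ρ x * fderiv ℝ η x v :=
    integral_congr_ae (ae_of_all _ fun x => mul_comm _ _)
  have h7 : κ * (b / 2 / κ) = b / 2 := by field_simp
  nlinarith [h3.1, h3.2]

/-- A probability measure with `FisherApprox` has translations that are Lipschitz in total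
variation. -/
theorem FisherApprox.lipschitz_smoothed {μ : Measure 𝔼} [IsProbabilityMeasure μ] {C : ℝ}
    (h : FisherApprox μ C) {η : 𝔼 → ℝ} (hη : ContDiff ℝ 1 η) (hηc : HasCompactSupport η)
    (hη1 : ∀ x, |η x| ≤ 1) (x y : 𝔼) :
    |smoothed μ η x - smoothed μ η y| ≤ (1 + C) * ‖x - y‖ := by
  have hle : ∀ x v, - fderiv ℝ (smoothed μ η) x v ≤ (1 + C) * ‖v‖ := by
    intro x v
    rcases eq_or_ne v 0 with rfl | hv
    · simp
    rw [fderiv_smoothed hη hηc, neg_neg]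
    have hη' : ContDiff ℝ 1 fun y => η (y - x) := hη.comp (contDiff_id.sub contDiff_const)
    have hηc' : HasCompactSupport fun y => η (y - x) :=
      hηc.comp_homeomorph (Homeomorph.subRight x)
    have h1 := h.fderiv_le hη' hηc' v (norm_pos_iff.2 hv)
    simp only [fderiv_comp_sub] at h1
    refine h1.trans ?_
    have h2 : ∫ y, η (y - x) ^ 2 ∂μ ≤ 1 := by
      have := norm_integral_le_of_norm_le_const (μ := μ) (f := fun y => η (y - x) ^ 2) (C := 1)
        (ae_of_all _ fun y => by
          rw [Real.norm_eq_abs, abs_pow]; exact pow_le_one₀ (abs_nonneg _) (hη1 _))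
      simp only [probReal_univ, mul_one, Real.norm_eq_abs] at this
      exact (le_abs_self _).trans this
    have h3 : ‖v‖ ^ 2 * C / ‖v‖ = C * ‖v‖ := by
      field_simp
    rw [h3]
    nlinarith [norm_nonneg v]
  have hC : 0 ≤ 1 + C ∨ Subsingleton 𝔼 := by
    rcases subsingleton_or_nontrivial 𝔼 with hs | hs
    · exact Or.inr hs
    · obtain ⟨v, hv⟩ := exists_ne (0 : 𝔼)
      left
      have h1 := hle 0 v
      have h2 := hle 0 (-v)
      simp only [map_neg, norm_neg, neg_neg] at h2
      by_contra! hc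
      nlinarith [norm_pos_iff.2 hv]
  rcases hC with hC | hs
  · have hn : ∀ z ∈ (univ : Set 𝔼), ‖fderiv ℝ (smoothed μ η) z‖ ≤ 1 + C := by
      refine fun z _ => ContinuousLinearMap.opNorm_le_bound _ hC fun v => ?_
      rw [Real.norm_eq_abs, abs_le']
      have h2 := hle z (-v)
      simp only [map_neg, norm_neg, neg_neg] at h2
      exact ⟨h2, hle z v⟩
    have := convex_univ.norm_image_sub_le_of_norm_fderiv_le (𝕜 := ℝ)
      (fun z _ => (contDiff_smoothed (μ := μ) hη hηc).differentiable (by simp) z) hn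
      (mem_univ y) (mem_univ x)
    exact this
  · simp [Subsingleton.elim x y]

theorem integral_mul_smoothed_comm {μ : Measure 𝔼} [IsFiniteMeasure μ] {ρ η : 𝔼 → ℝ}
    (hρ : Continuous ρ) (hρc : HasCompactSupport ρ) (hη : Continuous η)
    (hηc : HasCompactSupport η) :
    ∫ x, η x * smoothed μ ρ x = ∫ x, ρ x * smoothed μ η x := by
  rw [integral_mul_smoothed hρ hρc hη hηc, integral_mul_smoothed hη hηc hρ hρc]
  congr 1
  ext1 y
  rw [← integral_sub_left_eq_self _ volume y]
  simp [mul_comm]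

theorem FisherApprox.abs_integral_smoothed_sub_le {μ : Measure 𝔼} [IsProbabilityMeasure μ]
    {C : ℝ} (h : FisherApprox μ C) (hC : 0 ≤ C) {ρ η : 𝔼 → ℝ} {ε : ℝ}
    (hρ : Continuous ρ) (hρc : HasCompactSupport ρ) (hρ0 : ∀ z, 0 ≤ ρ z)
    (hρε : ∀ z, ε ≤ ‖z‖ → ρ z = 0) (hρ1 : ∫ z, ρ z = 1) (hη : ContDiff ℝ 1 η)
    (hηc : HasCompactSupport η) (hη1 : ∀ x, |η x| ≤ 1) :
    |(∫ x, η x * smoothed μ ρ x) - ∫ x, η x ∂μ| ≤ (1 + C) * ε := by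
  have h0 : ∫ x, η x ∂μ = smoothed μ η 0 := by simp [smoothed]
  have hρi := integrable_of_compactSupport hρ hρc
  have hs : Continuous (smoothed μ η) := (contDiff_smoothed hη hηc).continuous
  have h1 : (∫ x, η x * smoothed μ ρ x) - ∫ x, η x ∂μ =
      ∫ x, ρ x * (smoothed μ η x - smoothed μ η 0) := by
    simp only [mul_sub]
    have hi : Integrable fun x => ρ x * smoothed μ η x :=
      integrable_of_compactSupport (by fun_prop) hρc.mul_right
    rw [integral_sub hi (hρi.mul_const _), integral_mul_const, hρ1, one_mul, h0,
      integral_mul_smoothed_comm hρ hρc hη.continuous hηc]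
  rw [h1]
  refine abs_integral_le_integral_abs.trans ?_
  have h3 : ∫ x, |ρ x * (smoothed μ η x - smoothed μ η 0)| ≤ ∫ x, ρ x * ((1 + C) * ε) := by
    refine integral_mono
      (integrable_of_compactSupport (by fun_prop) hρc.mul_right).abs
      (hρi.mul_const _) fun x => ?_
    simp only [abs_mul, abs_of_nonneg (hρ0 _)]
    rcases le_total ε ‖x‖ with hx | hx
    · rw [hρε _ hx]; simp
    · refine mul_le_mul_of_nonneg_left ((h.lipschitz_smoothed hη hηc hη1 x 0).trans ?_) (hρ0 _)
      rw [sub_zero]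
      gcongr
  rwa [integral_mul_const, hρ1, one_mul] at h3

theorem exists_cutoff (R : ℝ) : ∃ χ : 𝔼 → ℝ, ContDiff ℝ (⊤ : ℕ∞) χ ∧ HasCompactSupport χ ∧
    (∀ x, 0 ≤ χ x) ∧ (∀ x, χ x ≤ 1) ∧ ∀ x, ‖x‖ ≤ R → χ x = 1 := by
  let b : ContDiffBump (0 : 𝔼) := ⟨|R| + 1, |R| + 2, by positivity, by linarith⟩
  refine ⟨b, b.contDiff, b.hasCompactSupport, fun x => b.nonneg, fun x => b.le_one,
    fun x hx => b.one_of_mem_closedBall ?_⟩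
  rw [mem_closedBall_zero_iff]
  exact (hx.trans (le_abs_self R)).trans (by simp [b])

/-- Duality characterisation of the `L¹` norm of a `C¹` function. -/
theorem integral_abs_le_of_dual {f : 𝔼 → ℝ} (hf : ContDiff ℝ 1 f) (hfi : Integrable f) {b : ℝ}
    (h : ∀ η : 𝔼 → ℝ, ContDiff ℝ 1 η → HasCompactSupport η → (∀ x, |η x| ≤ 1) →
      ∫ x, η x * f x ≤ b) : ∫ x, |f x| ≤ b := by
  choose χ hχ hχc hχ0 hχ1 hχR using fun k : ℕ => exists_cutoff (l := l) k
  have hlim : Tendsto (fun k => ∫ x, χ k x * |f x|) atTop (𝓝 (∫ x, |f x|)) := by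
    refine tendsto_integral_of_dominated_convergence (fun x => |f x|)
      (fun k => ((hχ k).continuous.mul hf.continuous.abs).aestronglyMeasurable) hfi.abs
      (fun k => ae_of_all _ fun x => ?_) (ae_of_all _ fun x => ?_)
    · rw [Real.norm_eq_abs, abs_mul, abs_abs, abs_of_nonneg (hχ0 k x)]
      exact mul_le_of_le_one_left (abs_nonneg _) (hχ1 k x)
    · obtain ⟨N, hN⟩ := exists_nat_ge ‖x‖
      refine tendsto_const_nhds.congr' ?_
      filter_upwards [eventually_ge_atTop N] with k hk
      rw [hχR k x (hN.trans (by exact_mod_cast hk)), one_mul]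
  refine le_of_tendsto' hlim fun k => ?_
  have hχi := integrable_of_compactSupport (hχ k).continuous (hχc k)
  have hχI : 0 ≤ ∫ x, χ k x := integral_nonneg (hχ0 k)
  have key : ∀ δ : ℝ, 0 < δ → ∫ x, χ k x * |f x| ≤ b + δ * ∫ x, χ k x := by
    intro δ hδ
    have hpos : ∀ x, 0 < f x ^ 2 + δ ^ 2 := fun x => by positivity
    have hs : ContDiff ℝ 1 fun x => √(f x ^ 2 + δ ^ 2) :=
      ((hf.pow 2).add contDiff_const).sqrt fun x => (hpos x).ne'
    have hs0 : ∀ x, √(f x ^ 2 + δ ^ 2) ≠ 0 := fun x => (Real.sqrt_pos.2 (hpos x)).ne'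
    have hη : ContDiff ℝ 1 fun x => χ k x * (f x / √(f x ^ 2 + δ ^ 2)) :=
      ((hχ k).of_le (by simp)).mul (hf.div hs hs0)
    have hηc : HasCompactSupport fun x => χ k x * (f x / √(f x ^ 2 + δ ^ 2)) :=
      (hχc k).mul_right
    have hfc := hf.continuous
    have hχcont := (hχ k).continuous
    have h1 := h _ hη hηc fun x => by
      rw [abs_mul, abs_of_nonneg (hχ0 k x), abs_div, abs_of_pos (Real.sqrt_pos.2 (hpos x))]
      refine mul_le_one₀ (hχ1 k x) (by positivity) (div_le_one_of_le₀ ?_ (Real.sqrt_nonneg _))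
      exact Real.abs_le_sqrt (by nlinarith)
    have hi1 : Integrable fun x => χ k x * (f x / √(f x ^ 2 + δ ^ 2)) * f x :=
      integrable_of_compactSupport (hη.continuous.mul hfc) hηc.mul_right
    have h2 : ∫ x, χ k x * |f x| ≤ ∫ x, (χ k x * (f x / √(f x ^ 2 + δ ^ 2)) * f x + δ * χ k x) := by
      refine integral_mono (integrable_of_compactSupport (by fun_prop) (hχc k).mul_right)
        (hi1.add (hχi.const_mul δ)) fun x => ?_
      have h3 : |f x| ≤ f x / √(f x ^ 2 + δ ^ 2) * f x + δ := by
        have e1 := Real.sq_sqrt (hpos x).le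
        have e2 := Real.sqrt_pos.2 (hpos x)
        set s := √(f x ^ 2 + δ ^ 2)
        rw [← sub_le_iff_le_add, div_mul_eq_mul_div, le_div_iff₀ e2]
        have e3 : |f x| ^ 2 = f x ^ 2 := sq_abs _
        have e4 : s ≤ |f x| + δ := by
          refine le_of_sq_le_sq ?_ (by positivity)
          nlinarith [abs_nonneg (f x)]
        rcases le_total δ (|f x|) with hh | hh
        · nlinarith [abs_nonneg (f x)]
        · nlinarith [abs_nonneg (f x), mul_nonneg (sub_nonneg.2 hh) e2.le]
      simp only
      nlinarith [mul_le_mul_of_nonneg_left h3 (hχ0 k x)]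
    rw [integral_add hi1 (hχi.const_mul δ), integral_const_mul] at h2
    linarith
  refine le_of_forall_pos_le_add fun ε hε => ?_
  refine (key (ε / (1 + ∫ x, χ k x)) (by positivity)).trans ?_
  have : ε / (1 + ∫ x, χ k x) * ∫ x, χ k x ≤ ε := by
    rw [div_mul_eq_mul_div, div_le_iff₀ (by positivity)]
    nlinarith
  linarith

theorem FisherApprox.exists_density {μ : Measure 𝔼} [IsProbabilityMeasure μ]
    {C : ℝ} (h : FisherApprox μ C) (hC : 0 ≤ C) :
    ∃ m : 𝔼 → ℝ, Measurable m ∧ (∀ x, 0 ≤ m x) ∧ Integrable m ∧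
      μ = volume.withDensity (fun x => ENNReal.ofReal (m x)) ∧
      ∃ f : ℕ → 𝔼 → ℝ, (∀ k, ContDiff ℝ 1 (f k)) ∧ (∀ k x, 0 ≤ f k x) ∧ (∀ k, Integrable (f k)) ∧
        Tendsto (fun k => ∫ x, |f k x - m x|) atTop (𝓝 0) ∧
        ∀ k, ∀ η : 𝔼 → ℝ, Continuous η → HasCompactSupport η → ∀ v : 𝔼, ∀ κ : ℝ, 0 < κ →
          ∫ x, η x * fderiv ℝ (f k) x v ≤ κ * (∫ x, η x ^ 2 * f k x) + ‖v‖ ^ 2 * C / κ := by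
  choose ρ hρ hρc hρ0 hρε hρ1 hF using fun k : ℕ => h (1 / ((k : ℝ) + 1)) (by positivity)
  set f : ℕ → 𝔼 → ℝ := fun k => smoothed μ (ρ k) with hf
  have hf1 : ∀ k, ContDiff ℝ 1 (f k) := fun k => contDiff_smoothed ((hρ k).of_le (by simp)) (hρc k)
  have hf0 : ∀ k x, 0 ≤ f k x := fun k => smoothed_nonneg (hρ0 k)
  have hfi : ∀ k, Integrable (f k) := fun k => integrable_smoothed (hρ k).continuous (hρc k)
  have happ : ∀ k (η : 𝔼 → ℝ), ContDiff ℝ 1 η → HasCompactSupport η → (∀ x, |η x| ≤ 1) →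
      |(∫ x, η x * f k x) - ∫ x, η x ∂μ| ≤ (1 + C) * (1 / ((k : ℝ) + 1)) :=
    fun k η h1 h2 h3 => h.abs_integral_smoothed_sub_le hC (hρ k).continuous (hρc k) (hρ0 k)
      (hρε k) (hρ1 k) h1 h2 h3
  have hdist : ∀ i j, ∫ x, |f i x - f j x| ≤
      (1 + C) * (1 / ((i : ℝ) + 1)) + (1 + C) * (1 / ((j : ℝ) + 1)) := by
    refine fun i j => integral_abs_le_of_dual ((hf1 i).sub (hf1 j)) ((hfi i).sub (hfi j))
      fun η h1 h2 h3 => ?_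
    have e1 := abs_le.1 (happ i η h1 h2 h3)
    have e2 := abs_le.1 (happ j η h1 h2 h3)
    have hi : ∀ k, Integrable fun x => η x * f k x := fun k =>
      integrable_of_compactSupport (h1.continuous.mul (hf1 k).continuous) h2.mul_right
    simp only [mul_sub]
    rw [integral_sub (hi i) (hi j)]
    linarith
  have hcauchy : CauchySeq fun k => (hfi k).toL1 (f k) := by
    refine cauchySeq_of_le_tendsto_0 (fun k : ℕ => 2 * ((1 + C) * (1 / ((k : ℝ) + 1)))) ?_ ?_
    · intro i j N hi hj
      rw [dist_eq_norm, ← Integrable.toL1_sub, L1.norm_eq_integral_norm]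
      have : ∫ x, ‖((hfi i).sub (hfi j)).toL1 (f i - f j) x‖ = ∫ x, |f i x - f j x| :=
        integral_congr_ae (((hfi i).sub (hfi j)).coeFn_toL1.mono fun x hx => by
          simp only [hx]; rfl)
      rw [this]
      refine (hdist i j).trans ?_
      have e1 : 1 / ((i : ℝ) + 1) ≤ 1 / ((N : ℝ) + 1) := by gcongr
      have e2 : 1 / ((j : ℝ) + 1) ≤ 1 / ((N : ℝ) + 1) := by gcongr
      nlinarith
    · have := (tendsto_one_div_add_atTop_nhds_zero_nat (𝕜 := ℝ)).const_mul (2 * (1 + C))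
      simpa [mul_assoc] using this
  obtain ⟨m0, hm0⟩ := cauchySeq_tendsto_of_complete hcauchy
  have hmi : Integrable m0 := L1.integrable_coeFn m0
  set m : 𝔼 → ℝ := fun x => |hmi.1.mk m0 x| with hm
  have hm_meas : Measurable m := hmi.1.stronglyMeasurable_mk.measurable.abs
  have hmint : Integrable m := (hmi.congr hmi.1.ae_eq_mk).abs
  have hlim : Tendsto (fun k => ∫ x, |f k x - m x|) atTop (𝓝 0) := by
    have h1 : Tendsto (fun k => ‖(hfi k).toL1 (f k) - m0‖) atTop (𝓝 0) :=
      tendsto_iff_norm_sub_tendsto_zero.1 hm0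
    refine squeeze_zero (fun k => integral_nonneg fun x => abs_nonneg _) (fun k => ?_) h1
    rw [L1.norm_eq_integral_norm]
    refine integral_mono_ae ((hfi k).sub hmint).abs (L1.integrable_coeFn _).norm ?_
    filter_upwards [Lp.coeFn_sub ((hfi k).toL1 (f k)) m0, (hfi k).coeFn_toL1, hmi.1.ae_eq_mk]
      with x e1 e2 e3
    rw [e1, Pi.sub_apply, e2, e3]
    have := abs_abs_sub_abs_le (f k x) (hmi.1.mk m0 x)
    rwa [abs_of_nonneg (hf0 k x)] at this
  refine ⟨m, hm_meas, fun x => abs_nonneg _, hmint, ?_, f, hf1, hf0, hfi, hlim, hF⟩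
  have : IsFiniteMeasure (volume.withDensity fun x => ENNReal.ofReal (m x)) :=
    isFiniteMeasure_withDensity_ofReal hmint.2
  refine Measure.ext_of_integral_eq_on_compactlySupported fun η => ?_
  rw [integral_withDensity_eq_integral_toReal_smul (by fun_prop) (by simp)]
  have hηc := η.hasCompactSupport
  have hη : Continuous (η : 𝔼 → ℝ) := η.continuous
  obtain ⟨B, hB0, hB⟩ := exists_bound_of_compactSupport hη hηc
  have l1 : Tendsto (fun k => ∫ x, η x * f k x) atTop (𝓝 (∫ x, η x ∂μ)) := by
    rw [tendsto_iff_norm_sub_tendsto_zero, Metric.tendsto_atTop]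
    intro b hb
    obtain ⟨ε, hε, hmod⟩ := exists_uniform_modulus hη hηc (half_pos hb)
    obtain ⟨N, hN⟩ := exists_nat_one_div_lt hε
    refine ⟨N, fun k hk => ?_⟩
    have e1 : 1 / ((k : ℝ) + 1) ≤ 1 / ((N : ℝ) + 1) := by gcongr
    have := _root_.abs_integral_smoothed_sub_le (μ := μ) (hρ k).continuous (hρc k) (hρ0 k) (hρε k)
      (hρ1 k) hη hηc (b := b / 2) fun x y hxy => hmod x y (by linarith)
    rw [dist_zero_right, norm_norm, Real.norm_eq_abs]
    linarith
  have l2 : Tendsto (fun k => ∫ x, η x * f k x) atTop (𝓝 (∫ x, η x * m x)) := by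
    rw [tendsto_iff_norm_sub_tendsto_zero]
    refine squeeze_zero (fun k => norm_nonneg _) (fun k => ?_) (by simpa using hlim.const_mul B)
    have i1 : Integrable fun x => η x * f k x :=
      integrable_of_compactSupport (hη.mul (hf1 k).continuous) hηc.mul_right
    have i2 : Integrable fun x => η x * m x :=
      hmint.bdd_mul hη.aestronglyMeasurable (ae_of_all _ hB)
    rw [← integral_sub i1 i2, ← integral_const_mul]
    refine norm_integral_le_of_norm_le (((hfi k).sub hmint).abs.const_mul B)
      (ae_of_all _ fun x => ?_)
    rw [← mul_sub, norm_mul]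
    exact mul_le_mul_of_nonneg_right (hB x) (norm_nonneg _)
  rw [tendsto_nhds_unique l1 l2]
  refine integral_congr_ae (ae_of_all _ fun x => ?_)
  simp [ENNReal.toReal_ofReal (abs_nonneg _), mul_comm, hm]

/-- The space of smooth compactly supported functions. -/
def testFun (l : ℕ) : Submodule ℝ (EuclideanSpace ℝ (Fin l) → ℝ) where
  carrier := {p | ContDiff ℝ (⊤ : ℕ∞) p ∧ HasCompactSupport p}
  add_mem' := fun hp hq => ⟨hp.1.add hq.1, hp.2.add hq.2⟩
  zero_mem' := ⟨contDiff_const, HasCompactSupport.zero⟩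
  smul_mem' := fun r p hp => ⟨contDiff_const.smul hp.1,
    hp.2.comp_left (g := fun t : ℝ => r • t) (by simp)⟩

theorem exists_riesz_L2 {ν : Measure 𝔼} {D : Submodule ℝ (𝔼 → ℝ)}
    (hD : ∀ p ∈ D, MemLp p 2 ν) (T : D →ₗ[ℝ] ℝ) {K : ℝ}
    (hT : ∀ p : D, |T p| ≤ K * √(∫ x, p.1 x ^ 2 ∂ν)) :
    ∃ β : 𝔼 → ℝ, MemLp β 2 ν ∧ ∀ p : D, T p = ∫ x, β x * p.1 x ∂ν := by
  let J : D →ₗ[ℝ] Lp ℝ 2 ν :=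
    { toFun := fun p => (hD p.1 p.2).toLp
      map_add' := fun p q => MemLp.toLp_add _ _
      map_smul' := fun r p => MemLp.toLp_const_smul r _ }
  have hJ : ∀ p : D, ‖J p‖ = √(∫ x, p.1 x ^ 2 ∂ν) := fun p => by
    rw [@norm_eq_sqrt_re_inner ℝ, L2.inner_def]
    congr 1
    simp only [RCLike.re_to_real]
    refine integral_congr_ae ((hD p.1 p.2).coeFn_toLp.mono fun x hx => ?_)
    have : (J p) x = p.1 x := hx
    simp [this, sq]
  have hker : LinearMap.ker J ≤ LinearMap.ker T := fun p hp => by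
    rw [LinearMap.mem_ker] at hp ⊢
    have := hT p
    rw [← hJ p, hp, norm_zero, mul_zero] at this
    exact abs_nonpos_iff.1 this
  let T' : LinearMap.range J →ₗ[ℝ] ℝ :=
    ((LinearMap.ker J).liftQ T hker).comp J.quotKerEquivRange.symm.toLinearMap
  have hT' : ∀ p : D, T' ⟨J p, LinearMap.mem_range_self J p⟩ = T p := fun p => by
    simp only [T', LinearMap.comp_apply, LinearEquiv.coe_coe]
    rw [LinearMap.quotKerEquivRange_symm_apply_image J p (LinearMap.mem_range_self J p)]
    simp
  let f : StrongDual ℝ (LinearMap.range J) := T'.mkContinuous K (by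
    rintro ⟨_, p, rfl⟩
    rw [hT']
    refine (hT p).trans (le_of_eq ?_)
    rw [← hJ]; rfl)
  obtain ⟨g, hg, -⟩ := exists_extension_norm_eq _ f
  refine ⟨(InnerProductSpace.toDual ℝ (Lp ℝ 2 ν)).symm g, Lp.memLp _, fun p => ?_⟩
  have h1 : T p = g (J p) := by
    have := hg ⟨J p, LinearMap.mem_range_self J p⟩
    rw [this]
    exact (hT' p).symm
  rw [h1, ← InnerProductSpace.toDual_symm_apply, L2.inner_def]
  refine integral_congr_ae ((hD p.1 p.2).coeFn_toLp.mono fun x hx => ?_)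
  have : (J p) x = p.1 x := hx
  simp [this, mul_comm]

theorem le_two_sqrt_of_forall {X S V : ℝ} (hS : 0 ≤ S) (hV : 0 ≤ V)
    (h : ∀ κ : ℝ, 0 < κ → X ≤ κ * S + V / κ) : X ≤ 2 * √V * √S := by
  have key : ∀ δ : ℝ, 0 < δ → X ≤ (√V + δ) * √S + √V * (√S + δ) := by
    intro δ hδ
    have hv := Real.sqrt_nonneg V
    have hs := Real.sqrt_nonneg S
    refine (h ((√V + δ) / (√S + δ)) (by positivity)).trans (add_le_add ?_ ?_)
    · rw [div_mul_eq_mul_div, div_le_iff₀ (by positivity), mul_assoc]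
      refine mul_le_mul_of_nonneg_left ?_ (by positivity)
      nlinarith [Real.mul_self_sqrt hS]
    · rw [div_div_eq_mul_div, div_le_iff₀ (by positivity)]
      nlinarith [Real.mul_self_sqrt hV, mul_nonneg hv hs, mul_nonneg (mul_nonneg hv hδ.le) hs,
        mul_nonneg (mul_nonneg hv hδ.le) hδ.le]
  have hlim : Tendsto (fun δ : ℝ => (√V + δ) * √S + √V * (√S + δ)) (𝓝[>] 0)
      (𝓝 ((√V + 0) * √S + √V * (√S + 0))) :=
    tendsto_nhdsWithin_of_tendsto_nhds (Continuous.tendsto (by fun_prop) _)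
  have := ge_of_tendsto hlim (eventually_nhdsWithin_of_forall fun δ hδ => key δ hδ)
  linarith

theorem locallyIntegrable_mul_test {f p : 𝔼 → ℝ} (hf : LocallyIntegrable f)
    (hp : Continuous p) (hpc : HasCompactSupport p) : Integrable fun x => f x * p x := by
  have := hf.integrable_smul_left_of_hasCompactSupport hp hpc
  simpa [mul_comm] using this

theorem continuous_fderiv_apply_test {p : 𝔼 → ℝ} (hp : ContDiff ℝ 1 p)
    (hpc : HasCompactSupport p) (v : 𝔼) :
    Continuous (fun x => fderiv ℝ p x v) ∧ HasCompactSupport fun x => fderiv ℝ p x v := by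
  have hd : Continuous (fderiv ℝ p) := hp.continuous_fderiv (by simp)
  exact ⟨by fun_prop,
    (hpc.fderiv ℝ).comp_left (g := fun (L : 𝔼 →L[ℝ] ℝ) => L v) (by simp)⟩

theorem exists_weakGrad_of_bound {ν : Measure 𝔼} [IsFiniteMeasureOnCompacts ν] {f : 𝔼 → ℝ}
    (hf : LocallyIntegrable f) {C : ℝ} (hC : 0 ≤ C)
    (h : ∀ p : 𝔼 → ℝ, ContDiff ℝ (⊤ : ℕ∞) p → HasCompactSupport p → ∀ v : 𝔼, ∀ κ : ℝ, 0 < κ →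
      ∫ x, f x * fderiv ℝ p x v ≤ κ * (∫ x, p x ^ 2 ∂ν) + ‖v‖ ^ 2 * C / κ) :
    ∃ β : 𝔼 → 𝔼, MemLp β 2 ν ∧ ∀ p : 𝔼 → ℝ, ContDiff ℝ (⊤ : ℕ∞) p → HasCompactSupport p →
      ∀ v : 𝔼, ∫ x, f x * fderiv ℝ p x v = - ∫ x, ⟪β x, v⟫ * p x ∂ν := by
  have hD : ∀ p ∈ testFun l, MemLp p 2 ν := fun p hp =>
    hp.1.continuous.memLp_of_hasCompactSupport hp.2
  have hint : ∀ p ∈ testFun l, ∀ v, Integrable fun x => f x * fderiv ℝ p x v := fun p hp v => by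
    obtain ⟨h1, h2⟩ := continuous_fderiv_apply_test (hp.1.of_le (by simp)) hp.2 v
    exact locallyIntegrable_mul_test hf h1 h2
  have hb : ∀ v : 𝔼, ∃ b : 𝔼 → ℝ, MemLp b 2 ν ∧ ∀ p ∈ testFun l,
      ∫ x, f x * fderiv ℝ p x v = ∫ x, b x * p x ∂ν := by
    intro v
    let T : testFun l →ₗ[ℝ] ℝ :=
      { toFun := fun p => ∫ x, f x * fderiv ℝ p.1 x v
        map_add' := fun p q => by
          rw [← integral_add (hint _ p.2 v) (hint _ q.2 v)]
          congr 1; ext x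
          have : fderiv ℝ ((p + q : testFun l).1) x = fderiv ℝ p.1 x + fderiv ℝ q.1 x :=
            fderiv_add (p.2.1.differentiable (by simp) x) (q.2.1.differentiable (by simp) x)
          rw [this, add_apply, mul_add]
        map_smul' := fun r p => by
          rw [RingHom.id_apply, smul_eq_mul, ← integral_const_mul]
          congr 1; ext x
          have : fderiv ℝ ((r • p : testFun l).1) x = r • fderiv ℝ p.1 x :=
            fderiv_const_smul (p.2.1.differentiable (by simp) x) r
          rw [this, smul_apply, smul_eq_mul]; ring }
    obtain ⟨b, hb1, hb2⟩ := exists_riesz_L2 hD T (K := 2 * √(‖v‖ ^ 2 * C)) fun p => by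
      have hS : 0 ≤ ∫ x, p.1 x ^ 2 ∂ν := integral_nonneg fun x => sq_nonneg _
      rw [abs_le']
      refine ⟨le_two_sqrt_of_forall hS (by positivity) (h p.1 p.2.1 p.2.2 v), ?_⟩
      have := le_two_sqrt_of_forall hS (by positivity) (h p.1 p.2.1 p.2.2 (-v))
      simp only [map_neg, mul_neg, integral_neg, norm_neg] at this
      exact this
    exact ⟨b, hb1, fun p hp => hb2 ⟨p, hp⟩⟩
  choose b hb1 hb2 using hb
  let e := EuclideanSpace.basisFun (Fin l) ℝ
  refine ⟨fun x => - ∑ i, b (e i) x • e i, ?_, fun p hp hpc v => ?_⟩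
  · refine MemLp.neg (memLp_finsetSum _ fun i _ => ?_)
    refine (hb1 (e i)).of_le_mul (c := ‖e i‖)
      ((hb1 (e i)).1.smul_const _) (ae_of_all _ fun x => ?_)
    rw [norm_smul, mul_comm]
  · have h1 : ∀ x, fderiv ℝ p x v = ∑ i, ⟪e i, v⟫ * fderiv ℝ p x (e i) := fun x => by
      conv_lhs => rw [← e.sum_repr' v, map_sum]
      simp
    have hp' : p ∈ testFun l := ⟨hp, hpc⟩
    have h2 : ∀ i, Integrable (fun x => ⟪e i, v⟫ * (b (e i) x * p x)) ν := fun i =>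
      ((hb1 (e i)).integrable_mul (hD p hp')).const_mul _
    simp only [h1, inner_neg_left, sum_inner, real_inner_smul_left, neg_mul, integral_neg, neg_neg,
      Finset.mul_sum, Finset.sum_mul]
    have h3 : ∀ i x, f x * (⟪e i, v⟫ * fderiv ℝ p x (e i)) =
      ⟪e i, v⟫ * (f x * fderiv ℝ p x (e i)) := fun i x => by ring
    have h4 : ∀ i x, b (e i) x * ⟪e i, v⟫ * p x = ⟪e i, v⟫ * (b (e i) x * p x) :=
      fun i x => by ring
    simp only [h3, h4]
    rw [integral_finsetSum _ fun i _ => (hint p hp' (e i)).const_mul _,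
      integral_finsetSum _ fun i _ => h2 i]
    refine Finset.sum_congr rfl fun i _ => ?_
    rw [integral_const_mul, integral_const_mul, hb2 (e i) p hp']

theorem sqrt_bound {m : 𝔼 → ℝ} {f : ℕ → 𝔼 → ℝ} {C : ℝ} (hm0 : ∀ x, 0 ≤ m x)
    (hm : Measurable m) (hmi : Integrable m)
    (hf : ∀ k, ContDiff ℝ 1 (f k)) (hf0 : ∀ k x, 0 ≤ f k x) (hfi : ∀ k, Integrable (f k))
    (hlim : Tendsto (fun k => ∫ x, |f k x - m x|) atTop (𝓝 0))
    (hF : ∀ k, ∀ η : 𝔼 → ℝ, Continuous η → HasCompactSupport η → ∀ v : 𝔼, ∀ κ : ℝ, 0 < κ →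
      ∫ x, η x * fderiv ℝ (f k) x v ≤ κ * (∫ x, η x ^ 2 * f k x) + ‖v‖ ^ 2 * C / κ)
    {p : 𝔼 → ℝ} (hp : ContDiff ℝ (⊤ : ℕ∞) p) (hpc : HasCompactSupport p) (v : 𝔼) {κ : ℝ}
    (hκ : 0 < κ) :
    ∫ x, √(m x) * fderiv ℝ p x v ≤ κ * (∫ x, p x ^ 2) + ‖v‖ ^ 2 * C / κ := by
  have hp1 : ContDiff ℝ 1 p := hp.of_le (by simp)
  have hpcont := hp1.continuous
  obtain ⟨hdc, hds⟩ := continuous_fderiv_apply_test hp1 hpc v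
  obtain ⟨χ, hχ, hχc, hχ0⟩ : ∃ χ : 𝔼 → ℝ, Continuous χ ∧ HasCompactSupport χ ∧
      ∀ x, |fderiv ℝ p x v| = χ x := ⟨_, hdc.abs, hds.abs, fun x => rfl⟩
  obtain ⟨B, hB0, hB⟩ := exists_bound_of_compactSupport hχ hχc
  have hχi := integrable_of_compactSupport hχ hχc
  set e : ℕ → ℝ := fun k => (∫ x, |f k x - m x|) + 1 / ((k : ℝ) + 1) with he
  have he0 : ∀ k, 0 < e k := fun k =>
    add_pos_of_nonneg_of_pos (integral_nonneg fun x => abs_nonneg _) (by positivity)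
  have helim : Tendsto e atTop (𝓝 0) := by
    simpa [he] using hlim.add (tendsto_one_div_add_atTop_nhds_zero_nat (𝕜 := ℝ))
  have hpos : ∀ k x, 0 < f k x + e k := fun k x => add_pos_of_nonneg_of_pos (hf0 k x) (he0 k)
  have hw : ∀ k, ContDiff ℝ 1 fun x => √(f k x + e k) := fun k =>
    ((hf k).add contDiff_const).sqrt fun x => (hpos k x).ne'
  have hbd : ∀ k, ∫ x, √(f k x + e k) * fderiv ℝ p x v ≤
      κ * (∫ x, p x ^ 2) + ‖v‖ ^ 2 * C / κ := by
    intro k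
    have hwc : Continuous fun x => √(f k x + e k) := (hw k).continuous
    have hw0 : ∀ x, √(f k x + e k) ≠ 0 := fun x => (Real.sqrt_pos.2 (hpos k x)).ne'
    have hηc : Continuous fun x => p x / (2 * √(f k x + e k)) :=
      hpcont.div (by fun_prop) fun x => mul_ne_zero two_ne_zero (hw0 x)
    have hηs : HasCompactSupport fun x => p x / (2 * √(f k x + e k)) := by
      simp only [div_eq_mul_inv]; exact hpc.mul_right
    rw [integral_fderiv_mul_eq (hw k) hp1 hpc v]
    have h1 := hF k _ hηc hηs (-v) κ hκ
    have h2 : ∀ x, p x * fderiv ℝ (fun x => √(f k x + e k)) x v =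
        p x / (2 * √(f k x + e k)) * fderiv ℝ (f k) x v := fun x => by
      have := (((hf k).differentiable (by simp) x).hasFDerivAt.add_const (e k)).sqrt
        (hpos k x).ne'
      rw [this.fderiv, smul_apply, smul_eq_mul]
      ring
    simp only [map_neg, mul_neg, integral_neg, norm_neg] at h1
    simp only [h2]
    refine h1.trans (add_le_add_left (mul_le_mul_of_nonneg_left ?_ hκ.le) _)
    refine integral_mono (integrable_of_compactSupport ((hηc.pow 2).mul (hf k).continuous)
      ((hηs.comp_left (g := fun t => t ^ 2) (by simp)).mul_right)) (integrable_of_compactSupport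
      (hpcont.pow 2) (hpc.comp_left (g := fun t => t ^ 2) (by simp))) fun x => ?_
    have h3 := Real.sq_sqrt (hpos k x).le
    simp only [div_pow, mul_pow, h3]
    rw [div_mul_eq_mul_div, div_le_iff₀ (by nlinarith [hpos k x])]
    nlinarith [sq_nonneg (p x), he0 k, hf0 k x, mul_nonneg (sq_nonneg (p x)) (hf0 k x),
      mul_nonneg (sq_nonneg (p x)) (he0 k).le]
  have hsq : LocallyIntegrable fun x => √(m x) := by
    have : MemLp (fun x => √(m x)) 2 volume := by
      rw [memLp_two_iff_integrable_sq (hm.sqrt.aestronglyMeasurable)]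
      exact hmi.congr (ae_of_all _ fun x => (Real.sq_sqrt (hm0 x)).symm)
    exact this.locallyIntegrable (by norm_num)
  have hconv : Tendsto (fun k => ∫ x, √(f k x + e k) * fderiv ℝ p x v) atTop
      (𝓝 (∫ x, √(m x) * fderiv ℝ p x v)) := by
    rw [tendsto_iff_norm_sub_tendsto_zero]
    have hle : ∀ k, ‖(∫ x, √(f k x + e k) * fderiv ℝ p x v) - ∫ x, √(m x) * fderiv ℝ p x v‖ ≤
        √(e k) * (2 * (∫ x, χ x) + B) := by
      intro k
      have hs := Real.sqrt_pos.2 (he0 k)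
      have hse := Real.mul_self_sqrt (he0 k).le
      have i1 : Integrable fun x => √(f k x + e k) * fderiv ℝ p x v :=
        integrable_of_compactSupport ((hw k).continuous.mul hdc) hds.mul_left
      have i2 := locallyIntegrable_mul_test hsq hdc hds
      have i3 : Integrable fun x => |f k x - m x| := ((hfi k).sub hmi).abs
      have i4 : Integrable fun x => 2 * √(e k) * χ x + B / √(e k) * |f k x - m x| :=
        (hχi.const_mul _).add (i3.const_mul _)
      rw [← integral_sub i1 i2]
      refine (norm_integral_le_of_norm_le i4 (ae_of_all _ fun x => ?_)).trans ?_
      · rw [← sub_mul, norm_mul, Real.norm_eq_abs, Real.norm_eq_abs, hχ0]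
        have hχx : 0 ≤ χ x := by rw [← hχ0]; exact abs_nonneg _
        have hBx : χ x ≤ B := (le_abs_self _).trans (hB x)
        have h5 : |√(f k x + e k) - √(m x)| ≤ √(|f k x - m x| + e k) := by
          refine Real.le_sqrt_of_sq_le ?_
          have a1 := Real.mul_self_sqrt (hpos k x).le
          have a2 := Real.mul_self_sqrt (hm0 x)
          have a3 := Real.sqrt_nonneg (f k x + e k)
          have a4 := Real.sqrt_nonneg (m x)
          have a5 : |f k x + e k - m x| ≤ |f k x - m x| + e k := by
            have := abs_add_le (f k x - m x) (e k)
            rw [abs_of_pos (he0 k)] at this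
            rwa [show f k x + e k - m x = f k x - m x + e k by ring]
          refine le_trans ?_ a5
          rw [sq_abs]
          rcases le_total (√(m x)) (√(f k x + e k)) with h | h
          · refine le_trans ?_ (le_abs_self _); nlinarith
          · refine le_trans ?_ (neg_le_abs _); nlinarith
        have h6 : √(|f k x - m x| + e k) ≤ 2 * √(e k) + |f k x - m x| / √(e k) := by
          rw [Real.sqrt_le_left (by positivity)]
          have : |f k x - m x| = |f k x - m x| / √(e k) * √(e k) := by field_simp
          have h0 : 0 ≤ |f k x - m x| / √(e k) := by positivity
          set q := |f k x - m x| / √(e k)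
          nlinarith [sq_nonneg q]
        calc |√(f k x + e k) - √(m x)| * χ x
            ≤ (2 * √(e k) + |f k x - m x| / √(e k)) * χ x :=
              mul_le_mul_of_nonneg_right (h5.trans h6) hχx
          _ = 2 * √(e k) * χ x + |f k x - m x| / √(e k) * χ x := by ring
          _ ≤ 2 * √(e k) * χ x + |f k x - m x| / √(e k) * B := by gcongr
          _ = _ := by ring
      · rw [integral_add (hχi.const_mul _) (i3.const_mul _), integral_const_mul,
          integral_const_mul]
        have h7 : ∫ x, |f k x - m x| ≤ e k := by
          have : 0 < 1 / ((k : ℝ) + 1) := by positivity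
          simp only [he]; linarith
        have h8 : B / √(e k) * ∫ x, |f k x - m x| ≤ B / √(e k) * e k := by gcongr
        have h9 : B / √(e k) * e k = √(e k) * B := by
          rw [div_mul_eq_mul_div, div_eq_iff hs.ne']
          linear_combination (-B) * hse
        linarith
    refine squeeze_zero (fun k => norm_nonneg _) hle ?_
    have : Tendsto (fun k => √(e k)) atTop (𝓝 0) := by
      have := (Real.continuous_sqrt.tendsto 0).comp helim
      rw [Real.sqrt_zero] at this
      exact this
    simpa using this.mul_const (2 * (∫ x, χ x) + B)
  exact le_of_tendsto' hconv hbd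

theorem HasWeakGrad.congr {f f' : 𝔼 → ℝ} {g : 𝔼 → 𝔼} (h : HasWeakGrad f g) (hf : f =ᵐ[volume] f') :
    HasWeakGrad f' g := by
  refine ⟨h.1.congr hf, h.2.1, fun p hp hpc v => ?_⟩
  rw [← h.2.2 p hp hpc v]
  exact integral_congr_ae (hf.mono fun x hx => by simp only [hx])

theorem FisherApprox.density_regularity {μ : Measure 𝔼} [IsProbabilityMeasure μ]
    {C : ℝ} (h : FisherApprox μ C) (hC : 0 ≤ C) :
    μ ≪ volume ∧ ∀ m : 𝔼 → ℝ, (∀ x, 0 ≤ m x) → Integrable m →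
      μ = volume.withDensity (fun x => ENNReal.ofReal (m x)) →
      (∃ g, HasWeakGrad m g) ∧ ∃ g, HasWeakGrad (fun x => √(m x)) g ∧
        Integrable (fun x => ‖g x‖ ^ 2) := by
  obtain ⟨m, hm, hm0, hmi, hμ, f, hf, hf0, hfi, hlim, hF⟩ := h.exists_density hC
  refine ⟨by rw [hμ]; exact withDensity_absolutelyContinuous _ _, fun m' hm0' hmi' hμ' => ?_⟩
  have hmm : m =ᵐ[volume] m' := by
    have := (withDensity_eq_iff hm.ennreal_ofReal.aemeasurable
      hmi'.1.aemeasurable.ennreal_ofReal (by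
        have := hmi.lintegral_lt_top; exact this.ne)).1 (hμ.symm.trans hμ')
    filter_upwards [this] with x hx
    exact (ENNReal.ofReal_eq_ofReal_iff (hm0 x) (hm0' x)).1 hx
  have hint : ∀ {F : Type} [NormedAddCommGroup F] [NormedSpace ℝ F] (g : 𝔼 → F),
      ∫ x, g x ∂μ = ∫ x, m x • g x := fun g => by
    conv_lhs => rw [hμ]
    rw [integral_withDensity_eq_integral_toReal_smul (by fun_prop) (by simp)]
    simp only [ENNReal.toReal_ofReal (hm0 _)]
  constructor
  · obtain ⟨β, hβ, hw⟩ := exists_weakGrad_of_bound (ν := μ) hmi.locallyIntegrable hC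
      fun p hp hpc v κ hκ => by
        have := h.fderiv_le (hp.of_le (by simp)) hpc v hκ
        rwa [hint fun x => fderiv ℝ p x v] at this
    refine ⟨fun x => m x • β x, HasWeakGrad.congr ⟨hmi.locallyIntegrable, ?_, fun p hp hpc v => ?_⟩
      hmm⟩
    · have h1 : Integrable β μ := hβ.integrable (by norm_num)
      rw [hμ, integrable_withDensity_iff_integrable_smul' (by fun_prop) (by simp)] at h1
      simp only [ENNReal.toReal_ofReal (hm0 _)] at h1
      exact h1.locallyIntegrable
    · rw [hw p hp hpc v, hint]
      simp only [real_inner_smul_left, smul_eq_mul, mul_assoc]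
  · have hsq : MemLp (fun x => √(m x)) 2 volume := by
      rw [memLp_two_iff_integrable_sq (hm.sqrt.aestronglyMeasurable)]
      exact hmi.congr (ae_of_all _ fun x => (Real.sq_sqrt (hm0 x)).symm)
    have hsl : LocallyIntegrable fun x => √(m x) := hsq.locallyIntegrable (by norm_num)
    obtain ⟨β, hβ, hw⟩ := exists_weakGrad_of_bound (ν := volume) hsl hC
      fun p hp hpc v κ hκ => sqrt_bound hm0 hm hmi hf hf0 hfi hlim hF hp hpc v hκ
    refine ⟨β, HasWeakGrad.congr ⟨hsl, hβ.locallyIntegrable (by norm_num), hw⟩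
      (hmm.mono fun x hx => by simp only [hx]), ?_⟩
    exact (memLp_two_iff_integrable_sq_norm hβ.1).1 hβ

/-- Functions of at most cubic growth. -/
def cubicGrowth (l : ℕ) : Submodule ℝ (EuclideanSpace ℝ (Fin l) → ℝ) where
  carrier := {g | ∃ C, ∀ x, |g x| ≤ C * (1 + ‖x‖ ^ 3)}
  add_mem' := by
    rintro f g ⟨C, hC⟩ ⟨C', hC'⟩
    exact ⟨C + C', fun x => (abs_add_le _ _).trans (by linarith [hC x, hC' x])⟩
  zero_mem' := ⟨0, fun x => by simp⟩
  smul_mem' := by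
    rintro r g ⟨C, hC⟩
    refine ⟨|r| * C, fun x => ?_⟩
    rw [Pi.smul_apply, smul_eq_mul, abs_mul, mul_assoc]
    exact mul_le_mul_of_nonneg_left (hC x) (abs_nonneg r)

theorem one_mem_cubicGrowth : (1 : 𝔼 → ℝ) ∈ cubicGrowth l :=
  ⟨1, fun x => by simp⟩

theorem cube_mem_cubicGrowth : (fun x : 𝔼 => ‖x‖ ^ 3) ∈ cubicGrowth l :=
  ⟨1, fun x => by rw [abs_of_nonneg (by positivity)]; linarith⟩

theorem mem_cubicGrowth_of_compactSupport {g : 𝔼 → ℝ} (hg : Continuous g)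
    (hgc : HasCompactSupport g) : g ∈ cubicGrowth l := by
  obtain ⟨C, hC, h⟩ := exists_bound_of_compactSupport hg hgc
  refine ⟨C, fun x => (h x).trans ?_⟩
  have : 0 ≤ ‖x‖ ^ 3 := by positivity
  nlinarith

theorem exists_functional (L : testFun l →ₗ[ℝ] (𝔼 → ℝ)) (W : 𝔼 → ℝ) {B : ℝ}
    (hmin : ∀ c : ℝ, 0 ≤ c → ∀ p, ∃ x, 0 ≤ c * W x + L p x)
    (hW : ∀ x, W x ≤ B - ‖x‖ ^ 3) (hL : ∀ p, Continuous (L p) ∧ HasCompactSupport (L p)) :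
    ∃ Φ : cubicGrowth l →ₗ[ℝ] ℝ, (∀ g : cubicGrowth l, (∀ x, 0 ≤ g.1 x) → 0 ≤ Φ g) ∧
      Φ ⟨1, one_mem_cubicGrowth⟩ = 1 ∧ Φ ⟨_, cube_mem_cubicGrowth⟩ ≤ B ∧
      ∀ p, Φ ⟨L p, mem_cubicGrowth_of_compactSupport (hL p).1 (hL p).2⟩ = 0 := by
  set e : cubicGrowth l := ⟨1, one_mem_cubicGrowth⟩ with he
  have he0 : e ≠ 0 := fun h => by
    have : e.1 0 = 0 := by rw [h]; rfl
    simp [he] at this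
  let s : PointedCone ℝ (cubicGrowth l) :=
    { carrier := {g | ∃ c : ℝ, 0 ≤ c ∧ ∃ p, ∀ x, c * W x + L p x ≤ g.1 x}
      add_mem' := by
        rintro f g ⟨c, hc, p, h⟩ ⟨c', hc', p', h'⟩
        refine ⟨c + c', by positivity, p + p', fun x => ?_⟩
        have : (f + g).1 x = f.1 x + g.1 x := rfl
        rw [this, map_add, Pi.add_apply]
        linarith [h x, h' x]
      zero_mem' := ⟨0, le_rfl, 0, fun x => by simp⟩
      smul_mem' := by
        rintro ⟨r, hr⟩ g ⟨c, hc, p, h⟩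
        refine ⟨r * c, by positivity, r • p, fun x => ?_⟩
        have : ((⟨r, hr⟩ : {r : ℝ // 0 ≤ r}) • g).1 x = r * g.1 x := rfl
        rw [this, map_smul, Pi.smul_apply, smul_eq_mul]
        nlinarith [mul_le_mul_of_nonneg_left (h x) hr] }
  have hs : ∀ g, g ∈ s ↔ ∃ c : ℝ, 0 ≤ c ∧ ∃ p, ∀ x, c * W x + L p x ≤ g.1 x := fun g => Iff.rfl
  let f : cubicGrowth l →ₗ.[ℝ] ℝ := LinearPMap.mkSpanSingleton e (1 : ℝ) he0
  have hfr : ∀ (r : ℝ) (h : r • e ∈ f.domain), f ⟨r • e, h⟩ = r := fun r h => by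
    have := LinearPMap.mkSpanSingleton'_apply (σ := RingHom.id ℝ) e (1 : ℝ) (fun c hc => by
      rcases smul_eq_zero.1 hc with h | h
      · simp [h]
      · exact absurd h he0) r h
    exact this.trans (mul_one r)
  have hdom : ∀ r : ℝ, r • e ∈ f.domain := fun r => Submodule.mem_span_singleton.2 ⟨r, rfl⟩
  obtain ⟨Φ, h1, h2⟩ := riesz_extension s f (by
    rintro ⟨y, hy⟩ hys
    obtain ⟨r, rfl⟩ := Submodule.mem_span_singleton.1 hy
    rw [hfr]
    obtain ⟨c, hc, p, h⟩ := (hs _).1 hys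
    obtain ⟨x, hx⟩ := hmin c hc p
    have := h x
    have e1 : (r • e).1 x = r * 1 := rfl
    simp only at this
    rw [e1] at this
    linarith) (by
    rintro ⟨y, C, hC⟩
    refine ⟨⟨(|C| * (B + 1)) • e, hdom _⟩, (hs _).2 ⟨|C|, abs_nonneg _, 0, fun x => ?_⟩⟩
    have e1 : (((|C| * (B + 1)) • e : cubicGrowth l) + ⟨y, C, hC⟩ : cubicGrowth l).1 x =
      |C| * (B + 1) * 1 + y x := rfl
    simp only [map_zero, Pi.zero_apply]
    rw [e1]
    have h3 := mul_le_mul_of_nonneg_left (hW x) (abs_nonneg C)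
    have h4 := (abs_le.1 (hC x)).1
    have h5 : C * (1 + ‖x‖ ^ 3) ≤ |C| * (1 + ‖x‖ ^ 3) :=
      mul_le_mul_of_nonneg_right (le_abs_self C) (by positivity)
    linarith)
  have hone : Φ e = 1 := by
    have := h1 ⟨(1 : ℝ) • e, hdom 1⟩
    rw [hfr] at this
    simpa using this
  refine ⟨Φ, fun g hg => h2 g ((hs g).2 ⟨0, le_rfl, 0, fun x => by simpa using hg x⟩), hone, ?_,
    fun p => ?_⟩
  · have := h2 (B • e - ⟨_, cube_mem_cubicGrowth⟩) ((hs _).2 ⟨1, zero_le_one, 0, fun x => by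
      have e1 : (B • e - ⟨_, cube_mem_cubicGrowth⟩ : cubicGrowth l).1 x = B * 1 - ‖x‖ ^ 3 := rfl
      rw [e1]
      simpa using hW x⟩)
    rw [map_sub, map_smul, hone] at this
    simpa using this
  · refine le_antisymm ?_ (h2 _ ((hs _).2 ⟨0, le_rfl, p, fun x => by simp⟩))
    have := h2 (-⟨L p, mem_cubicGrowth_of_compactSupport (hL p).1 (hL p).2⟩)
      ((hs _).2 ⟨0, le_rfl, -p, fun x => by
        rw [map_neg]; simp⟩)
    rw [map_neg] at this
    linarith

theorem exists_stationary_measure (L : testFun l →ₗ[ℝ] (𝔼 → ℝ)) (W : 𝔼 → ℝ) {B : ℝ}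
    (hmin : ∀ c : ℝ, 0 ≤ c → ∀ p, ∃ x, 0 ≤ c * W x + L p x)
    (hW : ∀ x, W x ≤ B - ‖x‖ ^ 3) (hL : ∀ p, Continuous (L p) ∧ HasCompactSupport (L p)) :
    ∃ μ : Measure 𝔼, IsProbabilityMeasure μ ∧ (∀ p, ∫ x, L p x ∂μ = 0) ∧
      ∫⁻ x, ENNReal.ofReal (‖x‖ ^ 3) ∂μ ≤ ENNReal.ofReal B := by
  obtain ⟨Φ, hpos, hone, hcube, hzero⟩ := exists_functional L W hmin hW hL
  have hmono : ∀ f g : cubicGrowth l, (∀ x, f.1 x ≤ g.1 x) → Φ f ≤ Φ g := fun f g h => by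
    have := hpos (g - f) fun x => sub_nonneg.2 (h x)
    rw [map_sub] at this
    linarith
  let i : CompactlySupportedContinuousMap 𝔼 ℝ →ₗ[ℝ] cubicGrowth l :=
    { toFun := fun f => ⟨f, mem_cubicGrowth_of_compactSupport f.continuous f.hasCompactSupport⟩
      map_add' := fun f g => rfl
      map_smul' := fun r f => rfl }
  let Λ : CompactlySupportedContinuousMap 𝔼 ℝ →ₚ[ℝ] ℝ :=
    PositiveLinearMap.mk₀ (Φ.comp i) fun f hf => hpos _ fun x => hf x
  set μ := RealRMK.rieszMeasure Λ with hμ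
  have hint : ∀ (f : 𝔼 → ℝ) (h : Continuous f) (hc : HasCompactSupport f),
      ∫ x, f x ∂μ = Φ ⟨f, mem_cubicGrowth_of_compactSupport h hc⟩ := fun f h hc =>
    RealRMK.integral_rieszMeasure Λ ⟨⟨f, h⟩, hc⟩
  have hinti : ∀ (f : 𝔼 → ℝ) (_ : Continuous f) (_ : HasCompactSupport f), Integrable f μ :=
    fun f h hc => h.integrable_of_hasCompactSupport hc
  choose χ hχ hχc hχ0 hχ1 hχR using fun k : ℕ => exists_cutoff (l := l) k
  have hlint : ∀ g : 𝔼 → ℝ, Continuous g → (∀ x, 0 ≤ g x) → ∀ b : ℝ,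
      (∀ k, ∫ x, χ k x * g x ∂μ ≤ b) → ∫⁻ x, ENNReal.ofReal (g x) ∂μ ≤ ENNReal.ofReal b := by
    intro g hg hg0 b hb
    have h1 : ∀ x, Tendsto (fun k => ENNReal.ofReal (χ k x * g x)) atTop
        (𝓝 (ENNReal.ofReal (g x))) := fun x => by
      obtain ⟨N, hN⟩ := exists_nat_ge ‖x‖
      refine tendsto_const_nhds.congr' ?_
      filter_upwards [eventually_ge_atTop N] with k hk
      rw [hχR k x (hN.trans (by exact_mod_cast hk)), one_mul]
    have h2 : ∫⁻ x, ENNReal.ofReal (g x) ∂μ ≤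
        liminf (fun k => ∫⁻ x, ENNReal.ofReal (χ k x * g x) ∂μ) atTop := by
      simp only [fun x => (h1 x).liminf_eq.symm]
      exact lintegral_liminf_le fun k =>
        ((hχ k).continuous.mul hg).measurable.ennreal_ofReal
    refine h2.trans (liminf_le_of_le (by isBoundedDefault) fun c hc => ?_)
    obtain ⟨k, hk⟩ := hc.exists
    refine hk.trans ?_
    have hi : Integrable (fun x => χ k x * g x) μ :=
      hinti _ ((hχ k).continuous.mul hg) (hχc k).mul_right
    rw [← ofReal_integral_eq_lintegral_ofReal hi
      (ae_of_all _ fun x => mul_nonneg (hχ0 k x) (hg0 x))]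
    exact ENNReal.ofReal_le_ofReal (hb k)
  have hmass : μ univ ≤ 1 := by
    have := hlint (fun _ => 1) continuous_const (fun _ => zero_le_one) 1 fun k => by
      simp only [mul_one]
      rw [hint _ (hχ k).continuous (hχc k), ← hone]
      exact hmono _ _ fun x => hχ1 k x
    simpa using this
  have hfin : IsFiniteMeasure μ := ⟨hmass.trans_lt ENNReal.one_lt_top⟩
  have hmass' : (1 : ℝ) ≤ μ.real univ := by
    have hle : ∀ k : ℕ, 1 - B * (1 / ((k : ℝ) + 1)) ≤ μ.real univ := by
      intro k
      have h1 : ∫ x, χ (k + 1) x ∂μ ≤ μ.real univ := by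
        have := integral_mono (hinti _ (hχ (k + 1)).continuous (hχc (k + 1)))
          (integrable_const (1 : ℝ)) fun x => hχ1 (k + 1) x
        simpa using this
      have hk : (0 : ℝ) < (k : ℝ) + 1 := by positivity
      have h2 := hmono (⟨1, one_mem_cubicGrowth⟩ - (1 / ((k : ℝ) + 1)) • ⟨_, cube_mem_cubicGrowth⟩)
        ⟨χ (k + 1), mem_cubicGrowth_of_compactSupport (hχ (k + 1)).continuous (hχc (k + 1))⟩
        fun x => by
          have e1 : ((⟨1, one_mem_cubicGrowth⟩ - (1 / ((k : ℝ) + 1)) •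
            ⟨_, cube_mem_cubicGrowth⟩ : cubicGrowth l)).1 x =
              1 - (1 / ((k : ℝ) + 1)) * ‖x‖ ^ 3 := rfl
          rw [e1]
          rcases le_total ‖x‖ ((k : ℝ) + 1) with h | h
          · have : χ (k + 1) x = 1 := hχR _ _ (by push_cast; exact h)
            simp only [this]
            have : 0 ≤ (1 / ((k : ℝ) + 1)) * ‖x‖ ^ 3 := by positivity
            linarith
          · have h3 : 1 ≤ (1 / ((k : ℝ) + 1)) * ‖x‖ ^ 3 := by
              rw [one_div_mul_eq_div, le_div_iff₀ hk, one_mul]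
              have : (1 : ℝ) ≤ ‖x‖ := le_trans (by linarith [(Nat.cast_nonneg k : (0 : ℝ) ≤ k)]) h
              nlinarith [sq_nonneg ‖x‖, mul_self_nonneg (‖x‖ - 1)]
            have := hχ0 (k + 1) x
            simp only
            linarith
      rw [map_sub, map_smul, hone, smul_eq_mul, ← hint _ (hχ (k + 1)).continuous (hχc (k + 1))]
        at h2
      have h3 := mul_le_mul_of_nonneg_left hcube (by positivity : 0 ≤ 1 / ((k : ℝ) + 1))
      linarith
    have hlim : Tendsto (fun k : ℕ => 1 - B * (1 / ((k : ℝ) + 1))) atTop (𝓝 (1 - B * 0)) :=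
      (tendsto_one_div_add_atTop_nhds_zero_nat.const_mul B).const_sub 1
    have := le_of_tendsto' hlim hle
    simpa using this
  refine ⟨μ, ⟨le_antisymm hmass ?_⟩, fun p => ?_, ?_⟩
  · rw [← ENNReal.ofReal_one, ← ofReal_measureReal (measure_ne_top _ _)]
    exact ENNReal.ofReal_le_ofReal hmass'
  · rw [hint _ (hL p).1 (hL p).2, hzero]
  · refine hlint _ (by fun_prop) (fun x => by positivity) B fun k => ?_
    have hc : Continuous fun x => χ k x * ‖x‖ ^ 3 := by
      have := (hχ k).continuous; fun_prop
    rw [hint _ hc (hχc k).mul_right]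
    exact (hmono _ ⟨_, cube_mem_cubicGrowth⟩ fun x =>
      mul_le_of_le_one_left (by positivity) (hχ1 k x)).trans hcube

theorem traceL_comp_nonneg {C H : 𝔼 →L[ℝ] 𝔼} (hC : ∀ v, 0 ≤ ⟪C v, v⟫)
    (hs : ∀ v w, ⟪H v, w⟫ = ⟪v, H w⟫) (hH : ∀ v, 0 ≤ ⟪H v, v⟫) :
    0 ≤ traceL (C.comp H) := by
  have hT : H.toLinearMap.IsSymmetric := fun v w => hs v w
  let b := hT.eigenvectorBasis (n := l) (by simp)
  rw [traceL_apply, LinearMap.trace_eq_sum_inner _ b]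
  refine Finset.sum_nonneg fun i _ => ?_
  have h1 : H (b i) = (hT.eigenvalues (n := l) (by simp) i) • b i := 
    hT.apply_eigenvectorBasis (n := l) (by simp) i
  have h2 : 0 ≤ hT.eigenvalues (n := l) (by simp) i := by
    have := hH (b i)
    rw [h1, inner_smul_left] at this
    have hb : ⟪b i, b i⟫ = (1 : ℝ) := by
      rw [real_inner_self_eq_norm_sq, b.orthonormal.1 i]; norm_num
    rw [hb] at this
    simpa using this
  change 0 ≤ ⟪b i, C (H (b i))⟫
  rw [h1, map_smul, inner_smul_right, real_inner_comm]
  exact mul_nonneg h2 (hC _)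

theorem gradient_eq_zero_of_isMin {f : 𝔼 → ℝ} {x : 𝔼} (hmin : ∀ y, f x ≤ f y) :
    gradient f x = 0 := by
  have : IsLocalMin f x := Eventually.of_forall hmin
  unfold gradient
  rw [this.fderiv_eq_zero, map_zero]

theorem gradient_hessian_symm {f : 𝔼 → ℝ} (hf : ContDiff ℝ (⊤ : ℕ∞) f) (x v w : 𝔼) :
    ⟪fderiv ℝ (fun y => gradient f y) x v, w⟫ = ⟪v, fderiv ℝ (fun y => gradient f y) x w⟫ := by
  have hd : DifferentiableAt ℝ (fderiv ℝ f) x :=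
    ((hf.fderiv_right (m := 1) (by norm_cast)).differentiable (by simp)).differentiableAt
  have key : ∀ v w : 𝔼, ⟪fderiv ℝ (fun y => gradient f y) x v, w⟫
      = fderiv ℝ (fderiv ℝ f) x v w := by
    intro v w
    have : fderiv ℝ (fun y => gradient f y) x
        = ((InnerProductSpace.toDual ℝ 𝔼).symm.toContinuousLinearEquiv.toContinuousLinearMap).comp
            (fderiv ℝ (fderiv ℝ f) x) := by
      have h := ((InnerProductSpace.toDual ℝ 𝔼).symm.toContinuousLinearEquiv.toContinuousLinearMap
        ).hasFDerivAt.comp x hd.hasFDerivAt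
      exact h.fderiv
    rw [this]
    exact InnerProductSpace.toDual_symm_apply
  rw [key, real_inner_comm, key]
  exact (hf.contDiffAt.isSymmSndFDerivAt
    (by simp only [minSmoothness_of_isRCLikeNormedField]; norm_cast)).eq v w

theorem hessian_nonneg_of_isMin {f : 𝔼 → ℝ} (hf : ContDiff ℝ (⊤ : ℕ∞) f) {x : 𝔼}
    (hmin : ∀ y, f x ≤ f y) (v : 𝔼) :
    0 ≤ ⟪fderiv ℝ (fun y => gradient f y) x v, v⟫ := by
  by_contra! hneg
  set g : ℝ → ℝ := fun s => f (x + s • v) with hg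
  have hline : ∀ s : ℝ, HasDerivAt (fun s : ℝ => x + s • v) v s := by
    intro s
    simpa using ((hasDerivAt_id s).smul_const v).const_add x
  have hg1 : ∀ s, HasDerivAt g (⟪gradient f (x + s • v), v⟫) s := by
    intro s
    rw [inner_gradient_left]
    exact ((hf.differentiable (by simp)) _).hasFDerivAt.comp_hasDerivAt s (hline s)
  have hg1' : deriv g = fun s => ⟪gradient f (x + s • v), v⟫ := funext fun s => (hg1 s).deriv
  have hg2 : HasDerivAt (fun s : ℝ => ⟪gradient f (x + s • v), v⟫)
      (⟪fderiv ℝ (fun y => gradient f y) x v, v⟫) 0 := by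
    have hd : DifferentiableAt ℝ (fun y => gradient f y) (x + (0 : ℝ) • v) :=
      ((contDiff_gradient hf).differentiable (by simp)) _
    have h1 := hd.hasFDerivAt.comp_hasDerivAt (0 : ℝ) (hline 0)
    have h2 := h1.inner ℝ (hasDerivAt_const (0 : ℝ) v)
    simpa using h2
  have hdd : deriv (deriv g) 0 < 0 := by rw [hg1', hg2.deriv]; exact hneg
  have hd0 : deriv g 0 = 0 := by
    rw [hg1']; simp [gradient_eq_zero_of_isMin hmin]
  have hmax := isLocalMax_of_deriv_deriv_neg hdd hd0 (hg1 0).continuousAt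
  have hconst : g =ᶠ[𝓝 0] fun _ => f x := by
    filter_upwards [hmax] with s hs
    refine le_antisymm ?_ (hmin _)
    simpa [hg] using hs
  have h1 : deriv g =ᶠ[𝓝 0] deriv (fun _ : ℝ => f x) := hconst.deriv
  have h2 := h1.deriv_eq
  simp at h2
  rw [h2] at hdd
  exact lt_irrefl _ hdd

theorem diffGen_nonneg_of_isMin {c : 𝔼 → (𝔼 →L[ℝ] 𝔼)} (a : 𝔼 → 𝔼) {f : 𝔼 → ℝ}
    (hf : ContDiff ℝ (⊤ : ℕ∞) f) {x : 𝔼} (hc : ∀ v, 0 ≤ ⟪c x v, v⟫) (hmin : ∀ y, f x ≤ f y) :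
    0 ≤ diffGen c a f x := by
  have := traceL_comp_nonneg hc (gradient_hessian_symm hf x) (hessian_nonneg_of_isMin hf hmin)
  rw [traceL_apply] at this
  unfold diffGen
  rw [gradient_eq_zero_of_isMin hmin, inner_zero_right]
  linarith

theorem contDiff_norm_pow_four : ContDiff ℝ (⊤ : ℕ∞) fun x : 𝔼 => ‖x‖ ^ 4 := by
  have : (fun x : 𝔼 => ‖x‖ ^ 4) = fun x => (‖x‖ ^ 2) ^ 2 := by ext x; ring
  rw [this]
  exact (contDiff_norm_sq ℝ).pow 2

theorem gradient_norm_pow_four : gradient (fun x : 𝔼 => ‖x‖ ^ 4) = fun x => (4 * ‖x‖ ^ 2) • x := by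
  ext1 x
  have h1 : HasFDerivAt (fun x : 𝔼 => ‖x‖ ^ 2) (2 • innerSL ℝ x) x :=
    (hasStrictFDerivAt_norm_sq x).hasFDerivAt
  have h2 := h1.pow 2
  have h3 : (fun x : 𝔼 => ‖x‖ ^ 4) = fun x => (‖x‖ ^ 2) ^ 2 := by ext x; ring
  refine ext_inner_right ℝ fun y => ?_
  rw [inner_gradient_left, h3, h2.fderiv]
  simp [inner_smul_left]
  ring

theorem hessian_norm_pow_four (x : 𝔼) :
    fderiv ℝ (fun y => gradient (fun x : 𝔼 => ‖x‖ ^ 4) y) x =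
      (4 * ‖x‖ ^ 2) • ContinuousLinearMap.id ℝ 𝔼 + (8 • innerSL ℝ x).smulRight x := by
  rw [gradient_norm_pow_four]
  have h1 : HasFDerivAt (fun x : 𝔼 => ‖x‖ ^ 2) (2 • innerSL ℝ x) x :=
    (hasStrictFDerivAt_norm_sq x).hasFDerivAt
  have h2 := (h1.const_mul 4).smul (hasFDerivAt_id x)
  refine h2.fderiv.trans ?_
  ext1 v
  simp
  module

theorem diffGen_norm_pow_four (c : 𝔼 → (𝔼 →L[ℝ] 𝔼)) (a : 𝔼 → 𝔼) (x : 𝔼) :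
    diffGen c a (fun x : 𝔼 => ‖x‖ ^ 4) x =
      2 * ‖x‖ ^ 2 * traceL (c x) + 4 * ⟪c x x, x⟫ + 4 * ‖x‖ ^ 2 * ⟪a x, x⟫ := by
  unfold diffGen
  rw [← traceL_apply, hessian_norm_pow_four, ContinuousLinearMap.comp_add,
    ContinuousLinearMap.comp_smul, ContinuousLinearMap.comp_id, map_add, map_smul,
    traceL_comp_smulRight, gradient_norm_pow_four]
  simp [inner_smul_right, real_inner_comm x]
  ring

theorem diffGen_norm_pow_four_le {c : 𝔼 → (𝔼 →L[ℝ] 𝔼)} {a : 𝔼 → 𝔼} {C₀ C₁ R : ℝ} (hR : 0 ≤ R)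
    (hC₀ : 0 ≤ C₀) (hC₁ : 0 ≤ C₁) (hc : ∀ x, ‖c x‖ ≤ C₀) (ha : ∀ x, ‖x‖ ≤ R → ‖a x‖ ≤ C₁)
    (hst : ∀ x, R ≤ ‖x‖ → ⟪a x, x⟫ ≤ -‖x‖) (x : 𝔼) :
    diffGen c a (fun x : 𝔼 => ‖x‖ ^ 4) x ≤
      ((2 * ‖(traceL : (𝔼 →L[ℝ] 𝔼) →L[ℝ] ℝ)‖ + 4) * C₀) ^ 3 +
      ((2 * ‖(traceL : (𝔼 →L[ℝ] 𝔼) →L[ℝ] ℝ)‖ + 4) * C₀) * R ^ 2 + 4 * R ^ 3 * C₁ + R ^ 3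
       - ‖x‖ ^ 3 := by
  rw [diffGen_norm_pow_four]
  have hτ := norm_nonneg (traceL : (𝔼 →L[ℝ] 𝔼) →L[ℝ] ℝ)
  set τ := ‖(traceL : (𝔼 →L[ℝ] 𝔼) →L[ℝ] ℝ)‖
  set k := (2 * τ + 4) * C₀ with hk
  have hk0 : 0 ≤ k := by positivity
  have h1 : traceL (c x) ≤ τ * C₀ :=
    (le_abs_self _).trans ((traceL.le_opNorm (c x)).trans (by gcongr; exact hc x))
  have h2 : ⟪c x x, x⟫ ≤ C₀ * ‖x‖ ^ 2 := by
    calc ⟪c x x, x⟫ ≤ ‖c x x‖ * ‖x‖ := real_inner_le_norm _ _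
      _ ≤ (C₀ * ‖x‖) * ‖x‖ := by gcongr; exact (c x).le_of_opNorm_le (hc x) x
      _ = _ := by ring
  set r := ‖x‖ with hr
  have hr0 : 0 ≤ r := norm_nonneg x
  have h3 : 2 * r ^ 2 * traceL (c x) + 4 * ⟪c x x, x⟫ ≤ k * r ^ 2 := by
    have := mul_le_mul_of_nonneg_left h1 (show 0 ≤ 2 * r ^ 2 by positivity)
    nlinarith
  rcases le_total R r with h | h
  · have h4 := mul_le_mul_of_nonneg_left (hst x h) (show 0 ≤ 4 * r ^ 2 by positivity)
    have h5 : k * r ^ 2 ≤ k ^ 3 + r ^ 3 := by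
      rcases le_total k r with h | h
      · have : k * r ^ 2 ≤ r * r ^ 2 := by gcongr
        nlinarith [pow_nonneg hk0 3]
      · have : k * r ^ 2 ≤ k * k ^ 2 := by gcongr
        nlinarith [pow_nonneg hr0 3]
    have h6 : 0 ≤ k * R ^ 2 + 4 * R ^ 3 * C₁ + R ^ 3 := by positivity
    nlinarith [pow_nonneg hr0 3]
  · have h4 : ⟪a x, x⟫ ≤ C₁ * R := by
      calc ⟪a x, x⟫ ≤ ‖a x‖ * ‖x‖ := real_inner_le_norm _ _
        _ ≤ C₁ * R := by gcongr; exact ha x h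
    have h5 : 4 * r ^ 2 * ⟪a x, x⟫ ≤ 4 * R ^ 2 * (C₁ * R) := by
      calc 4 * r ^ 2 * ⟪a x, x⟫ ≤ 4 * r ^ 2 * (C₁ * R) := by gcongr
        _ ≤ _ := by gcongr
    have h6 : k * r ^ 2 ≤ k * R ^ 2 := by gcongr
    have h7 : r ^ 3 ≤ R ^ 3 := by gcongr
    nlinarith [pow_nonneg hk0 3]

theorem exists_isMin_add_norm_pow_four {p : 𝔼 → ℝ} (hp : Continuous p)
    (hs : HasCompactSupport p) {c : ℝ} (hc : 0 ≤ c) :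
    ∃ x, ∀ y, c * ‖x‖ ^ 4 + p x ≤ c * ‖y‖ ^ 4 + p y := by
  rcases hc.eq_or_lt with rfl | hc
  · simp only [zero_mul, zero_add]
    exact hp.exists_forall_le_of_hasCompactSupport hs
  · refine Continuous.exists_forall_le (β := 𝔼) (f := fun x => c * ‖x‖ ^ 4 + p x)
      (by fun_prop) ?_
    obtain ⟨C, -, hC⟩ := exists_bound_of_compactSupport hp hs
    have h1 : Tendsto (fun x : 𝔼 => c * ‖x‖ ^ 4) (cocompact 𝔼) atTop :=
      ((tendsto_pow_atTop (by norm_num)).comp (tendsto_norm_cocompact_atTop (E := 𝔼))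
        ).const_mul_atTop hc
    exact tendsto_atTop_add_right_of_le _ (-C) h1 fun x => (abs_le.mp (hC x)).1

theorem diffGen_eq_traceL (c : 𝔼 → (𝔼 →L[ℝ] 𝔼)) (a : 𝔼 → 𝔼) (p : 𝔼 → ℝ) (x : 𝔼) :
    diffGen c a p x = (1 / 2 : ℝ) * traceL ((c x).comp (fderiv ℝ (fun y => gradient p y) x)) +
      ⟪a x, gradient p x⟫ := rfl

theorem measurable_clm_apply {Ω : Type*} [MeasurableSpace Ω] {T : Ω → (𝔼 →L[ℝ] 𝔼)}
    (hT : ∀ y, Measurable fun ω => T ω y) {v : Ω → 𝔼} (hv : Measurable v) :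
    Measurable fun ω => T ω (v ω) := by
  let e := EuclideanSpace.basisFun (Fin l) ℝ
  have : (fun ω => T ω (v ω)) = fun ω => ∑ i, ⟪e i, v ω⟫ • T ω (e i) := by
    ext1 ω
    conv_lhs => rw [← e.sum_repr' (v ω), map_sum]
    simp
  rw [this]
  exact Finset.measurable_fun_sum _ fun i _ => (measurable_const.inner hv).fun_smul (hT _)

theorem continuous_hessian {p : 𝔼 → ℝ} (hp : ContDiff ℝ (⊤ : ℕ∞) p) :
    Continuous (fderiv ℝ (fun y => gradient p y)) :=
  (contDiff_gradient hp).continuous_fderiv (by simp)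

theorem measurable_diffGen {Ω : Type*} [MeasurableSpace Ω] {c : Ω → 𝔼 → (𝔼 →L[ℝ] 𝔼)}
    {a : Ω → 𝔼 → 𝔼} {x : Ω → 𝔼} (hc : ∀ y, Measurable fun ω => c ω (x ω) y)
    (ha : Measurable fun ω => a ω (x ω)) (hx : Measurable x) {p : 𝔼 → ℝ}
    (hp : ContDiff ℝ (⊤ : ℕ∞) p) : Measurable fun ω => diffGen (c ω) (a ω) p (x ω) := by
  let e := EuclideanSpace.basisFun (Fin l) ℝ
  have : (fun ω => diffGen (c ω) (a ω) p (x ω)) = fun ω =>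
      (1 / 2 : ℝ) * (∑ i, ⟪e i, c ω (x ω) (fderiv ℝ (fun y => gradient p y) (x ω) (e i))⟫) +
      ⟪a ω (x ω), gradient p (x ω)⟫ := by
    ext1 ω
    rw [diffGen_eq_traceL, traceL_apply, LinearMap.trace_eq_sum_inner _ e]
    rfl
  rw [this]
  have h1 : Measurable fun ω => gradient p (x ω) :=
    (contDiff_gradient hp).continuous.measurable.comp hx
  have h2 : ∀ i, Measurable fun ω => fderiv ℝ (fun y => gradient p y) (x ω) (e i) := fun i =>
    (((continuous_hessian hp).clm_apply continuous_const).measurable).comp hx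
  exact ((Finset.measurable_fun_sum _ fun i _ => measurable_const.inner
    (measurable_clm_apply hc (h2 i))).const_mul _).add (ha.inner h1)

theorem continuous_diffGen {Y : Type*} [TopologicalSpace Y] {c : Y → 𝔼 → (𝔼 →L[ℝ] 𝔼)}
    {a : Y → 𝔼 → 𝔼} {x : Y → 𝔼} (hc : Continuous fun y => c y (x y))
    (ha : Continuous fun y => a y (x y)) (hx : Continuous x) {p : 𝔼 → ℝ}
    (hp : ContDiff ℝ (⊤ : ℕ∞) p) : Continuous fun y => diffGen (c y) (a y) p (x y) := by
  simp only [diffGen_eq_traceL]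
  have h1 : Continuous fun y => gradient p (x y) := (contDiff_gradient hp).continuous.comp hx
  have h2 : Continuous fun y => fderiv ℝ (fun y => gradient p y) (x y) :=
    (continuous_hessian hp).comp hx
  exact (continuous_const.mul (traceL.continuous.comp (hc.clm_comp h2))).add (ha.inner h1)

theorem abs_diffGen_le {c : 𝔼 → (𝔼 →L[ℝ] 𝔼)} {a : 𝔼 → 𝔼} (p : 𝔼 → ℝ) {x : 𝔼} {C₀ C₁ : ℝ}
    (hc : ‖c x‖ ≤ C₀) (ha : ‖a x‖ ≤ C₁) :
    |diffGen c a p x| ≤ ‖(traceL : (𝔼 →L[ℝ] 𝔼) →L[ℝ] ℝ)‖ *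
      (C₀ * ‖fderiv ℝ (fun y => gradient p y) x‖) + C₁ * ‖gradient p x‖ := by
  rw [diffGen_eq_traceL]
  refine (abs_add_le _ _).trans (add_le_add ?_ ?_)
  · rw [abs_mul]
    have h1 : |traceL ((c x).comp (fderiv ℝ (fun y => gradient p y) x))| ≤
        ‖(traceL : (𝔼 →L[ℝ] 𝔼) →L[ℝ] ℝ)‖ * (C₀ * ‖fderiv ℝ (fun y => gradient p y) x‖) :=
      (traceL.le_opNorm _).trans (by
        gcongr
        exact (ContinuousLinearMap.opNorm_comp_le _ _).trans (by gcongr))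
    have h2 : |(1 / 2 : ℝ)| ≤ 1 := by norm_num [abs_of_pos]
    nlinarith [abs_nonneg (traceL ((c x).comp (fderiv ℝ (fun y => gradient p y) x)))]
  · exact (abs_real_inner_le_norm _ _).trans (by gcongr)

theorem diffGen_add (c : 𝔼 → (𝔼 →L[ℝ] 𝔼)) (a : 𝔼 → 𝔼) {p q : 𝔼 → ℝ}
    (hp : ContDiff ℝ (⊤ : ℕ∞) p) (hq : ContDiff ℝ (⊤ : ℕ∞) q) (x : 𝔼) :
    diffGen c a (p + q) x = diffGen c a p x + diffGen c a q x := by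
  have h1 : (fun y => gradient (p + q) y) = (fun y => gradient p y) + fun y => gradient q y := by
    ext1 y
    unfold gradient
    rw [fderiv_add (hp.differentiable (by simp) y) (hq.differentiable (by simp) y), map_add]
    rfl
  have h2 : gradient (p + q) x = gradient p x + gradient q x := congrFun h1 x
  rw [diffGen_eq_traceL, h2, h1, fderiv_add ((contDiff_gradient hp).differentiable (by simp) x)
    ((contDiff_gradient hq).differentiable (by simp) x), ContinuousLinearMap.comp_add, map_add,
    inner_add_right, diffGen_eq_traceL, diffGen_eq_traceL]
  ring

theorem diffGen_const_smul (c : 𝔼 → (𝔼 →L[ℝ] 𝔼)) (a : 𝔼 → 𝔼) (r : ℝ) {p : 𝔼 → ℝ}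
    (hp : ContDiff ℝ (⊤ : ℕ∞) p) (x : 𝔼) : diffGen c a (r • p) x = r * diffGen c a p x := by
  have h1 : (fun y => gradient (r • p) y) = r • fun y => gradient p y := by
    ext1 y
    unfold gradient
    rw [fderiv_const_smul (hp.differentiable (by simp) y)]
    simp
  have h2 : gradient (r • p) x = r • gradient p x := congrFun h1 x
  rw [diffGen_eq_traceL, h2, h1, fderiv_const_smul ((contDiff_gradient hp).differentiable
    (by simp) x), ContinuousLinearMap.comp_smul, map_smul, inner_smul_right, diffGen_eq_traceL,
    smul_eq_mul]
  ring

theorem diffGen_of_notMem_tsupport (c : 𝔼 → (𝔼 →L[ℝ] 𝔼)) (a : 𝔼 → 𝔼) {p : 𝔼 → ℝ} {x : 𝔼}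
    (hx : x ∉ tsupport p) : diffGen c a p x = 0 := by
  have h0 : p =ᶠ[𝓝 x] fun _ => 0 := notMem_tsupport_iff_eventuallyEq.1 hx
  have h1 : (fun y => gradient p y) =ᶠ[𝓝 x] fun _ => 0 := by
    filter_upwards [h0.fderiv (𝕜 := ℝ)] with y hy
    unfold gradient
    rw [hy]; simp
  rw [diffGen_eq_traceL, h1.fderiv_eq, h1.eq_of_nhds]
  simp

theorem exists_averaged_stationary {S : Type*} [MeasurableSpace S] (σ : Measure S)
    [IsProbabilityMeasure σ] {c : S → 𝔼 → (𝔼 →L[ℝ] 𝔼)} {a : S → 𝔼 → 𝔼}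
    (hcm : ∀ x y, Measurable fun s => c s x y) (ham : ∀ x, Measurable fun s => a s x)
    (hcc : ∀ s, Continuous (c s)) (hac : ∀ s, Continuous (a s)) {C₀ C₁ R : ℝ} (hR : 0 ≤ R)
    (hc : ∀ s x, ‖c s x‖ ≤ C₀) (hpos : ∀ s x v, 0 ≤ ⟪c s x v, v⟫)
    (hbd : ∀ r : ℝ, ∃ C, ∀ s x, ‖x‖ ≤ r → ‖a s x‖ ≤ C)
    (ha : ∀ s x, ‖x‖ ≤ R → ‖a s x‖ ≤ C₁) (hst : ∀ s x, R ≤ ‖x‖ → ⟪a s x, x⟫ ≤ -‖x‖) :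
    ∃ μ : Measure 𝔼, IsProbabilityMeasure μ ∧
      (∀ p : 𝔼 → ℝ, ContDiff ℝ (⊤ : ℕ∞) p → HasCompactSupport p →
        ∫ x, ∫ s, diffGen (c s) (a s) p x ∂σ ∂μ = 0) ∧
      ∫⁻ x, ENNReal.ofReal (‖x‖ ^ 3) ∂μ ≤ ENNReal.ofReal
        (((2 * ‖(traceL : (𝔼 →L[ℝ] 𝔼) →L[ℝ] ℝ)‖ + 4) * C₀) ^ 3 +
        ((2 * ‖(traceL : (𝔼 →L[ℝ] 𝔼) →L[ℝ] ℝ)‖ + 4) * C₀) * R ^ 2 + 4 * R ^ 3 * C₁ + R ^ 3) := by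
  obtain ⟨s₀⟩ : Nonempty S := σ.nonempty_of_neZero
  have hC₀ : 0 ≤ C₀ := (norm_nonneg _).trans (hc s₀ 0)
  have hC₁ : 0 ≤ C₁ := (norm_nonneg _).trans (ha s₀ 0 (by simpa using hR))
  have hmeas : ∀ {p : 𝔼 → ℝ} (x : 𝔼), ContDiff ℝ (⊤ : ℕ∞) p →
      Measurable fun s => diffGen (c s) (a s) p x := fun x hp =>
    measurable_diffGen (x := fun _ => x) (hcm x) (ham x) measurable_const hp
  have hint : ∀ {p : 𝔼 → ℝ} (x : 𝔼), ContDiff ℝ (⊤ : ℕ∞) p →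
      Integrable (fun s => diffGen (c s) (a s) p x) σ := fun {p} x hp => by
    obtain ⟨C, hC⟩ := hbd ‖x‖
    exact Integrable.of_bound (hmeas x hp).aestronglyMeasurable _
      (ae_of_all _ fun s => abs_diffGen_le p (hc s x) (hC s x le_rfl))
  let L : testFun l →ₗ[ℝ] (𝔼 → ℝ) :=
    { toFun := fun p x => ∫ s, diffGen (c s) (a s) p.1 x ∂σ
      map_add' := fun p q => by
        ext1 x
        rw [Pi.add_apply, ← integral_add (hint x p.2.1) (hint x q.2.1)]
        exact integral_congr_ae (ae_of_all _ fun s => diffGen_add _ _ p.2.1 q.2.1 x)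
      map_smul' := fun r p => by
        ext1 x
        rw [RingHom.id_apply, Pi.smul_apply, smul_eq_mul, ← integral_const_mul]
        exact integral_congr_ae (ae_of_all _ fun s => diffGen_const_smul _ _ r p.2.1 x) }
  have key := exists_stationary_measure L
    (fun x => ∫ s, diffGen (c s) (a s) (fun x => ‖x‖ ^ 4) x ∂σ)
    (B := ((2 * ‖(traceL : (𝔼 →L[ℝ] 𝔼) →L[ℝ] ℝ)‖ + 4) * C₀) ^ 3 +
        ((2 * ‖(traceL : (𝔼 →L[ℝ] 𝔼) →L[ℝ] ℝ)‖ + 4) * C₀) * R ^ 2 + 4 * R ^ 3 * C₁ + R ^ 3)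
    ?_ (fun x => ?_) ?_
  · obtain ⟨μ, h1, h2, h3⟩ := key
    exact ⟨μ, h1, fun p hp hpc => h2 ⟨p, hp, hpc⟩, h3⟩
  · intro r hr p
    obtain ⟨x, hx⟩ := exists_isMin_add_norm_pow_four p.2.1.continuous p.2.2 hr
    refine ⟨x, ?_⟩
    have hV := contDiff_norm_pow_four (l := l)
    have hrV : ContDiff ℝ (⊤ : ℕ∞) (r • fun x : 𝔼 => ‖x‖ ^ 4) := contDiff_const.smul hV
    change 0 ≤ r * (∫ s, diffGen (c s) (a s) (fun x => ‖x‖ ^ 4) x ∂σ) +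
      ∫ s, diffGen (c s) (a s) p.1 x ∂σ
    rw [← integral_const_mul, ← integral_add ((hint x hV).const_mul r) (hint x p.2.1)]
    refine integral_nonneg fun s => ?_
    change 0 ≤ r * diffGen (c s) (a s) (fun x => ‖x‖ ^ 4) x + diffGen (c s) (a s) p.1 x
    rw [← diffGen_const_smul _ _ r hV, ← diffGen_add _ _ hrV p.2.1]
    exact diffGen_nonneg_of_isMin _ (hrV.add p.2.1) (hpos s x) hx
  · have := integral_mono (hint x (contDiff_norm_pow_four (l := l))) (integrable_const _)
      (fun s => diffGen_norm_pow_four_le hR hC₀ hC₁ (hc s) (ha s) (hst s) x)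
    simpa using this
  · refine fun p => ⟨?_, HasCompactSupport.intro p.2.2 fun x hx => ?_⟩
    · rw [continuous_iff_continuousAt]
      intro x₀
      obtain ⟨C, hC⟩ := hbd (‖x₀‖ + 1)
      obtain ⟨D₁, -, hD₁⟩ := exists_bound_of_compactSupport (contDiff_gradient p.2.1).continuous
        (hasCompactSupport_gradient p.2.2)
      obtain ⟨D₂, -, hD₂⟩ := exists_bound_of_compactSupport (continuous_hessian p.2.1)
        ((hasCompactSupport_gradient p.2.2).fderiv ℝ)
      refine continuousAt_of_dominated
        (bound := fun _ => ‖(traceL : (𝔼 →L[ℝ] 𝔼) →L[ℝ] ℝ)‖ * (C₀ * D₂) + C * D₁)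
        (Eventually.of_forall fun x => (hmeas x p.2.1).aestronglyMeasurable) ?_
        (integrable_const _) (ae_of_all _ fun s =>
          (continuous_diffGen (c := fun _ => c s) (a := fun _ => a s) (x := fun x => x)
            (hcc s) (hac s) continuous_id p.2.1).continuousAt)
      filter_upwards [Metric.ball_mem_nhds x₀ one_pos] with x hx
      have hx' : ‖x‖ ≤ ‖x₀‖ + 1 := by
        have := norm_le_norm_add_norm_sub' x x₀
        rw [Metric.mem_ball, dist_eq_norm] at hx
        linarith
      refine ae_of_all _ fun s => (abs_diffGen_le p.1 (hc s x) (hC s x hx')).trans ?_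
      have : 0 ≤ C := (norm_nonneg _).trans (hC s x hx')
      gcongr
      · exact hD₂ x
      · exact hD₁ x
    · change ∫ s, diffGen (c s) (a s) p.1 x ∂σ = 0
      simp [diffGen_of_notMem_tsupport _ _ hx]

variable {n : ℕ}

local notation "𝕌" => EuclideanSpace ℝ (Fin n)

/-- Global (not merely local) versions of the standing assumptions on the coefficients, with
explicit constants. -/
structure TameCoeff (A : ℝ → 𝕌 → 𝔼 → 𝕌) (a : ℝ → 𝕌 → 𝔼 → 𝔼) (c : ℝ → 𝕌 → 𝔼 → (𝔼 →L[ℝ] 𝔼))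
    (CA C₀ C₁ R : ℝ) : Prop where
  A_meas : Measurable fun q : ℝ × 𝕌 × 𝔼 => A q.1 q.2.1 q.2.2
  a_meas : Measurable fun q : ℝ × 𝕌 × 𝔼 => a q.1 q.2.1 q.2.2
  c_meas : ∀ y, Measurable fun q : ℝ × 𝕌 × 𝔼 => c q.1 q.2.1 q.2.2 y
  A_cont : ∀ s, Continuous fun q : 𝕌 × 𝔼 => A s q.1 q.2
  a_cont : ∀ s, Continuous fun q : 𝕌 × 𝔼 => a s q.1 q.2
  c_cont : ∀ s, Continuous fun q : 𝕌 × 𝔼 => c s q.1 q.2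
  A_bd : ∀ s u x, ‖A s u x‖ ≤ CA
  c_bd : ∀ s u x, ‖c s u x‖ ≤ C₀
  c_nonneg : ∀ s u x v, 0 ≤ ⟪c s u x v, v⟫
  a_locbd : ∀ r : ℝ, ∃ C, ∀ s u x, ‖x‖ ≤ r → ‖a s u x‖ ≤ C
  R_nonneg : 0 ≤ R
  a_bd : ∀ s u x, ‖x‖ ≤ R → ‖a s u x‖ ≤ C₁
  a_stab : ∀ s u x, R ≤ ‖x‖ → ⟪a s u x, x⟫ ≤ -‖x‖

section Piecewise

theorem floor_mul_eq_of_mem {k : ℕ} (hk : 0 < k) {j : ℕ} {s : ℝ}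
    (hs : s ∈ Ico ((j : ℝ) / k) ((j + 1 : ℝ) / k)) : ⌊(k : ℝ) * s⌋₊ = j := by
  have hk' : (0 : ℝ) < k := by exact_mod_cast hk
  have h1 := (div_le_iff₀ hk').1 hs.1
  have h2 := (lt_div_iff₀ hk').1 hs.2
  have h0 : (0 : ℝ) ≤ k * s := by
    have : (0 : ℝ) ≤ j := by positivity
    linarith
  rw [Nat.floor_eq_iff h0]
  constructor <;> linarith

theorem intervalIntegrable_of_bounded {E : Type*} [NormedAddCommGroup E] {γ : ℝ → E} (hm : StronglyMeasurable γ) {C : ℝ}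
    (hC : ∀ s, ‖γ s‖ ≤ C) (r r' : ℝ) : IntervalIntegrable γ volume r r' :=
  (intervalIntegrable_const (c := C)).mono_fun hm.aestronglyMeasurable
    (ae_of_all _ fun s => (hC s).trans (Real.le_norm_self C))

variable {E : Type*} [NormedAddCommGroup E] [NormedSpace ℝ E]

theorem integral_piecewise_eq_sum {k : ℕ} (hk : 0 < k) {γ : ℝ → E} {γ' : ℕ → ℝ → E}
    (hγ : ∀ s, γ s = γ' ⌊(k : ℝ) * s⌋₊ s) (hm : StronglyMeasurable γ) {C : ℝ}
    (hC : ∀ s, ‖γ s‖ ≤ C) (j : ℕ) :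
    ∫ s in (0 : ℝ)..(j / k), γ s =
      ∑ i ∈ Finset.range j, ∫ s in ((i : ℝ) / k)..((i + 1 : ℝ) / k), γ' i s := by
  have hk' : (0 : ℝ) < k := by exact_mod_cast hk
  have h := intervalIntegral.sum_integral_adjacent_intervals (μ := volume) (f := γ)
    (a := fun i : ℕ => (i : ℝ) / k) (n := j)
    (fun i _ => intervalIntegrable_of_bounded hm hC _ _)
  simp only [Nat.cast_zero, zero_div, Nat.cast_add, Nat.cast_one] at h
  rw [← h]
  refine Finset.sum_congr rfl fun i _ => ?_
  have hle : (i : ℝ) / k ≤ (i + 1 : ℝ) / k := by gcongr; linarith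
  rw [intervalIntegral.integral_of_le hle, intervalIntegral.integral_of_le hle,
    ← integral_Ico_eq_integral_Ioc, ← integral_Ico_eq_integral_Ioc]
  refine setIntegral_congr_fun measurableSet_Ico fun s hs => ?_
  rw [hγ, floor_mul_eq_of_mem hk hs]

theorem norm_integral_piecewise_sub_sum_le {k : ℕ} (hk : 0 < k) {γ : ℝ → E} {γ' : ℕ → ℝ → E}
    (hγ : ∀ s, γ s = γ' ⌊(k : ℝ) * s⌋₊ s) (hm : StronglyMeasurable γ) {C : ℝ}
    (hC : ∀ s, ‖γ s‖ ≤ C) {r : ℝ} (hr : 0 ≤ r) :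
    ‖(∫ s in (0 : ℝ)..r, γ s) - ∑ i ∈ Finset.range ⌊(k : ℝ) * r⌋₊,
      ∫ s in ((i : ℝ) / k)..((i + 1 : ℝ) / k), γ' i s‖ ≤ C / k := by
  have hk' : (0 : ℝ) < k := by exact_mod_cast hk
  have hC0 : 0 ≤ C := (norm_nonneg _).trans (hC 0)
  rw [← integral_piecewise_eq_sum hk hγ hm hC, intervalIntegral.integral_interval_sub_left
    (intervalIntegrable_of_bounded hm hC _ _) (intervalIntegrable_of_bounded hm hC _ _)]
  refine (intervalIntegral.norm_integral_le_of_norm_le_const fun s _ => hC s).trans ?_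
  have h1 : (⌊(k : ℝ) * r⌋₊ : ℝ) ≤ k * r := Nat.floor_le (by positivity)
  have h2 : (k : ℝ) * r < ⌊(k : ℝ) * r⌋₊ + 1 := Nat.lt_floor_add_one _
  have h3 : (⌊(k : ℝ) * r⌋₊ : ℝ) / k ≤ r := by rw [div_le_iff₀ hk']; linarith
  have h4 : r - (⌊(k : ℝ) * r⌋₊ : ℝ) / k ≤ 1 / k := by
    rw [sub_le_iff_le_add, ← add_div, le_div_iff₀ hk']; linarith
  rw [abs_of_nonneg (by linarith)]
  exact (mul_le_mul_of_nonneg_left h4 hC0).trans_eq (mul_one_div C k)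

end Piecewise

variable {A : ℝ → EuclideanSpace ℝ (Fin n) → EuclideanSpace ℝ (Fin l) → EuclideanSpace ℝ (Fin n)}
  {a : ℝ → EuclideanSpace ℝ (Fin n) → EuclideanSpace ℝ (Fin l) → EuclideanSpace ℝ (Fin l)}
  {c : ℝ → EuclideanSpace ℝ (Fin n) → EuclideanSpace ℝ (Fin l) →
    (EuclideanSpace ℝ (Fin l) →L[ℝ] EuclideanSpace ℝ (Fin l))}
  {CA C₀ C₁ R : ℝ}

theorem TameCoeff.exists_diffGen_bound (h : TameCoeff A a c CA C₀ C₁ R) {p : 𝔼 → ℝ}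
    (hp : ContDiff ℝ (⊤ : ℕ∞) p) (hpc : HasCompactSupport p) :
    ∃ C, 0 ≤ C ∧ ∀ s u x, |diffGen (c s u) (a s u) p x| ≤ C := by
  obtain ⟨r, hr⟩ := hpc.isBounded.subset_closedBall (0 : 𝔼)
  obtain ⟨C, hC⟩ := h.a_locbd r
  obtain ⟨D₁, hD₁0, hD₁⟩ := exists_bound_of_compactSupport (contDiff_gradient hp).continuous
    (hasCompactSupport_gradient hpc)
  obtain ⟨D₂, hD₂0, hD₂⟩ := exists_bound_of_compactSupport (continuous_hessian hp)
    ((hasCompactSupport_gradient hpc).fderiv ℝ)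
  have hC₀ : 0 ≤ C₀ := (norm_nonneg _).trans (h.c_bd 0 0 0)
  refine ⟨‖(traceL : (𝔼 →L[ℝ] 𝔼) →L[ℝ] ℝ)‖ * (C₀ * D₂) + max C 0 * D₁, by positivity,
    fun s u x => ?_⟩
  by_cases hx : x ∈ tsupport p
  · have hxr : ‖x‖ ≤ r := mem_closedBall_zero_iff.1 (hr hx)
    have ha : ‖a s u x‖ ≤ max C 0 := (hC s u x hxr).trans (le_max_left C 0)
    refine (abs_diffGen_le (c := c s u) (a := a s u) p (h.c_bd s u x) ha).trans ?_
    have h1 := hD₁ x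
    have h2 := hD₂ x
    gcongr
  · rw [diffGen_of_notMem_tsupport _ _ hx, abs_zero]
    positivity

theorem TameCoeff.measurable_diffGen (h : TameCoeff A a c CA C₀ C₁ R) {p : 𝔼 → ℝ}
    (hp : ContDiff ℝ (⊤ : ℕ∞) p) :
    Measurable fun q : ℝ × 𝕌 × 𝔼 => diffGen (c q.1 q.2.1) (a q.1 q.2.1) p q.2.2 :=
  _root_.measurable_diffGen (c := fun q : ℝ × 𝕌 × 𝔼 => c q.1 q.2.1)
    (a := fun q : ℝ × 𝕌 × 𝔼 => a q.1 q.2.1) (x := fun q => q.2.2)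
    h.c_meas h.a_meas measurable_snd.snd hp

theorem TameCoeff.exists_window_stationary (h : TameCoeff A a c CA C₀ C₁ R) (k : ℕ)
    (hk : 0 < k) (j : ℕ) (u : 𝕌) :
    ∃ μ : Measure 𝔼, IsProbabilityMeasure μ ∧
      (∀ p : 𝔼 → ℝ, ContDiff ℝ (⊤ : ℕ∞) p → HasCompactSupport p →
        ∫ s in ((j : ℝ) / k)..((j + 1 : ℝ) / k), ∫ x, diffGen (c s u) (a s u) p x ∂μ = 0) ∧
      ∫⁻ x, ENNReal.ofReal (‖x‖ ^ 3) ∂μ ≤ ENNReal.ofReal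
        (((2 * ‖(traceL : (𝔼 →L[ℝ] 𝔼) →L[ℝ] ℝ)‖ + 4) * C₀) ^ 3 +
        ((2 * ‖(traceL : (𝔼 →L[ℝ] 𝔼) →L[ℝ] ℝ)‖ + 4) * C₀) * R ^ 2 + 4 * R ^ 3 * C₁ + R ^ 3) := by
  have hk' : (0 : ℝ) < k := by exact_mod_cast hk
  let ν : Measure ℝ := volume.restrict (Ioc ((j : ℝ) / k) ((j + 1 : ℝ) / k))
  have hν : ν univ = ENNReal.ofReal (1 / k) := by
    simp only [ν, Measure.restrict_apply_univ, Real.volume_Ioc]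
    congr 1; field_simp; ring
  let σ : Measure ℝ := ENNReal.ofReal k • ν
  have : IsProbabilityMeasure σ := ⟨by
    rw [Measure.smul_apply, hν, smul_eq_mul, ← ENNReal.ofReal_mul hk'.le, mul_one_div_cancel hk'.ne',
      ENNReal.ofReal_one]⟩
  have hsu : ∀ x : 𝔼, Measurable fun s : ℝ => (s, u, x) := fun x => by fun_prop
  obtain ⟨μ, h1, h2, h3⟩ := exists_averaged_stationary σ (c := fun s => c s u)
    (a := fun s => a s u) (fun x y => (h.c_meas y).comp (hsu x)) (fun x => h.a_meas.comp (hsu x))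
    (fun s => (h.c_cont s).comp (by fun_prop : Continuous fun x : 𝔼 => (u, x)))
    (fun s => (h.a_cont s).comp (by fun_prop : Continuous fun x : 𝔼 => (u, x))) h.R_nonneg
    (fun s => h.c_bd s u) (fun s => h.c_nonneg s u)
    (fun r => (h.a_locbd r).imp fun C hC s => hC s u) (fun s => h.a_bd s u)
    (fun s => h.a_stab s u)
  refine ⟨μ, h1, fun p hp hpc => ?_, h3⟩
  have h4 := h2 p hp hpc
  obtain ⟨C, -, hC⟩ := h.exists_diffGen_bound hp hpc
  simp only [σ, integral_smul_measure, integral_const_mul, smul_eq_mul,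
    ENNReal.toReal_ofReal hk'.le, mul_eq_zero, hk'.ne', false_or] at h4
  rw [intervalIntegral.integral_of_le (by gcongr; linarith), ← h4]
  refine integral_integral_swap (μ := ν) (ν := μ) ?_
  have : IsFiniteMeasure ν := ⟨by rw [hν]; exact ENNReal.ofReal_lt_top⟩
  refine Integrable.of_bound (C := C) (Measurable.aestronglyMeasurable ?_)
    (ae_of_all _ fun q => hC _ _ _)
  exact (h.measurable_diffGen hp).comp (by fun_prop : Measurable fun q : ℝ × 𝔼 => (q.1, u, q.2))

open ProbabilityTheory in
/-- The law on `(time, slow, fast)` space of a process which at time `s ∈ [0, 1)` has slow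
component `u ⌊ks⌋` and fast component distributed as `μ ⌊ks⌋`. -/
theorem exists_piecewise_law (k : ℕ) (u : ℕ → 𝕌) (μ : ℕ → Measure 𝔼)
    [∀ j, IsProbabilityMeasure (μ j)] {B : ENNReal}
    (hB : ∀ j, ∫⁻ x, ENNReal.ofReal (‖x‖ ^ 3) ∂(μ j) ≤ B) :
    ∃ M : Measure (ℝ × 𝕌 × 𝔼), IsProbabilityMeasure M ∧
      M.map Prod.fst = volume.restrict (Ico 0 1) ∧
      (∀ᵐ q ∂M, q.2.1 = u ⌊(k : ℝ) * q.1⌋₊) ∧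
      ∫⁻ q, ENNReal.ofReal (‖q.2.2‖ ^ 3) ∂M ≤ B ∧
      ∀ {E : Type} [NormedAddCommGroup E] [NormedSpace ℝ E] [SecondCountableTopology E]
        [MeasurableSpace E] [BorelSpace E] (g : ℝ × 𝕌 × 𝔼 → E) (C : ℝ), Measurable g →
        (∀ q, ‖g q‖ ≤ C) →
        StronglyMeasurable (fun s => ∫ x, g (s, u ⌊(k : ℝ) * s⌋₊, x) ∂(μ ⌊(k : ℝ) * s⌋₊)) ∧
        ∀ r ∈ Icc (0 : ℝ) 1, ∫ q in Iio r ×ˢ univ, g q ∂M =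
          ∫ s in (0 : ℝ)..r, ∫ x, g (s, u ⌊(k : ℝ) * s⌋₊, x) ∂(μ ⌊(k : ℝ) * s⌋₊) := by
  let J : ℝ → ℕ := fun s => ⌊(k : ℝ) * s⌋₊
  have hJ : Measurable J := Nat.measurable_floor.comp (measurable_const_mul _)
  let κ : Kernel ℝ 𝔼 := (Kernel.ofFunOfCountable μ).comap J hJ
  have hκ : ∀ s, κ s = μ (J s) := fun s => rfl
  have : IsMarkovKernel κ := ⟨fun s => by rw [hκ]; infer_instance⟩
  let ν : Measure ℝ := volume.restrict (Ico 0 1)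
  have : IsProbabilityMeasure ν := ⟨by simp [ν]⟩
  let T : ℝ × 𝔼 → ℝ × 𝕌 × 𝔼 := fun q => (q.1, u (J q.1), q.2)
  have hT : Measurable T := measurable_fst.prodMk
    (((measurable_of_countable u).comp (hJ.comp measurable_fst)).prodMk measurable_snd)
  have hTa : AEMeasurable T (ν ⊗ₘ κ) := hT.aemeasurable
  refine ⟨(ν ⊗ₘ κ).map T, Measure.isProbabilityMeasure_map hTa, ?_, ?_, ?_, ?_⟩
  · rw [Measure.map_map measurable_fst hT]
    exact Measure.fst_compProd ν κ
  · refine (ae_map_iff (p := fun q => q.2.1 = u ⌊(k : ℝ) * q.1⌋₊) hTa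
      (measurableSet_eq_fun measurable_snd.fst
        ((measurable_of_countable u).comp (hJ.comp measurable_fst)))).2 ?_
    exact ae_of_all _ fun q => rfl
  · have hm : Measurable fun q : ℝ × 𝕌 × 𝔼 => ENNReal.ofReal (‖q.2.2‖ ^ 3) := by fun_prop
    rw [lintegral_map hm hT]
    refine (Measure.lintegral_compProd (hm.comp hT)).trans_le ?_
    calc ∫⁻ s, ∫⁻ x, ENNReal.ofReal (‖x‖ ^ 3) ∂(κ s) ∂ν ≤ ∫⁻ s, B ∂ν :=
          lintegral_mono fun s => hB (J s)
      _ = B := by simp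
  · intro E _ _ _ _ _ g C hg hC
    refine ⟨StronglyMeasurable.integral_kernel_prod_right' (κ := κ)
      (hg.comp hT).stronglyMeasurable, fun r hr => ?_⟩
    rw [setIntegral_map (measurableSet_Iio.prod MeasurableSet.univ)
      hg.aestronglyMeasurable hTa]
    have hpre : T ⁻¹' (Iio r ×ˢ univ) = Iio r ×ˢ univ := by ext; simp [T]
    rw [hpre]
    refine (Measure.setIntegral_compProd (f := g ∘ T) measurableSet_Iio MeasurableSet.univ
      (Integrable.of_bound (hg.comp hT).aestronglyMeasurable C
        (ae_of_all _ fun q => hC _)).integrableOn).trans ?_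
    simp only [Measure.restrict_univ]
    have hI : Iio r ∩ Ico (0 : ℝ) 1 = Ico 0 r := by
      ext s
      simp only [mem_inter_iff, mem_Iio, mem_Ico]
      exact ⟨fun h => ⟨h.2.1, h.1⟩, fun h => ⟨h.2, h.1, h.2.trans_le hr.2⟩⟩
    rw [Measure.restrict_restrict measurableSet_Iio, hI,
      intervalIntegral.integral_of_le hr.1, integral_Ico_eq_integral_Ioc]
    rfl

theorem TameCoeff.exists_euler (h : TameCoeff A a c CA C₀ C₁ R) (z : 𝕌) {G N : ℝ} (hG : 0 ≤ G)
    (hN0 : 0 ≤ N) (hgrow : ∀ s u x, ‖u‖ ≤ N → ⟪u, A s u x⟫ ≤ G * (1 + ‖u‖ ^ 2))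
    (hN : (1 + ‖z‖ ^ 2) * Real.exp (2 * G + 1) ≤ 1 + N ^ 2) {k : ℕ} (hk : 0 < k)
    (hkA : CA ^ 2 ≤ k) :
    ∃ (M : Measure (ℝ × 𝕌 × 𝔼)) (w : ℝ → 𝕌), IsProbabilityMeasure M ∧
      M.map Prod.fst = volume.restrict (Ico 0 1) ∧
      (∀ᵐ q ∂M, q.2.1 = w q.1) ∧ (∀ s ∈ Ico (0 : ℝ) 1, ‖w s‖ ≤ N) ∧
      ∫⁻ q, ENNReal.ofReal (‖q.2.2‖ ^ 3) ∂M ≤ ENNReal.ofReal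
        (((2 * ‖(traceL : (𝔼 →L[ℝ] 𝔼) →L[ℝ] ℝ)‖ + 4) * C₀) ^ 3 +
        ((2 * ‖(traceL : (𝔼 →L[ℝ] 𝔼) →L[ℝ] ℝ)‖ + 4) * C₀) * R ^ 2 + 4 * R ^ 3 * C₁ + R ^ 3) ∧
      (∀ p : 𝔼 → ℝ, ContDiff ℝ (⊤ : ℕ∞) p → HasCompactSupport p → ∀ C : ℝ,
        (∀ s u x, |diffGen (c s u) (a s u) p x| ≤ C) → ∀ r ∈ Icc (0 : ℝ) 1,
        |∫ q in Iio r ×ˢ univ, diffGen (c q.1 q.2.1) (a q.1 q.2.1) p q.2.2 ∂M| ≤ C / k) ∧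
      ∀ s ∈ Ico (0 : ℝ) 1,
        ‖w s - (z + ∫ q in Iio s ×ˢ univ, A q.1 q.2.1 q.2.2 ∂M)‖ ≤ CA / k := by
  have hk' : (0 : ℝ) < k := by exact_mod_cast hk
  have hCA : 0 ≤ CA := (norm_nonneg _).trans (h.A_bd 0 0 0)
  choose μ hμ1 hμ2 hμ3 using h.exists_window_stationary k hk
  let D : ℕ → 𝕌 → 𝕌 := fun j v =>
    ∫ s in ((j : ℝ) / k)..((j + 1 : ℝ) / k), ∫ x, A s v x ∂(μ j v)
  let u : ℕ → 𝕌 := fun j => Nat.rec z (fun i v => v + D i v) j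
  have hu0 : u 0 = z := rfl
  have hus : ∀ j, u (j + 1) = u j + D j (u j) := fun j => rfl
  have husum : ∀ j, u j = z + ∑ i ∈ Finset.range j, D i (u i) := by
    intro j
    induction j with
    | zero => simp [hu0]
    | succ j ih => rw [hus, Finset.sum_range_succ, ← add_assoc, ← ih]
  have hlen : ∀ j : ℕ, |((j + 1 : ℝ) / k) - (j : ℝ) / k| = 1 / k := fun j => by
    rw [← sub_div, add_sub_cancel_left, abs_of_nonneg (by positivity)]
  have hAint : ∀ s v j, Integrable (fun x => A s v x) (μ j v) := fun s v j =>
    Integrable.of_bound (h.A_meas.comp (by fun_prop : Measurable fun x : 𝔼 => (s, v, x))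
      ).aestronglyMeasurable CA (ae_of_all _ fun x => h.A_bd s v x)
  have hAb : ∀ s v j, ‖∫ x, A s v x ∂(μ j v)‖ ≤ CA := fun s v j => by
    simpa using norm_integral_le_of_norm_le_const (μ := μ j v)
      (ae_of_all _ fun x => h.A_bd s v x)
  have hDn : ∀ j v, ‖D j v‖ ≤ CA / k := fun j v => by
    have := intervalIntegral.norm_integral_le_of_norm_le_const (a := (j : ℝ) / k)
      (b := (j + 1 : ℝ) / k) (f := fun s => ∫ x, A s v x ∂(μ j v)) (fun s _ => hAb s v j)
    rwa [hlen, mul_one_div] at this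
  have hAm : ∀ j v, StronglyMeasurable fun s => ∫ x, A s v x ∂(μ j v) := fun j v =>
    StronglyMeasurable.integral_prod_right' (f := fun q : ℝ × 𝔼 => A q.1 v q.2)
      (h.A_meas.comp (by fun_prop : Measurable fun q : ℝ × 𝔼 => (q.1, v, q.2))).stronglyMeasurable
  have hDi : ∀ j v, ‖v‖ ≤ N → ⟪v, D j v⟫ ≤ G * (1 + ‖v‖ ^ 2) / k := fun j v hv => by
    have h1 := (innerSL ℝ v).intervalIntegral_comp_comm
      (intervalIntegrable_of_bounded (hAm j v) (fun s => hAb s v j) ((j : ℝ) / k)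
        ((j + 1 : ℝ) / k))
    have h2 : ⟪v, D j v⟫ = ∫ s in ((j : ℝ) / k)..((j + 1 : ℝ) / k),
        ⟪v, ∫ x, A s v x ∂(μ j v)⟫ := h1.symm
    have hle : (j : ℝ) / k ≤ (j + 1 : ℝ) / k := by gcongr; linarith
    have h3 : ∫ s in ((j : ℝ) / k)..((j + 1 : ℝ) / k), ⟪v, ∫ x, A s v x ∂(μ j v)⟫ ≤
        ∫ s in ((j : ℝ) / k)..((j + 1 : ℝ) / k), G * (1 + ‖v‖ ^ 2) := by
      refine intervalIntegral.integral_mono hle ?_ intervalIntegrable_const fun s => ?_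
      · exact intervalIntegrable_of_bounded (stronglyMeasurable_const.inner (hAm j v))
          (C := ‖v‖ * CA) (fun s => (norm_inner_le_norm _ _).trans
            (mul_le_mul_of_nonneg_left (hAb s v j) (norm_nonneg v))) _ _
      · change ⟪v, ∫ x, A s v x ∂(μ j v)⟫ ≤ G * (1 + ‖v‖ ^ 2)
        rw [← integral_inner (hAint s v j)]
        have := integral_mono ((hAint s v j).const_inner v)
          (integrable_const (G * (1 + ‖v‖ ^ 2))) (fun x => hgrow s v x hv)
        simpa using this
    rw [h2]
    refine h3.trans_eq ?_
    rw [intervalIntegral.integral_const, smul_eq_mul, ← sub_div, add_sub_cancel_left]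
    ring
  set ρ : ℝ := 1 + (2 * G + 1) / k with hρ
  have hρ1 : 1 ≤ ρ := by rw [hρ]; linarith [show 0 ≤ (2 * G + 1) / k by positivity]
  have hρk : ∀ j ≤ k, (1 + ‖z‖ ^ 2) * ρ ^ j ≤ 1 + N ^ 2 := fun j hj => by
    refine le_trans ?_ hN
    gcongr
    calc ρ ^ j ≤ ρ ^ k := pow_le_pow_right₀ hρ1 hj
      _ ≤ (Real.exp ((2 * G + 1) / k)) ^ k := by
        refine pow_le_pow_left₀ (by linarith) ?_ k
        have := Real.add_one_le_exp ((2 * G + 1) / k); linarith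
      _ = Real.exp (2 * G + 1) := by
        rw [← Real.exp_nat_mul]; congr 1; field_simp
  have hbd : ∀ j ≤ k, 1 + ‖u j‖ ^ 2 ≤ (1 + ‖z‖ ^ 2) * ρ ^ j := by
    intro j
    induction j with
    | zero => intro _; simp [hu0]
    | succ j ih =>
      intro hj
      have h1 := ih (by omega)
      have h2 : ‖u j‖ ≤ N := by
        have := h1.trans (hρk j (by omega))
        exact abs_le_of_sq_le_sq' (by linarith) hN0 |>.2
      have h3 := hDi j (u j) h2
      have h4 : ‖D j (u j)‖ ^ 2 ≤ 1 / k := by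
        calc ‖D j (u j)‖ ^ 2 ≤ (CA / k) ^ 2 := by gcongr; exact hDn _ _
          _ = CA ^ 2 / k / k := by ring
          _ ≤ 1 / k := by gcongr; exact (div_le_one hk').2 hkA
      rw [hus, norm_add_sq_real, pow_succ ρ j, ← mul_assoc]
      have h5 : 1 / (k : ℝ) ≤ (1 + ‖u j‖ ^ 2) / k := by gcongr; nlinarith [sq_nonneg ‖u j‖]
      calc 1 + (‖u j‖ ^ 2 + 2 * ⟪u j, D j (u j)⟫ + ‖D j (u j)‖ ^ 2)
          ≤ 1 + (‖u j‖ ^ 2 + 2 * (G * (1 + ‖u j‖ ^ 2) / k) + (1 + ‖u j‖ ^ 2) / k) := by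
            linarith
        _ = (1 + ‖u j‖ ^ 2) * ρ := by rw [hρ]; ring
        _ ≤ _ := by gcongr
  have huN : ∀ j ≤ k, ‖u j‖ ≤ N := fun j hj => by
    have := (hbd j hj).trans (hρk j hj)
    exact abs_le_of_sq_le_sq' (by linarith) hN0 |>.2
  have : ∀ j, IsProbabilityMeasure (μ j (u j)) := fun j => hμ1 j _
  obtain ⟨M, hM, hfst, hw, hmom, hint⟩ := exists_piecewise_law k u (fun j => μ j (u j))
    (fun j => hμ3 j (u j))
  refine ⟨M, fun s => u ⌊(k : ℝ) * s⌋₊, hM, hfst, hw, fun s hs => ?_, hmom, ?_, ?_⟩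
  · refine huN _ (Nat.floor_le_of_le ?_)
    nlinarith [hs.2]
  · intro p hp hpc C hC r hr
    obtain ⟨h1, h2⟩ := hint (fun q => diffGen (c q.1 q.2.1) (a q.1 q.2.1) p q.2.2) C
      (h.measurable_diffGen hp) (fun q => hC _ _ _)
    have h3 := norm_integral_piecewise_sub_sum_le hk
      (γ' := fun j s => ∫ x, diffGen (c s (u j)) (a s (u j)) p x ∂(μ j (u j)))
      (fun s => rfl) h1 (C := C) (fun s => ?_) hr.1
    · rw [h2 r hr]
      simpa [hμ2 _ _ p hp hpc] using h3
    · simpa using norm_integral_le_of_norm_le_const (μ := μ ⌊(k : ℝ) * s⌋₊ (u ⌊(k : ℝ) * s⌋₊))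
        (f := fun x => diffGen (c s (u ⌊(k : ℝ) * s⌋₊)) (a s (u ⌊(k : ℝ) * s⌋₊)) p x) (C := C)
        (ae_of_all _ fun x => by rw [Real.norm_eq_abs]; exact hC s (u ⌊(k : ℝ) * s⌋₊) x)
  · intro s hs
    obtain ⟨h1, h2⟩ := hint (fun q => A q.1 q.2.1 q.2.2) CA h.A_meas (fun q => h.A_bd _ _ _)
    have h3 := norm_integral_piecewise_sub_sum_le hk
      (γ' := fun j s => ∫ x, A s (u j) x ∂(μ j (u j)))
      (fun s => rfl) h1 (C := CA) (fun s => hAb _ _ _) hs.1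
    have e := husum ⌊(k : ℝ) * s⌋₊
    change ‖u ⌊(k : ℝ) * s⌋₊ - _‖ ≤ _
    rw [h2 s ⟨hs.1, hs.2.le⟩]
    rw [← norm_sub_rev] at h3
    refine le_trans (le_of_eq ?_) h3
    conv_lhs => rw [e]
    congr 1
    exact add_sub_add_left_eq_sub _ _ _

section Caratheodory

theorem stronglyMeasurable_continuousMap_of_eval {Ω K : Type*} [MeasurableSpace Ω]
    [TopologicalSpace K] [CompactSpace K] [TopologicalSpace.MetrizableSpace K] {G : Ω → C(K, ℝ)}
    (hG : ∀ y, Measurable fun s => G s y) : StronglyMeasurable G := by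
  have : SecondCountableTopology K := by
    let : MetricSpace K := TopologicalSpace.metrizableSpaceMetric K
    infer_instance
  obtain ⟨D, hDc, hD⟩ := TopologicalSpace.exists_countable_dense K
  have hball : ∀ (f : C(K, ℝ)) (r : ℝ), 0 ≤ r → MeasurableSet (G ⁻¹' Metric.closedBall f r) := by
    intro f r hr
    have : G ⁻¹' Metric.closedBall f r = ⋂ y ∈ D, {s | |G s y - f y| ≤ r} := by
      ext s
      simp only [mem_preimage, Metric.mem_closedBall, mem_iInter, mem_ofPred_eq]
      rw [ContinuousMap.dist_le hr]
      refine ⟨fun h y _ => h y, fun h y => ?_⟩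
      have hcl : IsClosed {y | |G s y - f y| ≤ r} :=
        isClosed_le (by fun_prop) continuous_const
      exact hcl.closure_subset_iff.2 (fun y hy => h y hy) (hD y)
    rw [this]
    exact MeasurableSet.biInter hDc fun y _ =>
      measurableSet_le ((hG y).sub_const _).abs measurable_const
  let : MeasurableSpace C(K, ℝ) := borel _
  have : BorelSpace C(K, ℝ) := ⟨rfl⟩
  refine (measurable_of_isOpen fun U hU => ?_).stronglyMeasurable
  have h1 : ∀ f : U, ∃ r : ℝ, 0 < r ∧ Metric.closedBall (f : C(K, ℝ)) r ⊆ U := fun f =>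
    Metric.nhds_basis_closedBall.mem_iff.1 (hU.mem_nhds f.2)
  choose r hr hrU using h1
  obtain ⟨T, hTc, hT⟩ := TopologicalSpace.isOpen_iUnion_countable
    (fun f : U => Metric.ball (f : C(K, ℝ)) (r f)) (fun f => Metric.isOpen_ball)
  have hU' : U = ⋃ f ∈ T, Metric.closedBall (f : C(K, ℝ)) (r f) := by
    apply Subset.antisymm
    · intro f hf
      have : f ∈ ⋃ f : U, Metric.ball (f : C(K, ℝ)) (r f) :=
        mem_iUnion.2 ⟨⟨f, hf⟩, Metric.mem_ball_self (hr _)⟩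
      rw [← hT] at this
      exact biUnion_mono subset_rfl (fun _ _ => Metric.ball_subset_closedBall) this
    · exact iUnion₂_subset fun f _ => hrU f
  rw [hU', preimage_iUnion₂]
  exact MeasurableSet.biUnion hTc fun f _ => hball f _ (hr f).le

/-- The radial retraction onto the ball of radius `r`. -/
noncomputable def radialProj {Y : Type*} [NormedAddCommGroup Y] [NormedSpace ℝ Y] (r : ℝ) (y : Y) :
    Y :=
  (r / max r ‖y‖) • y

section RadialProj

variable {Y : Type*} [NormedAddCommGroup Y] [NormedSpace ℝ Y] {r : ℝ}

theorem continuous_radialProj (hr : 0 < r) : Continuous (radialProj r : Y → Y) := by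
  unfold radialProj
  exact (continuous_const.div (continuous_const.max continuous_norm)
    fun y => (hr.trans_le (le_max_left _ _)).ne').smul continuous_id

theorem norm_radialProj_le (hr : 0 < r) (y : Y) : ‖radialProj r y‖ ≤ r := by
  have h : 0 < max r ‖y‖ := hr.trans_le (le_max_left _ _)
  rw [radialProj, norm_smul, Real.norm_of_nonneg (by positivity), div_mul_eq_mul_div,
    div_le_iff₀ h]
  gcongr
  exact le_max_right _ _

theorem radialProj_of_norm_le (hr : 0 < r) {y : Y} (hy : ‖y‖ ≤ r) : radialProj r y = y := by
  rw [radialProj, max_eq_left hy, div_self hr.ne', one_smul]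

end RadialProj

variable {Y : Type*} [NormedAddCommGroup Y] [NormedSpace ℝ Y] [FiniteDimensional ℝ Y]
  [MeasurableSpace Y]

theorem exists_boundedContinuous_approx {lam : Measure ℝ} [IsFiniteMeasure lam]
    {g : ℝ × Y → ℝ} (hgm : Measurable g) (hgc : ∀ s, Continuous fun y => g (s, y)) {C : ℝ}
    (hC : ∀ q, |g q| ≤ C) {r : ℝ} (hr : 0 < r) {ε : ℝ} (hε : 0 < ε) :
    ∃ (h : BoundedContinuousFunction (ℝ × Y) ℝ) (d : ℝ → ℝ), Integrable d lam ∧ ∫ s, d s ∂lam ≤ ε ∧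
      ∀ s y, |g (s, radialProj r y) - h (s, y)| ≤ d s := by
  let K := Metric.closedBall (0 : Y) r
  have : CompactSpace K := isCompact_iff_compactSpace.1 (by
    have : ProperSpace Y := FiniteDimensional.proper ℝ Y
    exact isCompact_closedBall _ _)
  let G : ℝ → C(K, ℝ) := fun s => ⟨fun y => g (s, y), (hgc s).comp continuous_subtype_val⟩
  have hG : StronglyMeasurable G := stronglyMeasurable_continuousMap_of_eval fun y =>
    hgm.comp (measurable_id.prodMk measurable_const)
  have hC0 : 0 ≤ C := (abs_nonneg _).trans (hC 0)
  have hGi : Integrable G lam := Integrable.of_bound hG.aestronglyMeasurable C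
    (ae_of_all _ fun s => (ContinuousMap.norm_le _ hC0).2 fun y => hC _)
  obtain ⟨f, hf, hfi⟩ := hGi.exists_boundedContinuous_integral_sub_le hε
  let ρ : Y → K := fun y => ⟨radialProj r y, by
    simpa [K] using norm_radialProj_le hr y⟩
  have hρ : Continuous ρ := (continuous_radialProj hr).subtype_mk _
  have hcont : Continuous fun q : ℝ × Y => f q.1 (ρ q.2) :=
    ContinuousEval.continuous_eval.comp
      ((f.continuous.comp continuous_fst).prodMk (hρ.comp continuous_snd))
  refine ⟨BoundedContinuousFunction.ofNormedAddCommGroup _ hcont ‖f‖ fun q =>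
    ((f q.1).norm_coe_le_norm _).trans (f.norm_coe_le_norm _), fun s => ‖G s - f s‖,
    (hGi.sub hfi).norm, hf, fun s y => ?_⟩
  exact (G s - f s).norm_coe_le_norm (ρ y)

variable [BorelSpace Y]

theorem abs_integral_sub_integral_le {lam : Measure ℝ} {M : Measure (ℝ × Y)}
    [IsProbabilityMeasure M] (hM : M.map Prod.fst = lam)
    {g : ℝ × Y → ℝ} (hgm : Measurable g) {C : ℝ}
    (hC : ∀ q, |g q| ≤ C) {r : ℝ} (hr : 0 < r) {ε δ : ℝ}
    {h : BoundedContinuousFunction (ℝ × Y) ℝ} {d : ℝ → ℝ} (hdi : Integrable d lam)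
    (hd : ∫ s, d s ∂lam ≤ ε) (hgh : ∀ s y, |g (s, radialProj r y) - h (s, y)| ≤ d s)
    (hδ : M.real {q | r < ‖q.2‖} ≤ δ) :
    |∫ q, g q ∂M - ∫ q, h q ∂M| ≤ ε + 2 * C * δ := by
  have hC0 : 0 ≤ C := (abs_nonneg _).trans (hC 0)
  have hS : MeasurableSet {q : ℝ × Y | r < ‖q.2‖} :=
    measurableSet_lt measurable_const measurable_snd.norm
  have hg' : Measurable fun q : ℝ × Y => g (q.1, radialProj r q.2) :=
    hgm.comp (measurable_fst.prodMk
      ((continuous_radialProj hr).measurable.comp measurable_snd))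
  have i1 : Integrable g M := Integrable.of_bound hgm.aestronglyMeasurable C
    (ae_of_all _ hC)
  have i2 : Integrable (fun q => h q) M := h.integrable M
  have i3 : Integrable (fun q : ℝ × Y => d q.1) M :=
    (integrable_map_measure (f := Prod.fst) (by rw [hM]; exact hdi.aestronglyMeasurable)
      measurable_fst.aemeasurable).1 (by rw [hM]; exact hdi)
  have i4 : Integrable ({q : ℝ × Y | r < ‖q.2‖}.indicator fun _ => 2 * C) M :=
    (integrable_const _).indicator hS
  rw [← integral_sub i1 i2]
  have hb : ∀ q : ℝ × Y, ‖g q - h q‖ ≤ d q.1 + {q : ℝ × Y | r < ‖q.2‖}.indicator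
      (fun _ => 2 * C) q := by
    intro q
    rw [Real.norm_eq_abs]
    have h1 := hgh q.1 q.2
    by_cases hq : r < ‖q.2‖
    · rw [indicator_of_mem (by exact hq)]
      have h2 := hC q
      have h3 := hC (q.1, radialProj r q.2)
      rw [abs_le] at *
      constructor <;> linarith [h1.1, h1.2]
    · rw [indicator_of_notMem (by exact hq), add_zero]
      rwa [radialProj_of_norm_le hr (not_lt.1 hq)] at h1
  refine (norm_integral_le_of_norm_le (i3.add i4) (ae_of_all _ hb)).trans ?_
  have e1 : ∫ q : ℝ × Y, d q.1 ∂M = ∫ s, d s ∂lam := by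
    rw [← hM, integral_map measurable_fst.aemeasurable (by rw [hM]; exact hdi.aestronglyMeasurable)]
  have e2 : ∫ q, {q : ℝ × Y | r < ‖q.2‖}.indicator (fun _ => 2 * C) q ∂M =
      M.real {q : ℝ × Y | r < ‖q.2‖} * (2 * C) := by
    rw [integral_indicator_const _ hS, smul_eq_mul]
  refine (integral_add i3 i4).le.trans ?_
  rw [e1, e2]
  nlinarith

end Caratheodory

section StableLimit

variable {Y : Type*} [NormedAddCommGroup Y] [NormedSpace ℝ Y] [FiniteDimensional ℝ Y]
  [MeasurableSpace Y] [BorelSpace Y]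

theorem tendsto_integral_of_caratheodory {lam : Measure ℝ} [IsFiniteMeasure lam]
    {M : ℕ → ProbabilityMeasure (ℝ × Y)} {M₀ : ProbabilityMeasure (ℝ × Y)}
    (hlim : Tendsto M atTop (𝓝 M₀)) (hM : ∀ k, (M k : Measure (ℝ × Y)).map Prod.fst = lam)
    (hM₀ : (M₀ : Measure (ℝ × Y)).map Prod.fst = lam)
    (htight : ∀ ε : ℝ, 0 < ε → ∃ r : ℝ, 0 < r ∧
      ∀ k, (M k : Measure (ℝ × Y)).real {q | r < ‖q.2‖} ≤ ε)
    {g : ℝ × Y → ℝ} (hgm : Measurable g) (hgc : ∀ s, Continuous fun y => g (s, y)) {C : ℝ}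
    (hC : ∀ q, |g q| ≤ C) :
    Tendsto (fun k => ∫ q, g q ∂(M k : Measure (ℝ × Y))) atTop
      (𝓝 (∫ q, g q ∂(M₀ : Measure (ℝ × Y)))) := by
  have hC0 : 0 ≤ C := (abs_nonneg _).trans (hC 0)
  rw [Metric.tendsto_atTop]
  intro ε hε
  set η : ℝ := ε / (4 * (1 + 2 * C)) with hη
  have hη0 : 0 < η := by positivity
  obtain ⟨r, hr, hrM⟩ := htight η hη0
  have hrM₀ : (M₀ : Measure (ℝ × Y)).real {q | r < ‖q.2‖} ≤ η := by
    have hop : IsOpen {q : ℝ × Y | r < ‖q.2‖} :=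
      isOpen_lt continuous_const continuous_snd.norm
    have h1 := ProbabilityMeasure.le_liminf_measure_open_of_tendsto hlim hop
    have h2 : atTop.liminf (fun k => (M k : Measure (ℝ × Y)) {q | r < ‖q.2‖}) ≤
        ENNReal.ofReal η := by
      refine liminf_le_of_frequently_le' (Frequently.of_forall fun k => ?_)
      exact (ENNReal.le_ofReal_iff_toReal_le (measure_ne_top _ _) hη0.le).2 (hrM k)
    exact (ENNReal.le_ofReal_iff_toReal_le (measure_ne_top _ _) hη0.le).1 (h1.trans h2)
  obtain ⟨h, d, hdi, hd, hgh⟩ := exists_boundedContinuous_approx (lam := lam) hgm hgc hC hr hη0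
  have hh := (ProbabilityMeasure.tendsto_iff_forall_integral_tendsto.1 hlim) h
  obtain ⟨k₀, hk₀⟩ := Metric.tendsto_atTop.1 hh (ε / 2) (by positivity)
  refine ⟨k₀, fun k hk => ?_⟩
  have h1 := abs_integral_sub_integral_le (hM k) hgm hC hr hdi hd hgh (hrM k)
  have h2 := abs_integral_sub_integral_le hM₀ hgm hC hr hdi hd hgh hrM₀
  have h3 := hk₀ k hk
  rw [Real.dist_eq] at *
  have h4 : η + 2 * C * η = ε / 4 := by
    rw [hη]; field_simp
  rw [h4] at h1 h2
  rw [abs_le] at h1 h2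
  rw [abs_lt] at *
  constructor <;> linarith [h1.1, h1.2, h2.1, h2.2, h3.1, h3.2]

theorem exists_stable_limit {lam : Measure ℝ} [IsFiniteMeasure lam] {b : ℝ}
    (hlam : lam (Icc 0 b)ᶜ = 0)
    {M : ℕ → ProbabilityMeasure (ℝ × Y)} (hM : ∀ k, (M k : Measure (ℝ × Y)).map Prod.fst = lam)
    (htight : ∀ ε : ℝ, 0 < ε → ∃ r : ℝ, 0 < r ∧
      ∀ k, (M k : Measure (ℝ × Y)).real {q | r < ‖q.2‖} ≤ ε) :
    ∃ (φ : ℕ → ℕ) (M₀ : ProbabilityMeasure (ℝ × Y)), StrictMono φ ∧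
      Tendsto (M ∘ φ) atTop (𝓝 M₀) ∧ (M₀ : Measure (ℝ × Y)).map Prod.fst = lam ∧
      ∀ (g : ℝ × Y → ℝ) (C : ℝ), Measurable g → (∀ s, Continuous fun y => g (s, y)) →
        (∀ q, |g q| ≤ C) → Tendsto (fun k => ∫ q, g q ∂(M (φ k) : Measure (ℝ × Y))) atTop
          (𝓝 (∫ q, g q ∂(M₀ : Measure (ℝ × Y)))) := by
  have : ProperSpace Y := FiniteDimensional.proper ℝ Y
  have hT : IsTightMeasureSet
      {((μ : ProbabilityMeasure (ℝ × Y)) : Measure (ℝ × Y)) | μ ∈ range M} := by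
    rw [isTightMeasureSet_iff_exists_isCompact_measure_compl_le]
    intro ε hε
    obtain ⟨ε', hε', hε'ε⟩ : ∃ ε' : ℝ, 0 < ε' ∧ ENNReal.ofReal ε' ≤ ε := by
      obtain ⟨e, he0, he⟩ := ENNReal.lt_iff_exists_nnreal_btwn.1 hε
      exact ⟨e, by exact_mod_cast he0, by simpa using he.le⟩
    obtain ⟨r, hr, hrM⟩ := htight ε' hε'
    refine ⟨Icc 0 b ×ˢ Metric.closedBall 0 r,
      isCompact_Icc.prod (isCompact_closedBall _ _), ?_⟩
    rintro _ ⟨_, ⟨k, rfl⟩, rfl⟩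
    have hsub : (Icc 0 b ×ˢ Metric.closedBall (0 : Y) r)ᶜ ⊆
        Prod.fst ⁻¹' (Icc 0 b)ᶜ ∪ {q : ℝ × Y | r < ‖q.2‖} := by
      rintro q hq
      simp only [mem_compl_iff, mem_prod, Metric.mem_closedBall, dist_zero_right, not_and_or,
        not_le] at hq
      exact hq.imp (fun h => h) (fun h => h)
    refine (measure_mono hsub).trans ((measure_union_le _ _).trans ?_)
    have e0 : (M k : Measure (ℝ × Y)) (Prod.fst ⁻¹' (Icc 0 b)ᶜ) = 0 := by
      rw [← Measure.map_apply measurable_fst measurableSet_Icc.compl, hM k, hlam]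
    rw [e0, zero_add]
    exact ((ENNReal.le_ofReal_iff_toReal_le (measure_ne_top _ _) hε'.le).2 (hrM k)).trans hε'ε
  obtain ⟨M₀, -, φ, hφ, hlim⟩ := (isCompact_closure_of_isTightMeasureSet hT).tendsto_subseq
    (fun k => subset_closure (mem_range_self k))
  have hM₀ : (M₀ : Measure (ℝ × Y)).map Prod.fst = lam := by
    have h1 := ProbabilityMeasure.tendsto_map_of_tendsto_of_continuous _ _ hlim
      (continuous_fst (X := ℝ) (Y := Y))
    have h2 : ∀ k, ((M ∘ φ) k).map (continuous_fst (X := ℝ) (Y := Y)).measurable.aemeasurable =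
        (M 0).map (continuous_fst (X := ℝ) (Y := Y)).measurable.aemeasurable := fun k =>
      Subtype.ext ((hM _).trans (hM 0).symm)
    simp only [h2] at h1
    have h3 := tendsto_nhds_unique h1 tendsto_const_nhds
    exact (congrArg Subtype.val h3).trans (hM 0)
  exact ⟨φ, M₀, hφ, hlim, hM₀, fun g C hgm hgc hC =>
    tendsto_integral_of_caratheodory hlim (fun k => hM _) hM₀
      (fun ε hε => (htight ε hε).imp fun r h => ⟨h.1, fun k => h.2 _⟩) hgm hgc hC⟩

end StableLimit

theorem lipschitzWith_setIntegral_Iio {Y E : Type*} [MeasurableSpace Y] [NormedAddCommGroup E]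
    [NormedSpace ℝ E] {M : Measure (ℝ × Y)} [IsProbabilityMeasure M]
    (hM : M.map Prod.fst = volume.restrict (Ico 0 1)) {g : ℝ × Y → E}
    (hg : AEStronglyMeasurable g M) {C : ℝ} (hC : ∀ q, ‖g q‖ ≤ C) :
    LipschitzWith C.toNNReal fun s => ∫ q in Iio s ×ˢ univ, g q ∂M := by
  have hC0 : 0 ≤ C := by
    obtain ⟨q⟩ := M.nonempty_of_neZero
    exact (norm_nonneg _).trans (hC q)
  have hi : Integrable g M := Integrable.of_bound hg C (ae_of_all _ hC)
  have key : ∀ r s : ℝ, r ≤ s →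
      ‖∫ q in Iio s ×ˢ univ, g q ∂M - ∫ q in Iio r ×ˢ univ, g q ∂M‖ ≤ C * (s - r) := by
    intro r s hrs
    have hun : Iio s ×ˢ (univ : Set Y) = Iio r ×ˢ univ ∪ Ico r s ×ˢ univ := by
      rw [← union_prod, Iio_union_Ico_eq_Iio hrs]
    have hdis : Disjoint (Iio r ×ˢ (univ : Set Y)) (Ico r s ×ˢ univ) := by
      rw [Set.disjoint_left]
      rintro q ⟨h1, -⟩ ⟨h2, -⟩
      exact absurd h2.1 (not_le.2 h1)
    rw [hun, setIntegral_union hdis (measurableSet_Ico.prod MeasurableSet.univ) hi.integrableOn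
      hi.integrableOn, add_sub_cancel_left]
    have h1 : M.real (Ico r s ×ˢ univ) ≤ s - r := by
      have h2 : M (Ico r s ×ˢ univ) ≤ ENNReal.ofReal (s - r) := by
        rw [show Ico r s ×ˢ (univ : Set Y) = Prod.fst ⁻¹' Ico r s by ext; simp,
          ← Measure.map_apply measurable_fst measurableSet_Ico, hM,
          ← Real.volume_Ico]
        exact Measure.restrict_apply_le _ _
      exact ENNReal.toReal_le_of_le_ofReal (by linarith) h2
    refine (norm_setIntegral_le_of_norm_le_const (measure_lt_top _ _)
      (fun q _ => hC q)).trans ?_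
    gcongr
  refine LipschitzWith.of_dist_le_mul fun s r => ?_
  rw [dist_eq_norm, Real.coe_toNNReal _ hC0, Real.dist_eq]
  rcases le_total r s with h | h
  · rw [abs_of_nonneg (by linarith)]
    exact key r s h
  · rw [norm_sub_rev, abs_sub_comm, abs_of_nonneg (by linarith)]
    exact key s r h

theorem tendsto_integral_euclidean_of_real {Y : Type*} [MeasurableSpace Y] [TopologicalSpace Y]
    {M : ℕ → Measure (ℝ × Y)} {M₀ : Measure (ℝ × Y)} [∀ k, IsFiniteMeasure (M k)]
    [IsFiniteMeasure M₀]
    (h : ∀ (g : ℝ × Y → ℝ) (C : ℝ), Measurable g → (∀ s, Continuous fun y => g (s, y)) →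
        (∀ q, |g q| ≤ C) → Tendsto (fun k => ∫ q, g q ∂(M k)) atTop (𝓝 (∫ q, g q ∂M₀)))
    {g : ℝ × Y → EuclideanSpace ℝ (Fin n)} {C : ℝ} (hgm : Measurable g)
    (hgc : ∀ s, Continuous fun y => g (s, y)) (hC : ∀ q, ‖g q‖ ≤ C) :
    Tendsto (fun k => ∫ q, g q ∂(M k)) atTop (𝓝 (∫ q, g q ∂M₀)) := by
  have hi : ∀ (μ : Measure (ℝ × Y)) [IsFiniteMeasure μ] (i : Fin n),
      (∫ q, g q ∂μ) i = ∫ q, g q i ∂μ := fun μ _ i =>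
    ((EuclideanSpace.proj i : EuclideanSpace ℝ (Fin n) →L[ℝ] ℝ).integral_comp_comm
      (Integrable.of_bound hgm.aestronglyMeasurable C (ae_of_all _ hC))).symm
  have hT : Tendsto (fun k => fun i => (∫ q, g q ∂(M k)) i) atTop
      (𝓝 fun i => (∫ q, g q ∂M₀) i) := by
    rw [tendsto_pi_nhds]
    intro i
    simp only [hi]
    exact h _ C ((EuclideanSpace.proj i : EuclideanSpace ℝ (Fin n) →L[ℝ] ℝ).measurable.comp hgm)
      (fun s => (EuclideanSpace.proj i : EuclideanSpace ℝ (Fin n) →L[ℝ] ℝ).continuous.comp (hgc s))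
      (fun q => (PiLp.norm_apply_le (g q) i).trans (hC q))
  exact ((PiLp.continuous_toLp 2 _).tendsto _).comp hT

/-- Passing to the limit in the time-discretised system: a relaxed (measure valued) solution on
the unit time window. -/
theorem TameCoeff.exists_relaxed (h : TameCoeff A a c CA C₀ C₁ R) (z : 𝕌) {G N : ℝ} (hG : 0 ≤ G)
    (hN0 : 0 ≤ N) (hgrow : ∀ s u x, ‖u‖ ≤ N → ⟪u, A s u x⟫ ≤ G * (1 + ‖u‖ ^ 2))
    (hN : (1 + ‖z‖ ^ 2) * Real.exp (2 * G + 1) ≤ 1 + N ^ 2) :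
    ∃ (M : Measure (ℝ × 𝕌 × 𝔼)) (X : ℝ → 𝕌), IsProbabilityMeasure M ∧
      M.map Prod.fst = volume.restrict (Ico 0 1) ∧ Continuous X ∧
      (∀ᵐ q ∂M, q.2.1 = X q.1) ∧ (∀ s ∈ Ico (0 : ℝ) 1, ‖X s‖ ≤ N) ∧
      ∫⁻ q, ENNReal.ofReal (‖q.2.2‖ ^ 3) ∂M < ⊤ ∧
      (∀ p : 𝔼 → ℝ, ContDiff ℝ (⊤ : ℕ∞) p → HasCompactSupport p → ∀ r ∈ Icc (0 : ℝ) 1,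
        ∫ q in Iio r ×ˢ univ, diffGen (c q.1 q.2.1) (a q.1 q.2.1) p q.2.2 ∂M = 0) ∧
      ∀ s, X s = z + ∫ q in Iio s ×ˢ univ, A q.1 q.2.1 q.2.2 ∂M := by
  have hCA : 0 ≤ CA := (norm_nonneg _).trans (h.A_bd 0 0 0)
  obtain ⟨k₀, hk₀⟩ := exists_nat_ge (CA ^ 2)
  have hex := fun k : ℕ => h.exists_euler z hG hN0 hgrow hN (k := k + k₀ + 1) (by omega)
    (by push_cast; have : (0 : ℝ) ≤ k := by positivity
        linarith)
  choose M w hM1 hMfst hMw hwN hmom hst hwX using hex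
  set B : ℝ := (((2 * ‖(traceL : (𝔼 →L[ℝ] 𝔼) →L[ℝ] ℝ)‖ + 4) * C₀) ^ 3 +
        ((2 * ‖(traceL : (𝔼 →L[ℝ] 𝔼) →L[ℝ] ℝ)‖ + 4) * C₀) * R ^ 2 + 4 * R ^ 3 * C₁ + R ^ 3) with hB
  have htight : ∀ ε : ℝ, 0 < ε → ∃ r : ℝ, 0 < r ∧
      ∀ k, (M k).real {q | r < ‖q.2‖} ≤ ε := by
    intro ε hε
    refine ⟨max (N + 1) (|B| / ε + 1), lt_max_of_lt_left (by linarith), fun k => ?_⟩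
    set r := max (N + 1) (|B| / ε + 1) with hr
    have hr1 : 1 ≤ r := le_max_of_le_right (by have : 0 ≤ |B| / ε := by positivity
                                               linarith)
    have hsub : ∀ᵐ q ∂(M k), q ∈ {q : ℝ × 𝕌 × 𝔼 | r < ‖q.2‖} →
        q ∈ {q : ℝ × 𝕌 × 𝔼 | ENNReal.ofReal r ≤ ENNReal.ofReal (‖q.2.2‖ ^ 3)} := by
      have h1 : ∀ᵐ s ∂((M k).map Prod.fst), s ∈ Ico (0 : ℝ) 1 := by
        rw [hMfst k]; exact ae_restrict_mem measurableSet_Ico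
      filter_upwards [hMw k, ae_of_ae_map measurable_fst.aemeasurable h1] with q h2 h3 h4
      have h5 : ‖q.2.1‖ ≤ N := by rw [h2]; exact hwN k _ h3
      have h6 : r < ‖q.2.2‖ := by
        have h7 : r < max ‖q.2.1‖ ‖q.2.2‖ := h4
        rcases lt_max_iff.1 h7 with h8 | h8
        · exact absurd (h8.trans_le h5) (not_lt.2 ((by linarith : N ≤ N + 1).trans
            (le_max_left _ _)))
        · exact h8
      refine ENNReal.ofReal_le_ofReal (h6.le.trans ?_)
      exact le_self_pow₀ (hr1.trans h6.le) (by norm_num)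
    have hmk := mul_meas_ge_le_lintegral (μ := M k)
      (f := fun q : ℝ × 𝕌 × 𝔼 => ENNReal.ofReal (‖q.2.2‖ ^ 3)) (by fun_prop) (ENNReal.ofReal r)
    have h9 : M k {q | r < ‖q.2‖} ≤ ENNReal.ofReal ε := by
      refine (measure_mono_ae hsub).trans ?_
      have h10 := hmk.trans (hmom k)
      have hr0 : ENNReal.ofReal r ≠ 0 := by simp; linarith
      rw [mul_comm, ← ENNReal.le_div_iff_mul_le (Or.inl hr0) (Or.inl ENNReal.ofReal_ne_top),
        ← ENNReal.ofReal_div_of_pos (by linarith)] at h10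
      refine h10.trans (ENNReal.ofReal_le_ofReal ?_)
      rw [div_le_iff₀ (by linarith)]
      have h11 : |B| / ε + 1 ≤ r := le_max_right _ _
      have h12 : |B| = ε * (|B| / ε) := by field_simp
      nlinarith [le_abs_self B]
    exact ENNReal.toReal_le_of_le_ofReal hε.le h9
  obtain ⟨φ, M₀, hφ, hlim, hM₀, hcv⟩ := exists_stable_limit (Y := 𝕌 × 𝔼)
    (lam := volume.restrict (Ico (0 : ℝ) 1)) (b := 1)
    (by
      rw [Measure.restrict_apply measurableSet_Icc.compl]
      have : (Icc (0 : ℝ) 1)ᶜ ∩ Ico 0 1 = ∅ := by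
        ext s; simp only [mem_inter_iff, mem_compl_iff, mem_empty_iff_false, iff_false]
        exact fun hs => hs.1 (Ico_subset_Icc_self hs.2)
      rw [this, measure_empty])
    (M := fun k => ⟨M k, hM1 k⟩) hMfst htight
  simp only [ProbabilityMeasure.coe_mk] at hcv
  have hcvE := fun (g : ℝ × 𝕌 × 𝔼 → 𝕌) (C : ℝ) =>
    tendsto_integral_euclidean_of_real (M := fun k => M (φ k)) (g := g) (C := C) hcv
  have hind : ∀ {F : Type} [NormedAddCommGroup F] (g : ℝ × 𝕌 × 𝔼 → F) (s : ℝ) (C : ℝ),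
      (∀ s, Continuous fun y => g (s, y)) → (∀ q, ‖g q‖ ≤ C) →
      (∀ s', Continuous fun y => (Iio s ×ˢ univ).indicator g (s', y)) ∧
      ∀ q, ‖(Iio s ×ˢ univ).indicator g q‖ ≤ C := by
    intro F _ g s C hg hC
    refine ⟨fun s' => ?_, fun q => (norm_indicator_le_norm_self _ _).trans (hC q)⟩
    by_cases hs : s' < s
    · have : (fun y => (Iio s ×ˢ univ).indicator g (s', y)) = fun y => g (s', y) := by
        ext y; exact indicator_of_mem (by simp [hs]) _
      rw [this]; exact hg s'
    · have : (fun y => (Iio s ×ˢ univ).indicator g (s', y)) = fun y => 0 := by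
        ext y; exact indicator_of_notMem (by simpa using hs) _
      rw [this]; exact continuous_const
  have hmeasS : ∀ s : ℝ, MeasurableSet (Iio s ×ˢ (univ : Set (𝕌 × 𝔼))) := fun s =>
    measurableSet_Iio.prod MeasurableSet.univ
  have hzero : ∀ C : ℝ, Tendsto (fun k : ℕ => C / ((φ k + k₀ + 1 : ℕ) : ℝ)) atTop (𝓝 0) := by
    intro C
    refine Tendsto.div_atTop tendsto_const_nhds (tendsto_natCast_atTop_atTop.comp ?_)
    exact tendsto_atTop_mono (fun k => by omega) hφ.tendsto_atTop
  set X : ℝ → 𝕌 := fun s => z + ∫ q in Iio s ×ˢ univ, A q.1 q.2.1 q.2.2 ∂(M₀ : Measure (ℝ × 𝕌 × 𝔼)) with hX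
  set Xk : ℕ → ℝ → 𝕌 := fun k s =>
    z + ∫ q in Iio s ×ˢ univ, A q.1 q.2.1 q.2.2 ∂(M (φ k)) with hXk
  have hXcont : Continuous X := continuous_const.add
    (lipschitzWith_setIntegral_Iio hM₀ h.A_meas.aestronglyMeasurable
      fun q => h.A_bd _ _ _).continuous
  have hXkcont : ∀ k, Continuous (Xk k) := fun k => continuous_const.add
    (lipschitzWith_setIntegral_Iio (hMfst _) h.A_meas.aestronglyMeasurable
      fun q => h.A_bd _ _ _).continuous
  have hXlim : ∀ s, Tendsto (fun k => Xk k s) atTop (𝓝 (X s)) := by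
    intro s
    refine tendsto_const_nhds.add ?_
    have h1 := hind (fun q : ℝ × 𝕌 × 𝔼 => A q.1 q.2.1 q.2.2) s CA h.A_cont
      (fun q => h.A_bd _ _ _)
    have h2 := hcvE _ CA (h.A_meas.indicator (hmeasS s)) h1.1 h1.2
    simpa only [integral_indicator (hmeasS s)] using h2
  have hwX' : ∀ k, ∀ s ∈ Ico (0 : ℝ) 1, ‖w (φ k) s - Xk k s‖ ≤ CA / ((φ k + k₀ + 1 : ℕ) : ℝ) :=
    fun k => hwX (φ k)
  have hwlim : ∀ s ∈ Ico (0 : ℝ) 1, Tendsto (fun k => w (φ k) s) atTop (𝓝 (X s)) := by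
    intro s hs
    have h1 := squeeze_zero_norm (fun k => hwX' k s hs) (hzero CA)
    simpa using h1.add (hXlim s)
  refine ⟨M₀, X, inferInstance, hM₀, hXcont, ?_, fun s hs => ?_, ?_, ?_, fun s => rfl⟩
  · set f : ℝ × 𝕌 × 𝔼 → ℝ := fun q => min 1 ‖q.2.1 - X q.1‖ with hf
    have hfc : Continuous f := by fun_prop
    have hf0 : ∀ q, 0 ≤ f q := fun q => le_min zero_le_one (norm_nonneg _)
    have hf1 : ∀ q, |f q| ≤ 1 := fun q => by
      rw [abs_of_nonneg (hf0 q)]; exact min_le_left _ _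
    have h1 := hcv f 1 hfc.measurable (fun s => hfc.comp (by fun_prop)) hf1
    have hfi : ∀ (μ : Measure (ℝ × 𝕌 × 𝔼)) [IsFiniteMeasure μ], Integrable f μ := fun μ _ =>
      Integrable.of_bound hfc.aestronglyMeasurable 1 (ae_of_all _ hf1)
    have hec : ∀ k, Continuous fun s => min 1 ‖Xk k s - X s‖ := fun k =>
      continuous_const.min ((hXkcont k).sub hXcont).norm
    have he1 : ∀ k s, ‖min 1 ‖Xk k s - X s‖‖ ≤ 1 := fun k s => by
      rw [Real.norm_of_nonneg (le_min zero_le_one (norm_nonneg _))]; exact min_le_left _ _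
    have h2 : ∀ k, ∫ q, f q ∂(M (φ k)) ≤ CA / ((φ k + k₀ + 1 : ℕ) : ℝ) +
        ∫ s in Ico (0 : ℝ) 1, min 1 ‖Xk k s - X s‖ := by
      intro k
      have e1 : ∫ s in Ico (0 : ℝ) 1, min 1 ‖Xk k s - X s‖ =
          ∫ q, min 1 ‖Xk k q.1 - X q.1‖ ∂(M (φ k)) := by
        rw [← hMfst (φ k), integral_map measurable_fst.aemeasurable
          (hec k).aestronglyMeasurable]
      have i1 : Integrable (fun q : ℝ × 𝕌 × 𝔼 => min 1 ‖Xk k q.1 - X q.1‖) (M (φ k)) :=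
        Integrable.of_bound ((hec k).comp continuous_fst).aestronglyMeasurable 1
          (ae_of_all _ fun q => he1 k q.1)
      have e2 : CA / ((φ k + k₀ + 1 : ℕ) : ℝ) = ∫ q, CA / ((φ k + k₀ + 1 : ℕ) : ℝ) ∂(M (φ k)) := by
        simp
      rw [e1, e2, ← integral_add (integrable_const _) i1]
      refine integral_mono_ae (hfi _) ((integrable_const _).add i1) ?_
      have h3 : ∀ᵐ s ∂((M (φ k)).map Prod.fst), s ∈ Ico (0 : ℝ) 1 := by
        rw [hMfst]; exact ae_restrict_mem measurableSet_Ico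
      filter_upwards [hMw (φ k), ae_of_ae_map measurable_fst.aemeasurable h3] with q h4 h5
      have h6 := hwX' k q.1 h5
      have h7 : ‖q.2.1 - X q.1‖ ≤ CA / ((φ k + k₀ + 1 : ℕ) : ℝ) + ‖Xk k q.1 - X q.1‖ := by
        rw [h4]
        exact (norm_sub_le_norm_sub_add_norm_sub _ (Xk k q.1) _).trans (by linarith)
      have h8 : 0 ≤ CA / ((φ k + k₀ + 1 : ℕ) : ℝ) := by positivity
      change min 1 ‖q.2.1 - X q.1‖ ≤ CA / ((φ k + k₀ + 1 : ℕ) : ℝ) + min 1 ‖Xk k q.1 - X q.1‖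
      rcases le_total 1 ‖Xk k q.1 - X q.1‖ with h9 | h9
      · rw [min_eq_left h9]; exact (min_le_left _ _).trans (by linarith)
      · rw [min_eq_right h9]; exact (min_le_right _ _).trans h7
    have h3 : Tendsto (fun k => ∫ s in Ico (0 : ℝ) 1, min 1 ‖Xk k s - X s‖) atTop (𝓝 0) := by
      have := tendsto_integral_of_dominated_convergence
        (μ := (volume : Measure ℝ).restrict (Ico 0 1))
        (F := fun k s => min 1 ‖Xk k s - X s‖) (f := fun _ => 0) (fun _ => 1)
        (fun k => (hec k).aestronglyMeasurable) (integrable_const _)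
        (fun k => ae_of_all _ (he1 k)) (ae_of_all _ fun s => by
          have h4 : Tendsto (fun k => ‖Xk k s - X s‖) atTop (𝓝 0) := by
            have := ((hXlim s).sub_const (X s)).norm
            simpa using this
          have h5 := (tendsto_const_nhds (x := (1 : ℝ))).min h4
          simpa using h5)
      simpa using this
    have h4 : ∫ q, f q ∂(M₀ : Measure (ℝ × 𝕌 × 𝔼)) ≤ 0 := by
      refine le_of_tendsto_of_tendsto' h1 ?_ h2
      simpa using (hzero CA).add h3
    have h5 := (integral_eq_zero_iff_of_nonneg hf0 (hfi _)).1
      (le_antisymm h4 (integral_nonneg hf0))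
    filter_upwards [h5] with q hq
    have h6 : min 1 ‖q.2.1 - X q.1‖ = 0 := hq
    rcases min_choice 1 ‖q.2.1 - X q.1‖ with h7 | h7
    · rw [h7] at h6; exact absurd h6 one_ne_zero
    · rw [h7] at h6; exact sub_eq_zero.1 (norm_eq_zero.1 h6)
  · exact le_of_tendsto ((hwlim s hs).norm) (Eventually.of_forall fun k => hwN _ s hs)
  · have h1 := lintegral_le_liminf_lintegral_of_forall_isOpen_measure_le_liminf_measure
      (μ := (M₀ : Measure (ℝ × 𝕌 × 𝔼))) (μs := fun k => M (φ k))
      (f := fun q => ‖q.2.2‖ ^ 3) (by fun_prop) (fun q => by positivity)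
      (fun U hU => ProbabilityMeasure.le_liminf_measure_open_of_tendsto hlim hU)
    refine (h1.trans (liminf_le_of_frequently_le' (Frequently.of_forall fun k =>
      hmom (φ k)))).trans_lt ENNReal.ofReal_lt_top
  · intro p hp hpc r hr
    obtain ⟨C, hC0, hC⟩ := h.exists_diffGen_bound hp hpc
    have h1 := hind (fun q : ℝ × 𝕌 × 𝔼 => diffGen (c q.1 q.2.1) (a q.1 q.2.1) p q.2.2) r C
      (fun s => continuous_diffGen (h.c_cont s) (h.a_cont s) continuous_snd hp)
      (fun q => hC _ _ _)
    have h2 := hcv _ C ((h.measurable_diffGen hp).indicator (hmeasS r)) h1.1 h1.2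
    simp only [integral_indicator (hmeasS r)] at h2
    have h3 := squeeze_zero_norm (fun k => (Real.norm_eq_abs _).trans_le
      (hst (φ k) p hp hpc C hC r hr)) (hzero C)
    exact tendsto_nhds_unique h2 h3

/-- A countable family of test functions which is dense with respect to uniform convergence of
the first two derivatives, with control of supports. -/
theorem exists_countable_testFun : ∃ D : ℕ → ℕ → 𝔼 → ℝ,
    (∀ m j, ContDiff ℝ (⊤ : ℕ∞) (D m j) ∧ HasCompactSupport (D m j) ∧
      tsupport (D m j) ⊆ Metric.closedBall 0 m) ∧
    ∀ p : 𝔼 → ℝ, ContDiff ℝ (⊤ : ℕ∞) p → HasCompactSupport p → ∃ m : ℕ,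
      tsupport p ⊆ Metric.closedBall 0 m ∧ ∀ ε : ℝ, 0 < ε → ∃ j, ∀ x ∈ Metric.closedBall (0 : 𝔼) m,
        ‖gradient p x - gradient (D m j) x‖ ≤ ε ∧
        ‖fderiv ℝ (fun y => gradient p y) x - fderiv ℝ (fun y => gradient (D m j) y) x‖ ≤ ε := by
  have hK : ∀ m : ℕ, CompactSpace (Metric.closedBall (0 : 𝔼) (m : ℝ)) := fun m =>
    isCompact_iff_compactSpace.1 (isCompact_closedBall _ _)
  let S : ℕ → Set (𝔼 → ℝ) := fun m => {p | ContDiff ℝ (⊤ : ℕ∞) p ∧ HasCompactSupport p ∧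
      tsupport p ⊆ Metric.closedBall 0 m}
  let Φ : ∀ m : ℕ, S m → C(Metric.closedBall (0 : 𝔼) (m : ℝ), 𝔼 × (𝔼 →L[ℝ] 𝔼)) := fun m p =>
    ⟨fun x => (gradient p.1 x, fderiv ℝ (fun y => gradient p.1 y) x),
      ((contDiff_gradient p.2.1).continuous.comp continuous_subtype_val).prodMk
        ((continuous_hessian p.2.1).comp continuous_subtype_val)⟩
  have hS0 : ∀ m, (fun _ => (0 : ℝ)) ∈ S m := fun m =>
    ⟨contDiff_const, HasCompactSupport.zero, by
      have : tsupport (fun _ : 𝔼 => (0 : ℝ)) = ∅ := tsupport_eq_empty_iff.2 rfl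
      rw [this]; exact empty_subset _⟩
  have hne : ∀ m, Nonempty (range (Φ m)) := fun m => ⟨⟨_, ⟨_, hS0 m⟩, rfl⟩⟩
  have hdense : ∀ m, ∃ d : ℕ → S m, ∀ p : S m, ∀ ε : ℝ, 0 < ε → ∃ j, dist (Φ m p) (Φ m (d j)) < ε := by
    intro m
    have := hne m
    have hd := TopologicalSpace.denseRange_denseSeq (range (Φ m))
    have hpre : ∀ j, ∃ p, Φ m p = TopologicalSpace.denseSeq (range (Φ m)) j := fun j =>
      (TopologicalSpace.denseSeq (range (Φ m)) j).2
    choose d hd' using hpre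
    refine ⟨d, fun p ε hε => ?_⟩
    obtain ⟨j, hj⟩ := hd.exists_mem_open
      (s := Subtype.val ⁻¹' Metric.ball (Φ m p) ε) (Metric.isOpen_ball.preimage
        continuous_subtype_val) ⟨⟨Φ m p, p, rfl⟩, Metric.mem_ball_self hε⟩
    refine ⟨j, ?_⟩
    rw [hd' j, dist_comm]
    exact hj
  choose d hd using hdense
  refine ⟨fun m j => (d m j).1, fun m j => (d m j).2, fun p hp hpc => ?_⟩
  obtain ⟨r, hr⟩ := hpc.isCompact.isBounded.subset_closedBall (0 : 𝔼)
  obtain ⟨m, hm⟩ := exists_nat_ge r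
  have hsup : tsupport p ⊆ Metric.closedBall 0 m :=
    Subset.trans hr (Metric.closedBall_subset_closedBall hm)
  refine ⟨m, hsup, fun ε hε => ?_⟩
  obtain ⟨j, hj⟩ := hd m ⟨p, hp, hpc, hsup⟩ ε hε
  refine ⟨j, fun x hx => ?_⟩
  have h1 := (ContinuousMap.dist_apply_le_dist (f := Φ m ⟨p, hp, hpc, hsup⟩) (g := Φ m (d m j))
    ⟨x, hx⟩).trans hj.le
  rw [Prod.dist_eq, dist_eq_norm, dist_eq_norm] at h1
  exact max_le_iff.1 h1

theorem diffGen_sub (c : 𝔼 → (𝔼 →L[ℝ] 𝔼)) (a : 𝔼 → 𝔼) (p q : 𝔼 → ℝ) (x : 𝔼) :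
    diffGen c a p x - diffGen c a q x = (1 / 2) * traceL ((c x).comp
      (fderiv ℝ (fun y => gradient p y) x - fderiv ℝ (fun y => gradient q y) x)) +
      ⟪a x, gradient p x - gradient q x⟫ := by
  rw [diffGen_eq_traceL, diffGen_eq_traceL, ContinuousLinearMap.comp_sub, map_sub, inner_sub_right]
  ring

theorem stationary_of_countable {D : ℕ → ℕ → 𝔼 → ℝ}
    (hD : ∀ m j, ContDiff ℝ (⊤ : ℕ∞) (D m j) ∧ HasCompactSupport (D m j) ∧
      tsupport (D m j) ⊆ Metric.closedBall 0 m)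
    {μ : Measure 𝔼} [IsProbabilityMeasure μ] {c : 𝔼 → (𝔼 →L[ℝ] 𝔼)} {a : 𝔼 → 𝔼} {C₀ : ℝ}
    (hcc : Continuous c) (hac : Continuous a)
    (hc : ∀ x, ‖c x‖ ≤ C₀) (ha : ∀ r : ℝ, ∃ C, ∀ x, ‖x‖ ≤ r → ‖a x‖ ≤ C)
    (hst : ∀ m j, ∫ x, diffGen c a (D m j) x ∂μ = 0) {p : 𝔼 → ℝ} (hp : ContDiff ℝ (⊤ : ℕ∞) p)
    (hpc : HasCompactSupport p) {m : ℕ} (hpm : tsupport p ⊆ Metric.closedBall 0 m)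
    (happ : ∀ ε : ℝ, 0 < ε → ∃ j, ∀ x ∈ Metric.closedBall (0 : 𝔼) m,
        ‖gradient p x - gradient (D m j) x‖ ≤ ε ∧
        ‖fderiv ℝ (fun y => gradient p y) x - fderiv ℝ (fun y => gradient (D m j) y) x‖ ≤ ε) :
    ∫ x, diffGen c a p x ∂μ = 0 := by
  obtain ⟨C₁, hC₁⟩ := ha m
  have hC₁0 : 0 ≤ C₁ := (norm_nonneg _).trans (hC₁ 0 (by simp))
  have hC₀0 : 0 ≤ C₀ := (norm_nonneg _).trans (hc 0)
  set κ := ‖(traceL : (𝔼 →L[ℝ] 𝔼) →L[ℝ] ℝ)‖ * C₀ + C₁ + 1 with hκ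
  have hκ0 : 0 < κ := by positivity
  have hcont : ∀ {q : 𝔼 → ℝ}, ContDiff ℝ (⊤ : ℕ∞) q → Continuous fun x => diffGen c a q x :=
    fun {q} hq => continuous_diffGen (c := fun _ => c) (a := fun _ => a) (x := fun x => x)
      hcc hac continuous_id hq
  have hsupp : ∀ {q : 𝔼 → ℝ}, HasCompactSupport q → HasCompactSupport fun x => diffGen c a q x :=
    fun {q} hq => HasCompactSupport.intro hq fun x hx => diffGen_of_notMem_tsupport c a hx
  have hint : ∀ {q : 𝔼 → ℝ}, ContDiff ℝ (⊤ : ℕ∞) q → HasCompactSupport q →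
      Integrable (fun x => diffGen c a q x) μ := fun hq hqc =>
    (hcont hq).integrable_of_hasCompactSupport (hsupp hqc)
  have key : ∀ ε : ℝ, 0 < ε → |∫ x, diffGen c a p x ∂μ| ≤ κ * ε := by
    intro ε hε
    obtain ⟨j, hj⟩ := happ ε hε
    obtain ⟨h1, h2, h3⟩ := hD m j
    have e : ∫ x, diffGen c a p x ∂μ = ∫ x, (diffGen c a p x - diffGen c a (D m j) x) ∂μ := by
      rw [integral_sub (hint hp hpc) (hint h1 h2), hst, sub_zero]
    rw [e]
    have hb : ∀ x, ‖diffGen c a p x - diffGen c a (D m j) x‖ ≤ κ * ε := by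
      intro x
      by_cases hx : x ∈ Metric.closedBall (0 : 𝔼) m
      · obtain ⟨h4, h5⟩ := hj x hx
        have h6 : ‖a x‖ ≤ C₁ := hC₁ x (by simpa using hx)
        rw [diffGen_sub c a p (D m j)]
        refine (norm_add_le _ _).trans ?_
        have h7 : ‖(1 / 2 : ℝ) * traceL ((c x).comp (fderiv ℝ (fun y => gradient p y) x -
            fderiv ℝ (fun y => gradient (D m j) y) x))‖ ≤
            ‖(traceL : (𝔼 →L[ℝ] 𝔼) →L[ℝ] ℝ)‖ * (C₀ * ε) := by
          rw [norm_mul]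
          have h8 := (traceL : (𝔼 →L[ℝ] 𝔼) →L[ℝ] ℝ).le_opNorm ((c x).comp
            (fderiv ℝ (fun y => gradient p y) x - fderiv ℝ (fun y => gradient (D m j) y) x))
          have h9 := ((c x).opNorm_comp_le (fderiv ℝ (fun y => gradient p y) x -
            fderiv ℝ (fun y => gradient (D m j) y) x)).trans
            (mul_le_mul (hc x) h5 (norm_nonneg _) hC₀0)
          have h10 := h8.trans (mul_le_mul_of_nonneg_left h9 (norm_nonneg _))
          have h11 : ‖(1 / 2 : ℝ)‖ ≤ 1 := by norm_num
          exact (mul_le_of_le_one_left (norm_nonneg _) h11).trans h10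
        have h12 := (norm_inner_le_norm (𝕜 := ℝ) (a x) (gradient p x - gradient (D m j) x)).trans
          (mul_le_mul h6 h4 (norm_nonneg _) hC₁0)
        rw [hκ]
        nlinarith
      · rw [diffGen_of_notMem_tsupport c a (fun h => hx (hpm h)),
          diffGen_of_notMem_tsupport c a (fun h => hx (h3 h)), sub_zero, norm_zero]
        positivity
    simpa using norm_integral_le_of_norm_le_const (μ := μ) (ae_of_all _ hb)
  by_contra hne
  have h1 := key (|∫ x, diffGen c a p x ∂μ| / (2 * κ)) (div_pos (abs_pos.2 hne) (by positivity))
  have h2 : κ * (|∫ x, diffGen c a p x ∂μ| / (2 * κ)) = |∫ x, diffGen c a p x ∂μ| / 2 := by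
    field_simp
  rw [h2] at h1
  linarith [abs_pos.2 hne]

open ProbabilityTheory in
theorem exists_measurable_kernel_density (κ : Kernel ℝ (EuclideanSpace ℝ (Fin l)))
    [IsMarkovKernel κ] : ∃ m : ℝ → 𝔼 → ℝ, Measurable (fun q : ℝ × 𝔼 => m q.1 q.2) ∧
      (∀ s x, 0 ≤ m s x) ∧ ∀ s, κ s ≪ volume →
        Integrable (m s) ∧ κ s = volume.withDensity fun x => ENNReal.ofReal (m s x) := by
  let η : Kernel ℝ 𝔼 := Kernel.const ℝ (volume : Measure 𝔼).toFinite
  let ρ : 𝔼 → ENNReal := (volume : Measure 𝔼).toFinite.rnDeriv volume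
  have hρ : Measurable ρ := Measure.measurable_rnDeriv _ _
  have hf : Measurable fun q : ℝ × 𝔼 => ρ q.2 * Kernel.rnDeriv κ η q.1 q.2 :=
    (hρ.comp measurable_snd).mul (Kernel.measurable_rnDeriv κ η)
  refine ⟨fun s x => (ρ x * Kernel.rnDeriv κ η s x).toReal, hf.ennreal_toReal,
    fun s x => ENNReal.toReal_nonneg, fun s hs => ?_⟩
  have hfs : Measurable fun x => ρ x * Kernel.rnDeriv κ η s x :=
    hf.comp measurable_prodMk_left
  have hac : (volume : Measure 𝔼).toFinite ≪ volume := toFinite_absolutelyContinuous _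
  have hs' : κ s ≪ (volume : Measure 𝔼).toFinite :=
    hs.trans (absolutelyContinuous_toFinite _)
  have e1 : volume.withDensity ρ = (volume : Measure 𝔼).toFinite :=
    Measure.withDensity_rnDeriv_eq _ _ hac
  have e2 : κ s = volume.withDensity fun x => ρ x * Kernel.rnDeriv κ η s x := by
    have h1 : volume.withDensity (fun x => ρ x * Kernel.rnDeriv κ η s x) =
        (volume.withDensity ρ).withDensity (Kernel.rnDeriv κ η s) :=
      withDensity_mul _ hρ (Kernel.measurable_rnDeriv_right κ η s)
    rw [h1, e1]
    have h2 : Kernel.rnDeriv κ η s =ᵐ[(volume : Measure 𝔼).toFinite]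
        (κ s).rnDeriv (volume : Measure 𝔼).toFinite :=
      Kernel.rnDeriv_eq_rnDeriv_measure (κ := κ) (η := η) (a := s)
    rw [withDensity_congr_ae h2, Measure.withDensity_rnDeriv_eq _ _ hs']
  have hone : ∫⁻ x, ρ x * Kernel.rnDeriv κ η s x = 1 := by
    have := congrArg (fun μ : Measure 𝔼 => μ univ) e2
    simpa [withDensity_apply] using this.symm
  have hfin : ∀ᵐ x ∂(volume : Measure 𝔼), ρ x * Kernel.rnDeriv κ η s x < ⊤ :=
    ae_lt_top hfs (by rw [hone]; exact ENNReal.one_ne_top)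
  refine ⟨integrable_toReal_of_lintegral_ne_top hfs.aemeasurable
    (by rw [hone]; exact ENNReal.one_ne_top), ?_⟩
  rw [e2]
  refine withDensity_congr_ae ?_
  filter_upwards [hfin] with x hx
  exact (ENNReal.ofReal_toReal hx.ne).symm

/-- A probability density which is stationary for the generator with coefficients `c`, `a`,
together with its Sobolev regularity. -/
structure IsStationaryDensity (c : EuclideanSpace ℝ (Fin l) →
      (EuclideanSpace ℝ (Fin l) →L[ℝ] EuclideanSpace ℝ (Fin l)))
    (a : EuclideanSpace ℝ (Fin l) → EuclideanSpace ℝ (Fin l))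
    (m : EuclideanSpace ℝ (Fin l) → ℝ) : Prop where
  nonneg : ∀ x, 0 ≤ m x
  integrable : Integrable m
  integral_eq_one : ∫ x, m x = 1
  weakGrad : ∃ g, HasWeakGrad m g
  sqrt_weakGrad : ∃ h, HasWeakGrad (fun x => Real.sqrt (m x)) h ∧
    Integrable (fun x => (Real.sqrt (m x)) ^ 2) ∧ Integrable (fun x => ‖h x‖ ^ 2)
  stationary : ∀ p : 𝔼 → ℝ, ContDiff ℝ (⊤ : ℕ∞) p → HasCompactSupport p →
    ∫ x, diffGen c a p x * m x = 0

theorem ae_eq_zero_of_intervalIntegral_eq_zero {f : ℝ → ℝ} (hf : LocallyIntegrable f)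
    (h : ∀ r ∈ Icc (0 : ℝ) 1, ∫ s in (0 : ℝ)..r, f s = 0) :
    ∀ᵐ s ∂volume.restrict (Ico (0 : ℝ) 1), f s = 0 := by
  have hne : ∀ᵐ s : ℝ, s ≠ 0 := by
    simp [ae_iff]
  rw [ae_restrict_iff' measurableSet_Ico]
  filter_upwards [LocallyIntegrable.ae_hasDerivAt_integral hf, hne] with s hs h0 hs1
  have hloc : (fun r => ∫ t in (0 : ℝ)..r, f t) =ᶠ[𝓝 s] fun _ => 0 := by
    filter_upwards [Ioo_mem_nhds (lt_of_le_of_ne hs1.1 h0.symm) hs1.2] with r hr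
    exact h r (Ioo_subset_Icc_self hr)
  exact (hs 0).unique ((hasDerivAt_const s (0 : ℝ)).congr_of_eventuallyEq hloc)

open ProbabilityTheory in
theorem setIntegral_eq_intervalIntegral_kernel {E : Type*} [NormedAddCommGroup E]
    [NormedSpace ℝ E] {M : Measure (ℝ × EuclideanSpace ℝ (Fin n) × EuclideanSpace ℝ (Fin l))}
    {κ : Kernel ℝ (EuclideanSpace ℝ (Fin l))} [IsMarkovKernel κ]
    (hκ : M.map (fun q => (q.1, q.2.2)) = (volume.restrict (Ico (0 : ℝ) 1)) ⊗ₘ κ)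
    {g : ℝ × 𝔼 → E} (hg : StronglyMeasurable g) {C : ℝ} (hC : ∀ q, ‖g q‖ ≤ C)
    {r : ℝ} (hr : r ∈ Icc (0 : ℝ) 1) :
    ∫ q in Iio r ×ˢ univ, g (q.1, q.2.2) ∂M = ∫ s in (0 : ℝ)..r, ∫ x, g (s, x) ∂κ s := by
  have hm : Measurable fun q : ℝ × 𝕌 × 𝔼 => (q.1, q.2.2) := by fun_prop
  have h1 := setIntegral_map (μ := M) (g := fun q : ℝ × 𝕌 × 𝔼 => (q.1, q.2.2)) (f := g)
    (s := Iio r ×ˢ univ) (measurableSet_Iio.prod MeasurableSet.univ) hg.aestronglyMeasurable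
    hm.aemeasurable
  have h2 : (fun q : ℝ × 𝕌 × 𝔼 => (q.1, q.2.2)) ⁻¹' (Iio r ×ˢ univ) = Iio r ×ˢ univ := by
    ext q; simp
  rw [h2, hκ] at h1
  rw [← h1, Measure.setIntegral_compProd measurableSet_Iio MeasurableSet.univ
    (Integrable.integrableOn (Integrable.of_bound hg.aestronglyMeasurable C (ae_of_all _ hC))),
    Measure.restrict_restrict measurableSet_Iio, intervalIntegral.integral_of_le hr.1]
  have h3 : Iio r ∩ Ico (0 : ℝ) 1 = Ico 0 r := by
    ext s
    simp only [mem_inter_iff, mem_Iio, mem_Ico]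
    exact ⟨fun h => ⟨h.2.1, h.1⟩, fun h => ⟨h.2, h.1, h.2.trans_le hr.2⟩⟩
  rw [h3, integral_Ico_eq_integral_Ioc]
  simp only [Measure.restrict_univ]

theorem locallyIntegrable_of_ae_bound {E : Type*} [NormedAddCommGroup E] {f : ℝ → E}
    (hf : AEStronglyMeasurable f volume) {C : ℝ} (hC : ∀ᵐ s, ‖f s‖ ≤ C) :
    LocallyIntegrable f := by
  refine (locallyIntegrable_const C).mono hf ?_
  filter_upwards [hC] with s hs
  exact hs.trans (le_abs_self C)

/-- Regularity of a stationary probability measure with a finite third moment. -/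
theorem isStationaryDensity_of_measure {μ : Measure 𝔼} [IsProbabilityMeasure μ]
    {c : 𝔼 → (𝔼 →L[ℝ] 𝔼)} {a : 𝔼 → 𝔼} {Cc K θ L : ℝ} (hCc : ∀ x, ‖c x‖ ≤ Cc)
    (hK : ∀ x y, ‖c y - c x‖ ≤ K * ‖y - x‖) (hc : Continuous c) (ha : Continuous a)
    (hθ : 0 < θ) (hell : ∀ x v, θ * ‖v‖ ^ 2 ≤ ⟪c x v, v⟫)
    (hL : ∀ x, ‖a x‖ ≤ L * (1 + ‖x‖))
    (hmom : ∫⁻ x, ENNReal.ofReal (‖x‖ ^ 3) ∂μ < ⊤)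
    (hst : ∀ p : 𝔼 → ℝ, ContDiff ℝ (⊤ : ℕ∞) p → HasCompactSupport p →
      ∫ x, diffGen c a p x ∂μ = 0) {m : 𝔼 → ℝ} (hm0 : ∀ x, 0 ≤ m x) (hmm : Measurable m)
    (hm : μ ≪ volume → Integrable m ∧ μ = volume.withDensity fun x => ENNReal.ofReal (m x)) :
    IsStationaryDensity c a m ∧ μ = volume.withDensity fun x => ENNReal.ofReal (m x) := by
  have hi3 : Integrable (fun x : 𝔼 => ‖x‖ ^ 3) μ := by
    refine ⟨(continuous_norm.pow 3).aestronglyMeasurable, ?_⟩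
    rw [hasFiniteIntegral_iff_ofReal (ae_of_all _ fun x => by positivity)]
    exact hmom
  have hL0 : 0 ≤ L := by
    have := (norm_nonneg _).trans (hL 0)
    simpa using this
  have ha2 : Integrable (fun x => ‖a x‖ ^ 2) μ := by
    refine (((integrable_const (1 : ℝ)).add hi3).const_mul (4 * L ^ 2)).mono'
      (ha.norm.pow 2).aestronglyMeasurable (ae_of_all _ fun x => ?_)
    rw [Real.norm_of_nonneg (by positivity)]
    have h1 := pow_le_pow_left₀ (norm_nonneg _) (hL x) 2
    have h2 : (1 + ‖x‖) ^ 2 ≤ 4 * (1 + ‖x‖ ^ 3) := by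
      have h0 := norm_nonneg x
      nlinarith [mul_nonneg h0 (sq_nonneg (‖x‖ - 1)), sq_nonneg (‖x‖ - 1)]
    calc ‖a x‖ ^ 2 ≤ (L * (1 + ‖x‖)) ^ 2 := h1
      _ = L ^ 2 * (1 + ‖x‖) ^ 2 := by ring
      _ ≤ L ^ 2 * (4 * (1 + ‖x‖ ^ 3)) := mul_le_mul_of_nonneg_left h2 (sq_nonneg L)
      _ = 4 * L ^ 2 * (1 + ‖x‖ ^ 3) := by ring
  have ha1 : Integrable a μ := by
    refine ((integrable_const (1 : ℝ)).add ha2).mono' ha.aestronglyMeasurable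
      (ae_of_all _ fun x => ?_)
    simp only [Pi.add_apply]
    nlinarith [sq_nonneg (‖a x‖ - 1), norm_nonneg (a x)]
  obtain ⟨C, hC, hF⟩ := exists_fisherApprox hCc hK hc hθ hell ha1 ha2 hst
  obtain ⟨hac, hreg⟩ := hF.density_regularity hC
  obtain ⟨hmi, hμ⟩ := hm hac
  obtain ⟨hw, g, hg, hg2⟩ := hreg m hm0 hmi hμ
  have hfin : ∀ᵐ x ∂(volume : Measure 𝔼), ENNReal.ofReal (m x) < ⊤ :=
    ae_of_all _ fun x => ENNReal.ofReal_lt_top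
  refine ⟨⟨hm0, hmi, ?_, hw, ⟨g, hg, ?_, hg2⟩, fun p hp hpc => ?_⟩, hμ⟩
  · have h1 := congrArg (fun ν : Measure 𝔼 => ν univ) hμ
    simp only [measure_univ, withDensity_apply _ MeasurableSet.univ, Measure.restrict_univ] at h1
    rw [integral_eq_lintegral_of_nonneg_ae (ae_of_all _ hm0) hmm.aestronglyMeasurable, ← h1]
    simp
  · simpa only [Real.sq_sqrt (hm0 _)] using hmi
  · have h1 := hst p hp hpc
    rw [hμ, integral_withDensity_eq_integral_toReal_smul hmm.ennreal_ofReal hfin] at h1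
    rw [← h1]
    refine integral_congr_ae (ae_of_all _ fun x => ?_)
    simp only [ENNReal.toReal_ofReal (hm0 x), smul_eq_mul]
    ring

open ProbabilityTheory in
/-- Existence of a solution of the averaged system on the unit time window. -/
theorem TameCoeff.exists_window (h : TameCoeff A a c CA C₀ C₁ R) (z : 𝕌) {G N K θ L : ℝ}
    (hG : 0 ≤ G) (hN0 : 0 ≤ N)
    (hgrow : ∀ s u x, ‖u‖ ≤ N → ⟪u, A s u x⟫ ≤ G * (1 + ‖u‖ ^ 2))
    (hN : (1 + ‖z‖ ^ 2) * Real.exp (2 * G + 1) ≤ 1 + N ^ 2)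
    (hK : ∀ s u x y, ‖c s u y - c s u x‖ ≤ K * ‖y - x‖) (hθ : 0 < θ)
    (hell : ∀ s u x v, θ * ‖v‖ ^ 2 ≤ ⟪c s u x v, v⟫)
    (hL : ∀ s u x, ‖a s u x‖ ≤ L * (1 + ‖x‖)) :
    ∃ (X : ℝ → 𝕌) (m : ℝ → 𝔼 → ℝ), Continuous X ∧ X 0 = z ∧ (∀ s ∈ Icc (0 : ℝ) 1, ‖X s‖ ≤ N) ∧
      Measurable (fun q : ℝ × 𝔼 => m q.1 q.2) ∧ (∀ s x, 0 ≤ m s x) ∧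
      (∀ s ∈ Icc (0 : ℝ) 1, X s = z + ∫ r in (0 : ℝ)..s, ∫ x, m r x • A r (X r) x) ∧
      ∀ᵐ s ∂volume.restrict (Ico (0 : ℝ) 1), IsStationaryDensity (c s (X s)) (a s (X s)) (m s) := by
  obtain ⟨M, X, hMp, hMt, hXc, hMX, hXN, hM3, hMst, hXeq⟩ :=
    h.exists_relaxed z hG hN0 hgrow hN
  have hXm : Measurable X := hXc.measurable
  set lam : Measure ℝ := volume.restrict (Ico (0 : ℝ) 1) with hlam
  have hpm : Measurable fun q : ℝ × 𝕌 × 𝔼 => (q.1, q.2.2) := by fun_prop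
  have hνp : IsProbabilityMeasure (M.map fun q : ℝ × 𝕌 × 𝔼 => (q.1, q.2.2)) :=
    Measure.isProbabilityMeasure_map hpm.aemeasurable
  set ν : Measure (ℝ × 𝔼) := M.map fun q : ℝ × 𝕌 × 𝔼 => (q.1, q.2.2) with hν
  have hfst : ν.fst = lam := by
    rw [Measure.fst, hν, Measure.map_map measurable_fst hpm, ← hMt]
    rfl
  set κ : Kernel ℝ 𝔼 := ν.condKernel with hκdef
  have hκ : ν = lam ⊗ₘ κ := by
    rw [← hfst]; exact (Measure.disintegrate ν ν.condKernel).symm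
  obtain ⟨m, hmm, hm0, hm⟩ := exists_measurable_kernel_density κ
  -- transfer of integrals along the limiting path
  have hF1 : ∀ {E : Type} [NormedAddCommGroup E] [NormedSpace ℝ E] (g : ℝ × 𝕌 × 𝔼 → E) (C : ℝ),
      StronglyMeasurable g → (∀ q, ‖g q‖ ≤ C) → ∀ r ∈ Icc (0 : ℝ) 1,
      ∫ q in Iio r ×ˢ univ, g q ∂M = ∫ s in (0 : ℝ)..r, ∫ x, g (s, X s, x) ∂κ s := by
    intro E _ _ g C hg hC r hr
    have hpath : Measurable fun q : ℝ × 𝔼 => (q.1, X q.1, q.2) := by fun_prop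
    have h1 := setIntegral_eq_intervalIntegral_kernel (M := M) (κ := κ) hκ
      (g := fun q : ℝ × 𝔼 => g (q.1, X q.1, q.2)) (hg.comp_measurable hpath) (fun q => hC _) hr
    rw [← h1]
    refine integral_congr_ae (ae_restrict_of_ae ?_)
    filter_upwards [hMX] with q hq
    obtain ⟨s, u, x⟩ := q
    simp only at hq
    rw [hq]
  have hloc : ∀ {E : Type} [NormedAddCommGroup E] [NormedSpace ℝ E] (g : ℝ × 𝕌 × 𝔼 → E) (C : ℝ),
      StronglyMeasurable g → (∀ q, ‖g q‖ ≤ C) →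
      LocallyIntegrable fun s => ∫ x, g (s, X s, x) ∂κ s := by
    intro E _ _ g C hg hC
    have hpath : Measurable fun q : ℝ × 𝔼 => (q.1, X q.1, q.2) := by fun_prop
    refine locallyIntegrable_of_ae_bound (C := C) (StronglyMeasurable.integral_kernel_prod_right'
      (κ := κ) (hg.comp_measurable hpath)).aestronglyMeasurable (ae_of_all _ fun s => ?_)
    simpa using norm_integral_le_of_norm_le_const (μ := κ s)
      (f := fun x => g (s, X s, x)) (C := C) (ae_of_all _ fun x => hC _)
  have hF2 : ∀ p : 𝔼 → ℝ, ContDiff ℝ (⊤ : ℕ∞) p → HasCompactSupport p →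
      ∀ᵐ s ∂lam, ∫ x, diffGen (c s (X s)) (a s (X s)) p x ∂κ s = 0 := by
    intro p hp hpc
    obtain ⟨C, hC0, hC⟩ := h.exists_diffGen_bound hp hpc
    have hg := (h.measurable_diffGen hp).stronglyMeasurable
    refine ae_eq_zero_of_intervalIntegral_eq_zero
      (hloc (fun q => diffGen (c q.1 q.2.1) (a q.1 q.2.1) p q.2.2) C hg fun q => hC _ _ _)
      fun r hr => ?_
    exact (hF1 (fun q => diffGen (c q.1 q.2.1) (a q.1 q.2.1) p q.2.2) C hg
      (fun q => hC _ _ _) r hr).symm.trans (hMst p hp hpc r hr)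
  have hF3 : ∀ᵐ s ∂lam, ∫⁻ x, ENNReal.ofReal (‖x‖ ^ 3) ∂κ s < ⊤ := by
    have hg : Measurable fun q : ℝ × 𝔼 => ENNReal.ofReal (‖q.2‖ ^ 3) := by fun_prop
    have h1 : ∫⁻ s, ∫⁻ x, ENNReal.ofReal (‖x‖ ^ 3) ∂κ s ∂lam < ⊤ := by
      have h2 := Measure.lintegral_compProd (μ := lam) (κ := κ) hg
      rw [← h2, ← hκ, hν, lintegral_map hg hpm]
      exact hM3
    exact ae_lt_top hg.lintegral_kernel_prod_right' h1.ne
  obtain ⟨D, hD, happ⟩ := exists_countable_testFun (l := l)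
  have hF4 : ∀ᵐ s ∂lam, ∀ i j, ∫ x, diffGen (c s (X s)) (a s (X s)) (D i j) x ∂κ s = 0 := by
    rw [ae_all_iff]; intro i
    rw [ae_all_iff]; intro j
    exact hF2 _ (hD i j).1 (hD i j).2.1
  have hF5 : ∀ᵐ s ∂lam, IsStationaryDensity (c s (X s)) (a s (X s)) (m s) ∧
      κ s = volume.withDensity fun x => ENNReal.ofReal (m s x) := by
    filter_upwards [hF3, hF4] with s h3 h4
    have hcs : Continuous (c s (X s)) :=
      (h.c_cont s).comp (continuous_const.prodMk continuous_id)
    have has : Continuous (a s (X s)) :=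
      (h.a_cont s).comp (continuous_const.prodMk continuous_id)
    refine isStationaryDensity_of_measure (h.c_bd s (X s)) (hK s (X s)) hcs has hθ
      (hell s (X s)) (hL s (X s)) h3 (fun p hp hpc => ?_) (hm0 s)
      (hmm.comp measurable_prodMk_left) (hm s)
    obtain ⟨i, hpi, hi⟩ := happ p hp hpc
    refine stationary_of_countable hD hcs has (h.c_bd s (X s)) (fun r => ?_) h4 hp hpc hpi hi
    obtain ⟨C, hC⟩ := h.a_locbd r
    exact ⟨C, hC s (X s)⟩
  have hXeq' : ∀ s ∈ Icc (0 : ℝ) 1, X s = z + ∫ r in (0 : ℝ)..s, ∫ x, m r x • A r (X r) x := by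
    intro s hs
    rw [hXeq s, hF1 (fun q => A q.1 q.2.1 q.2.2) CA h.A_meas.stronglyMeasurable
      (fun q => h.A_bd _ _ _) s hs]
    congr 1
    rw [intervalIntegral.integral_of_le hs.1, intervalIntegral.integral_of_le hs.1]
    have h1 : ∀ᵐ r ∂volume.restrict (Ioc 0 s), r ∈ Ico (0 : ℝ) 1 := by
      have h2 : ∀ᵐ r : ℝ, r ≠ 1 := by simp [ae_iff]
      filter_upwards [ae_restrict_of_ae h2, ae_restrict_mem measurableSet_Ioc] with r hr1 hr2
      exact ⟨hr2.1.le, lt_of_le_of_ne (hr2.2.trans hs.2) hr1⟩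
    refine integral_congr_ae ?_
    filter_upwards [h1, ae_restrict_of_ae ((ae_restrict_iff' measurableSet_Ico).1 hF5)]
      with r hr1 hr2
    obtain ⟨-, hr3⟩ := hr2 hr1
    have hmr : Measurable (m r) := hmm.comp measurable_prodMk_left
    rw [hr3, integral_withDensity_eq_integral_toReal_smul hmr.ennreal_ofReal
      (ae_of_all _ fun x => ENNReal.ofReal_lt_top)]
    refine integral_congr_ae (ae_of_all _ fun x => ?_)
    simp only [ENNReal.toReal_ofReal (hm0 r x)]
  refine ⟨X, m, hXc, ?_, fun s hs => ?_, hmm, hm0, hXeq', hF5.mono fun s hs => hs.1⟩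
  · simpa using hXeq' 0 (by simp)
  · have h1 : Icc (0 : ℝ) 1 = closure (Ico 0 1) := (closure_Ico zero_ne_one).symm
    rw [h1] at hs
    exact closure_minimal (t := {s | ‖X s‖ ≤ N}) hXN
      (isClosed_le hXc.norm continuous_const) hs

/-- The standing assumptions on the coefficients of the averaged system. -/
structure AveragingCoeff (A : ℝ → 𝕌 → 𝔼 → 𝕌) (a : ℝ → 𝕌 → 𝔼 → 𝔼)
    (c : ℝ → 𝕌 → 𝔼 → (𝔼 →L[ℝ] 𝔼)) : Prop where
  A_meas : Measurable fun q : ℝ × 𝕌 × 𝔼 => A q.1 q.2.1 q.2.2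
  a_meas : Measurable fun q : ℝ × 𝕌 × 𝔼 => a q.1 q.2.1 q.2.2
  c_meas : ∀ y, Measurable fun q : ℝ × 𝕌 × 𝔼 => c q.1 q.2.1 q.2.2 y
  A_cont : ∀ s, Continuous fun q : 𝕌 × 𝔼 => A s q.1 q.2
  A_bd : ∀ T N : ℝ, ∃ C : ℝ, ∀ s ∈ Icc (0 : ℝ) T, ∀ u, ‖u‖ ≤ N → ∀ x, ‖A s u x‖ ≤ C
  A_growth : ∀ T : ℝ, ∃ C : ℝ, ∀ s ∈ Icc (0 : ℝ) T, ∀ u x, ⟪u, A s u x⟫ ≤ C * (1 + ‖u‖ ^ 2)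
  a_locbd : ∀ T N R : ℝ, ∃ C : ℝ, ∀ s ∈ Icc (0 : ℝ) T, ∀ u, ‖u‖ ≤ N → ∀ x,
    ‖x‖ ≤ R → ‖a s u x‖ ≤ C
  a_lip : ∀ T N : ℝ, ∃ K : NNReal, ∀ s ∈ Icc (0 : ℝ) T, ∀ u, ‖u‖ ≤ N → LipschitzWith K (a s u)
  a_contu : ∀ T : ℝ, ∀ u₀ : 𝕌, ∀ ε : ℝ, 0 < ε → ∃ δ : ℝ, 0 < δ ∧
    ∀ s ∈ Icc (0 : ℝ) T, ∀ u, ‖u - u₀‖ < δ → ∀ x, ‖a s u x - a s u₀ x‖ < ε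
  a_stab : ∀ T N C : ℝ, ∃ R : ℝ, ∀ x : 𝔼, R ≤ ‖x‖ →
    ∀ s ∈ Icc (0 : ℝ) T, ∀ u, ‖u‖ ≤ N → ⟪a s u x, x⟫ ≤ -C * ‖x‖
  c_bd : ∀ T N : ℝ, ∃ C : ℝ, ∀ s ∈ Icc (0 : ℝ) T, ∀ u, ‖u‖ ≤ N → ∀ x, ‖c s u x‖ ≤ C
  c_pos : ∀ T N : ℝ, ∃ θ : ℝ, 0 < θ ∧ ∀ s ∈ Icc (0 : ℝ) T, ∀ u, ‖u‖ ≤ N →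
    ∀ x y, θ * ‖y‖ ^ 2 ≤ ⟪c s u x y, y⟫
  c_contu : ∀ T : ℝ, ∀ u₀ : 𝕌, ∀ ε : ℝ, 0 < ε → ∃ δ : ℝ, 0 < δ ∧
    ∀ s ∈ Icc (0 : ℝ) T, ∀ u, ‖u - u₀‖ < δ → ∀ x, ‖c s u x - c s u₀ x‖ < ε
  c_diff : ∀ s u, ContDiff ℝ 1 (c s u)
  c_deriv : ∀ T N : ℝ, ∃ K : ℝ, ∀ s ∈ Icc (0 : ℝ) T, ∀ u, ‖u‖ ≤ N →
    ∀ x, ‖fderiv ℝ (c s u) x‖ ≤ K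

theorem continuous_of_uniform_left {U V F : Type*} [NormedAddCommGroup U] [TopologicalSpace V]
    [NormedAddCommGroup F] {f : U → V → F} (hf : ∀ u, Continuous (f u))
    (hu : ∀ u₀ : U, ∀ ε : ℝ, 0 < ε → ∃ δ : ℝ, 0 < δ ∧ ∀ u, ‖u - u₀‖ < δ → ∀ x,
      ‖f u x - f u₀ x‖ < ε) : Continuous fun q : U × V => f q.1 q.2 := by
  refine continuous_iff_continuousAt.2 fun ⟨u₀, x₀⟩ => ?_
  refine Metric.tendsto_nhds.2 fun ε hε => ?_
  obtain ⟨δ, hδ, h⟩ := hu u₀ (ε / 2) (half_pos hε)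
  have h1 : ∀ᶠ q : U × V in 𝓝 (u₀, x₀), ‖q.1 - u₀‖ < δ := by
    have : Tendsto (fun q : U × V => ‖q.1 - u₀‖) (𝓝 (u₀, x₀)) (𝓝 ‖u₀ - u₀‖) :=
      ((continuous_fst.sub continuous_const).norm).tendsto (u₀, x₀)
    rw [sub_self, norm_zero] at this
    exact this.eventually (gt_mem_nhds hδ)
  have h2 : ∀ᶠ q : U × V in 𝓝 (u₀, x₀), dist (f u₀ q.2) (f u₀ x₀) < ε / 2 :=
    Metric.tendsto_nhds.1 (((hf u₀).comp continuous_snd).tendsto (u₀, x₀)) (ε / 2) (half_pos hε)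
  filter_upwards [h1, h2] with q hq1 hq2
  have h3 := h q.1 hq1 q.2
  rw [← dist_eq_norm] at h3
  have h4 := dist_triangle (f q.1 q.2) (f u₀ q.2) (f u₀ x₀)
  change dist (f q.1 q.2) (f u₀ x₀) < ε
  linarith

theorem AveragingCoeff.exists_window (h : AveragingCoeff A a c) {τ : ℝ} (hτ : 0 ≤ τ) (z : 𝕌) :
    ∃ (X : ℝ → 𝕌) (m : ℝ → 𝔼 → ℝ), Continuous X ∧ X 0 = z ∧
      Measurable (fun q : ℝ × 𝔼 => m q.1 q.2) ∧
      (∀ s ∈ Icc (0 : ℝ) 1, X s = z + ∫ r in (0 : ℝ)..s, ∫ x, m r x • A (r + τ) (X r) x) ∧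
      ∀ᵐ s ∂volume.restrict (Ico (0 : ℝ) 1),
        IsStationaryDensity (c (s + τ) (X s)) (a (s + τ) (X s)) (m s) := by
  obtain ⟨G₀, hG₀⟩ := h.A_growth (1 + τ)
  set G : ℝ := |G₀| with hG
  set N : ℝ := (1 + ‖z‖ ^ 2) * Real.exp (2 * G + 1) with hNdef
  have hN1 : 1 ≤ N := by
    have h1 : 1 ≤ Real.exp (2 * G + 1) := Real.one_le_exp (by positivity)
    have h2 : 1 ≤ 1 + ‖z‖ ^ 2 := by nlinarith [sq_nonneg ‖z‖]
    nlinarith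
  have hN0 : 0 < N := by linarith
  set σ : ℝ → ℝ := fun s => max 0 (min s 1) + τ with hσ
  have hσc : Continuous σ := by fun_prop
  have hσI : ∀ s, σ s ∈ Icc (0 : ℝ) (1 + τ) := by
    intro s
    have h1 : (0 : ℝ) ≤ max 0 (min s 1) := le_max_left _ _
    have h2 : max 0 (min s 1) ≤ (1 : ℝ) := max_le zero_le_one (min_le_right _ _)
    exact ⟨by simp only [hσ]; linarith, by simp only [hσ]; linarith⟩
  have hσeq : ∀ s ∈ Icc (0 : ℝ) 1, σ s = s + τ := by
    intro s hs
    simp only [hσ, min_eq_left hs.2, max_eq_right hs.1]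
  have hP : ∀ u : 𝕌, ‖radialProj N u‖ ≤ N := fun u => norm_radialProj_le hN0 u
  have hPc : Continuous fun u : 𝕌 => radialProj N u := continuous_radialProj hN0
  have hmeas : Measurable fun q : ℝ × 𝕌 × 𝔼 => (σ q.1, radialProj N q.2.1, q.2.2) :=
    ((hσc.comp continuous_fst).prodMk ((hPc.comp (continuous_fst.comp continuous_snd)).prodMk
      (continuous_snd.comp continuous_snd))).measurable
  have hPq : Continuous fun q : 𝕌 × 𝔼 => (radialProj N q.1, q.2) :=
    (hPc.comp continuous_fst).prodMk continuous_snd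
  obtain ⟨CA, hCA⟩ := h.A_bd (1 + τ) N
  obtain ⟨C₀, hC₀⟩ := h.c_bd (1 + τ) N
  obtain ⟨θ, hθ, hell⟩ := h.c_pos (1 + τ) N
  obtain ⟨R₀, hR₀⟩ := h.a_stab (1 + τ) N 1
  obtain ⟨C₁, hC₁⟩ := h.a_locbd (1 + τ) N (max R₀ 0)
  obtain ⟨K, hK⟩ := h.c_deriv (1 + τ) N
  obtain ⟨Ka, hKa⟩ := h.a_lip (1 + τ) N
  have ha_cont : ∀ s, Continuous fun q : 𝕌 × 𝔼 => a (σ s) (radialProj N q.1) q.2 := by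
    intro s
    refine continuous_of_uniform_left (f := fun u x => a (σ s) (radialProj N u) x)
      (fun u => (hKa _ (hσI s) _ (hP u)).continuous) fun u₀ ε hε => ?_
    obtain ⟨δ, hδ, hd⟩ := h.a_contu (1 + τ) (radialProj N u₀) ε hε
    obtain ⟨δ', hδ', hd'⟩ := Metric.continuousAt_iff.1 (hPc.continuousAt (x := u₀)) δ hδ
    refine ⟨δ', hδ', fun u hu x => hd _ (hσI s) _ ?_ x⟩
    rw [← dist_eq_norm] at hu ⊢
    exact hd' hu
  have hc_cont : ∀ s, Continuous fun q : 𝕌 × 𝔼 => c (σ s) (radialProj N q.1) q.2 := by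
    intro s
    refine continuous_of_uniform_left (f := fun u x => c (σ s) (radialProj N u) x)
      (fun u => (h.c_diff _ _).continuous) fun u₀ ε hε => ?_
    obtain ⟨δ, hδ, hd⟩ := h.c_contu (1 + τ) (radialProj N u₀) ε hε
    obtain ⟨δ', hδ', hd'⟩ := Metric.continuousAt_iff.1 (hPc.continuousAt (x := u₀)) δ hδ
    refine ⟨δ', hδ', fun u hu x => hd _ (hσI s) _ ?_ x⟩
    rw [← dist_eq_norm] at hu ⊢
    exact hd' hu
  have htame : TameCoeff (fun s u x => A (σ s) (radialProj N u) x)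
      (fun s u x => a (σ s) (radialProj N u) x) (fun s u x => c (σ s) (radialProj N u) x)
      CA C₀ C₁ (max R₀ 0) :=
    { A_meas := h.A_meas.comp hmeas
      a_meas := h.a_meas.comp hmeas
      c_meas := fun y => (h.c_meas y).comp hmeas
      A_cont := fun s => (h.A_cont (σ s)).comp hPq
      a_cont := ha_cont
      c_cont := hc_cont
      A_bd := fun s u x => hCA _ (hσI s) _ (hP u) x
      c_bd := fun s u x => hC₀ _ (hσI s) _ (hP u) x
      c_nonneg := fun s u x v => le_trans (by positivity) (hell _ (hσI s) _ (hP u) x v)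
      a_locbd := fun r => by
        obtain ⟨C, hC⟩ := h.a_locbd (1 + τ) N r
        exact ⟨C, fun s u x hx => hC _ (hσI s) _ (hP u) x hx⟩
      R_nonneg := le_max_right _ _
      a_bd := fun s u x hx => hC₁ _ (hσI s) _ (hP u) x hx
      a_stab := fun s u x hx => by
        simpa using hR₀ x ((le_max_left _ _).trans hx) _ (hσI s) _ (hP u) }
  have hgrow : ∀ s (u : 𝕌) x, ‖u‖ ≤ N → ⟪u, A (σ s) (radialProj N u) x⟫ ≤ G * (1 + ‖u‖ ^ 2) := by
    intro s u x hu
    rw [radialProj_of_norm_le hN0 hu]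
    exact (hG₀ _ (hσI s) u x).trans
      (mul_le_mul_of_nonneg_right (le_abs_self _) (by positivity))
  have hlip : ∀ s (u : 𝕌) x y, ‖c (σ s) (radialProj N u) y - c (σ s) (radialProj N u) x‖ ≤
      K * ‖y - x‖ := fun s u x y =>
    convex_univ.norm_image_sub_le_of_norm_fderiv_le
      (fun w _ => ((h.c_diff _ _).differentiable one_ne_zero).differentiableAt)
      (fun w _ => hK _ (hσI s) _ (hP u) w) (mem_univ x) (mem_univ y)
  have hL : ∀ s (u : 𝕌) x, ‖a (σ s) (radialProj N u) x‖ ≤ (|C₁| + Ka) * (1 + ‖x‖) := by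
    intro s u x
    have h1 := hC₁ _ (hσI s) _ (hP u) 0 (by simp)
    have h2 := (hKa _ (hσI s) _ (hP u)).dist_le_mul x 0
    rw [dist_zero_right, dist_eq_norm] at h2
    have h3 := norm_le_norm_add_norm_sub' (a (σ s) (radialProj N u) x) (a (σ s) (radialProj N u) 0)
    have h4 := le_abs_self C₁
    nlinarith [mul_nonneg (abs_nonneg C₁) (norm_nonneg x), Ka.coe_nonneg]
  obtain ⟨X, m, hXc, hX0, hXN, hm, -, hXeq, hst⟩ := htame.exists_window z (abs_nonneg G₀) hN0.le
    hgrow (by nlinarith) hlip hθ (fun s u x v => hell _ (hσI s) _ (hP u) x v) hL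
  have hPX : ∀ s ∈ Icc (0 : ℝ) 1, radialProj N (X s) = X s := fun s hs =>
    radialProj_of_norm_le hN0 (hXN s hs)
  refine ⟨X, m, hXc, hX0, hm, fun s hs => ?_, ?_⟩
  · rw [hXeq s hs]
    congr 1
    refine intervalIntegral.integral_congr fun r hr => ?_
    rw [uIcc_of_le hs.1] at hr
    have hr' : r ∈ Icc (0 : ℝ) 1 := ⟨hr.1, hr.2.trans hs.2⟩
    simp only [hPX r hr', hσeq r hr']
  · filter_upwards [hst, ae_restrict_mem measurableSet_Ico] with s hs1 hs2
    have hs' := Ico_subset_Icc_self hs2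
    simpa only [hPX s hs', hσeq s hs'] using hs1

theorem intervalIntegrable_of_locally_ae_bounded {E : Type*} [NormedAddCommGroup E]
    {F : ℝ → E} (hF : AEStronglyMeasurable F volume)
    (hb : ∀ T : ℝ, ∃ C, ∀ᵐ s, s ∈ Icc 0 T → ‖F s‖ ≤ C) {r s : ℝ} (hr : 0 ≤ r) (hs : 0 ≤ s) :
    IntervalIntegrable F volume r s := by
  obtain ⟨C, hC⟩ := hb (max r s)
  rw [intervalIntegrable_iff]
  refine Measure.integrableOn_of_bounded (M := C) measure_Ioc_lt_top.ne hF ?_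
  filter_upwards [ae_restrict_of_ae hC, ae_restrict_mem measurableSet_uIoc] with q hq1 hq2
  exact hq1 ⟨(le_min hr hs).trans hq2.1.le, hq2.2⟩

/-- A primitive of a locally bounded function is locally Lipschitz and almost everywhere
differentiable. -/
theorem lipschitz_and_hasDerivAt_of_primitive {E : Type*} [NormedAddCommGroup E]
    [NormedSpace ℝ E] [CompleteSpace E] {X F : ℝ → E} {z : E}
    (hF : AEStronglyMeasurable F volume)
    (hb : ∀ T : ℝ, ∃ C, ∀ᵐ s, s ∈ Icc 0 T → ‖F s‖ ≤ C)
    (hX : ∀ s, 0 ≤ s → X s = z + ∫ r in (0 : ℝ)..s, F r) :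
    (∀ T : ℝ, ∃ K : NNReal, LipschitzOnWith K X (Icc 0 T)) ∧
      ∀ᵐ s ∂volume.restrict (Ici (0 : ℝ)), HasDerivAt X (F s) s := by
  constructor
  · intro T
    obtain ⟨C, hC⟩ := hb T
    refine ⟨C.toNNReal, LipschitzOnWith.of_dist_le_mul fun x hx y hy => ?_⟩
    have h0 : (0 : ℝ) ∈ Icc 0 T := ⟨le_rfl, hx.1.trans hx.2⟩
    rw [hX x hx.1, hX y hy.1, dist_add_left, dist_eq_norm,
      intervalIntegral.integral_interval_sub_left
        (intervalIntegrable_of_locally_ae_bounded hF hb le_rfl hx.1)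
        (intervalIntegrable_of_locally_ae_bounded hF hb le_rfl hy.1)]
    refine intervalIntegral.norm_integral_le_of_norm_le_const_ae ?_
    filter_upwards [hC] with q hq hq'
    have h1 := uIoc_subset_uIcc hq'
    exact (hq (ordConnected_Icc.uIcc_subset hy hx h1)).trans (Real.le_coe_toNNReal C)
  · have hloc : LocallyIntegrable ((Ici (0 : ℝ)).indicator F) := by
      intro x
      refine ⟨Ioo (x - 1) (x + 1), Ioo_mem_nhds (by linarith) (by linarith), ?_⟩
      obtain ⟨C, hC⟩ := hb (x + 1)
      refine Measure.integrableOn_of_bounded (M := |C|) measure_Ioo_lt_top.ne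
        (hF.indicator measurableSet_Ici) ?_
      filter_upwards [ae_restrict_of_ae hC, ae_restrict_mem measurableSet_Ioo] with q hq1 hq2
      by_cases hq : q ∈ Ici (0 : ℝ)
      · rw [indicator_of_mem hq]
        exact (hq1 ⟨hq, hq2.2.le⟩).trans (le_abs_self C)
      · rw [indicator_of_notMem hq, norm_zero]
        exact abs_nonneg C
    have hne : ∀ᵐ s : ℝ, s ≠ 0 := by simp [ae_iff]
    rw [ae_restrict_iff' measurableSet_Ici]
    filter_upwards [LocallyIntegrable.ae_hasDerivAt_integral hloc, hne] with s hs h0 hs0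
    have hpos : 0 < s := lt_of_le_of_ne hs0 h0.symm
    have h1 := (hs 0).const_add z
    rw [indicator_of_mem hs0] at h1
    refine h1.congr_of_eventuallyEq ?_
    filter_upwards [Ioi_mem_nhds hpos] with r hr
    rw [hX r hr.le]
    congr 1
    refine intervalIntegral.integral_congr fun q hq => ?_
    rw [uIcc_of_le hr.le] at hq
    exact (indicator_of_mem (show q ∈ Ici (0 : ℝ) from hq.1) F).symm

theorem measurable_floor_glue {β γ : Type*} [MeasurableSpace β] [MeasurableSpace γ]
    {Y : ℕ → ℝ → β → γ} (hY : ∀ j, Measurable fun q : ℝ × β => Y j q.1 q.2) :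
    Measurable fun q : ℝ × β => Y ⌊q.1⌋₊ (q.1 - ⌊q.1⌋₊) q.2 := by
  have h1 : Measurable fun p : (ℝ × β) × ℕ => Y p.2 p.1.1 p.1.2 :=
    measurable_from_prod_countable_left hY
  have hf : Measurable fun q : ℝ × β => ⌊q.1⌋₊ := Nat.measurable_floor.comp measurable_fst
  have hf' : Measurable fun q : ℝ × β => ((⌊q.1⌋₊ : ℕ) : ℝ) :=
    (measurable_from_nat (f := fun k : ℕ => (k : ℝ))).comp hf
  exact h1.comp (((measurable_fst.sub hf').prodMk measurable_snd).prodMk hf)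

/-- If a property holds almost everywhere on every translated unit window, then it holds almost
everywhere on the half line. -/
theorem ae_Ici_of_ae_windows {P : ℕ → ℝ → Prop}
    (hP : ∀ j, ∀ᵐ s ∂volume.restrict (Ico (0 : ℝ) 1), P j s) :
    ∀ᵐ s : ℝ, 0 ≤ s → P ⌊s⌋₊ (s - ⌊s⌋₊) := by
  have h1 : ∀ᵐ s : ℝ, ∀ j : ℕ, s - j ∈ Ico (0 : ℝ) 1 → P j (s - j) := by
    rw [ae_all_iff]
    intro j
    exact (measurePreserving_sub_right volume (j : ℝ)).quasiMeasurePreserving.ae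
      ((ae_restrict_iff' measurableSet_Ico).1 (hP j))
  filter_upwards [h1] with s hs h0
  refine hs _ ⟨sub_nonneg.2 (Nat.floor_le h0), ?_⟩
  linarith [Nat.lt_floor_add_one s]

theorem exists_bound_floor_glue {E : Type*} [NormedAddCommGroup E] {Y : ℕ → ℝ → E}
    (hY : ∀ j, Continuous (Y j)) (T : ℝ) :
    ∃ B, ∀ s ∈ Icc 0 T, ‖Y ⌊s⌋₊ (s - ⌊s⌋₊)‖ ≤ B := by
  have h1 : ∀ j, ∃ B, ∀ s ∈ Icc (0 : ℝ) 1, ‖Y j s‖ ≤ B := fun j =>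
    isCompact_Icc.exists_bound_of_continuousOn (hY j).continuousOn
  choose B hB using h1
  have hB0 : ∀ j, 0 ≤ B j := fun j => (norm_nonneg _).trans (hB j 0 (by simp))
  refine ⟨∑ j ∈ Finset.range (⌊T⌋₊ + 1), B j, fun s hs => ?_⟩
  have h2 : s - ⌊s⌋₊ ∈ Icc (0 : ℝ) 1 :=
    ⟨sub_nonneg.2 (Nat.floor_le hs.1), by linarith [Nat.lt_floor_add_one s]⟩
  refine (hB _ _ h2).trans (Finset.single_le_sum (f := B) (fun j _ => hB0 j) ?_)
  exact Finset.mem_range.2 (Nat.lt_succ_of_le (Nat.floor_mono hs.2))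

/-- Consecutive windows of integral equations glue to one integral equation. -/
theorem integral_eq_of_windows {E : Type*} [NormedAddCommGroup E] [NormedSpace ℝ E]
    [CompleteSpace E] {Y : ℕ → ℝ → E} {F : ℝ → E} {z : E}
    (hF : ∀ r s : ℝ, 0 ≤ r → 0 ≤ s → IntervalIntegrable F volume r s) (h0 : Y 0 0 = z)
    (hnext : ∀ j, Y (j + 1) 0 = Y j 1)
    (hY : ∀ j : ℕ, ∀ s ∈ Icc (0 : ℝ) 1, Y j s = Y j 0 + ∫ r in (j : ℝ)..(j + s), F r) {s : ℝ}
    (hs : 0 ≤ s) : Y ⌊s⌋₊ (s - ⌊s⌋₊) = z + ∫ r in (0 : ℝ)..s, F r := by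
  have hj : ∀ j : ℕ, Y j 0 = z + ∫ r in (0 : ℝ)..j, F r := by
    intro j
    induction j with
    | zero => simp [h0]
    | succ j ih =>
      rw [hnext, hY j 1 (by simp), ih, add_assoc, intervalIntegral.integral_add_adjacent_intervals
        (hF _ _ le_rfl (Nat.cast_nonneg j)) (hF _ _ (Nat.cast_nonneg j) (by positivity))]
      push_cast
      rfl
  rw [hY ⌊s⌋₊ _ ⟨sub_nonneg.2 (Nat.floor_le hs), by linarith [Nat.lt_floor_add_one s]⟩, hj,
    add_sub_cancel, add_assoc, intervalIntegral.integral_add_adjacent_intervals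
      (hF _ _ le_rfl (Nat.cast_nonneg _)) (hF _ _ (Nat.cast_nonneg _) hs)]

theorem AveragingCoeff.exists_solution (h : AveragingCoeff A a c) {t : ℝ} (ht : 0 ≤ t) (z : 𝕌) :
    ∃ (X : ℝ → 𝕌) (m : ℝ → 𝔼 → ℝ), (∀ T : ℝ, ∃ K : NNReal, LipschitzOnWith K X (Icc 0 T)) ∧
      X 0 = z ∧ Measurable (fun q : ℝ × 𝔼 => m q.1 q.2) ∧
      ∀ᵐ s ∂volume.restrict (Ici (0 : ℝ)),
        IsStationaryDensity (c (s + t) (X s)) (a (s + t) (X s)) (m s) ∧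
        HasDerivAt X (∫ x, m s x • A (s + t) (X s) x) s := by
  choose X' m' hX'c hX'0 hm' hX'eq hst' using fun (j : ℕ) (w : 𝕌) =>
    h.exists_window (τ := t + j) (by positivity) w
  let w : ℕ → 𝕌 := fun j => Nat.rec z (fun j v => X' j v 1) j
  set Y : ℕ → ℝ → 𝕌 := fun j => X' j (w j) with hYdef
  set μ : ℕ → ℝ → 𝔼 → ℝ := fun j => m' j (w j) with hμdef
  set X : ℝ → 𝕌 := fun s => Y ⌊s⌋₊ (s - ⌊s⌋₊) with hXdef
  set m : ℝ → 𝔼 → ℝ := fun s => μ ⌊s⌋₊ (s - ⌊s⌋₊) with hmdef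
  have hYc : ∀ j, Continuous (Y j) := fun j => hX'c j (w j)
  have hXm : Measurable X :=
    (measurable_floor_glue (β := Unit) (Y := fun j s _ => Y j s)
      (fun j => (hYc j).measurable.comp measurable_fst)).comp
      (measurable_id.prodMk measurable_const : Measurable fun s : ℝ => (s, ()))
  have hmm : Measurable fun q : ℝ × 𝔼 => m q.1 q.2 :=
    measurable_floor_glue (Y := μ) fun j => hm' j (w j)
  set F : ℝ → 𝕌 := fun s => ∫ x, m s x • A (s + t) (X s) x with hFdef
  have hFm : AEStronglyMeasurable F volume := by
    have h1 : Measurable fun q : ℝ × 𝔼 => (q.1 + t, X q.1, q.2) := by fun_prop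
    have h2 : Measurable fun q : ℝ × 𝔼 => m q.1 q.2 • A (q.1 + t) (X q.1) q.2 :=
      hmm.smul (h.A_meas.comp h1)
    exact (StronglyMeasurable.integral_prod_right' (ν := (volume : Measure 𝔼))
      h2.stronglyMeasurable).aestronglyMeasurable
  have hcast : ∀ s : ℝ, s - ⌊s⌋₊ + (t + ⌊s⌋₊) = s + t := fun s => by ring
  have hst : ∀ᵐ s : ℝ, 0 ≤ s →
      IsStationaryDensity (c (s + t) (X s)) (a (s + t) (X s)) (m s) := by
    have h1 := ae_Ici_of_ae_windows (P := fun j s =>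
      IsStationaryDensity (c (s + (t + j)) (Y j s)) (a (s + (t + j)) (Y j s)) (μ j s))
      fun j => hst' j (w j)
    filter_upwards [h1] with s hs h0
    simpa only [hcast] using hs h0
  have hFb : ∀ T : ℝ, ∃ C, ∀ᵐ s, s ∈ Icc 0 T → ‖F s‖ ≤ C := by
    intro T
    obtain ⟨B, hB⟩ := exists_bound_floor_glue hYc T
    obtain ⟨C, hC⟩ := h.A_bd (T + t) B
    refine ⟨C, ?_⟩
    filter_upwards [hst] with s hs hsT
    have hd := hs hsT.1
    have h1 : ∀ x, ‖m s x • A (s + t) (X s) x‖ ≤ m s x * C := fun x => by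
      rw [norm_smul, Real.norm_of_nonneg (hd.nonneg x)]
      exact mul_le_mul_of_nonneg_left (hC (s + t) ⟨add_nonneg hsT.1 ht, by linarith [hsT.2]⟩
        (X s) (hB s hsT) x) (hd.nonneg x)
    refine (norm_integral_le_of_norm_le (hd.integrable.mul_const C) (ae_of_all _ h1)).trans ?_
    rw [integral_mul_const, hd.integral_eq_one, one_mul]
  have hFi : ∀ r s : ℝ, 0 ≤ r → 0 ≤ s → IntervalIntegrable F volume r s := fun r s hr hs =>
    intervalIntegrable_of_locally_ae_bounded hFm hFb hr hs
  have hYeq : ∀ j : ℕ, ∀ s ∈ Icc (0 : ℝ) 1, Y j s = Y j 0 + ∫ r in (j : ℝ)..(j + s), F r := by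
    intro j s hs
    have h1 := hX'eq j (w j) s hs
    have h2 := hX'0 j (w j)
    change Y j 0 = w j at h2
    rw [h2]
    refine h1.trans ?_
    congr 1
    have h3 := intervalIntegral.integral_comp_sub_right (a := (j : ℝ)) (b := j + s)
      (fun r => ∫ x, m' j (w j) r x • A (r + (t + j)) (X' j (w j) r) x) (j : ℝ)
    rw [sub_self, add_sub_cancel_left] at h3
    rw [← h3]
    refine intervalIntegral.integral_congr_ae ?_
    have hne : ∀ᵐ r : ℝ, r ≠ j + 1 := by simp [ae_iff]
    filter_upwards [hne] with r hr1 hr2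
    rw [uIoc_of_le (by linarith [hs.1])] at hr2
    have hfl : ⌊r⌋₊ = j := by
      rw [Nat.floor_eq_iff ((Nat.cast_nonneg j).trans hr2.1.le)]
      exact ⟨hr2.1.le, lt_of_le_of_ne (hr2.2.trans (by linarith [hs.2])) hr1⟩
    have h4 : r - j + (t + j) = r + t := by ring
    simp only [hFdef, hmdef, hXdef, hfl, h4, hYdef, hμdef]
  have hXeq : ∀ s, 0 ≤ s → X s = z + ∫ r in (0 : ℝ)..s, F r := fun s hs =>
    integral_eq_of_windows hFi (hX'0 0 z) (fun j => hX'0 (j + 1) (w (j + 1))) hYeq hs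
  obtain ⟨hlip, hder⟩ := lipschitz_and_hasDerivAt_of_primitive hFm hFb hXeq
  refine ⟨X, m, hlip, by simpa using hXeq 0 le_rfl, hmm, ?_⟩
  filter_upwards [hder, (ae_restrict_iff' measurableSet_Ici).2 hst] with s hs1 hs2
  exact ⟨hs2, hs1⟩

end Averaging

/-- Lemma `le:zero` of the paper (existence part): the averaged ODE coupled with the
stationarity equation for the fast variable has a solution `(X†, m†)` with `X†` locally
Lipschitz and `m†_s` a probability density with `m†_s ∈ W^{1,1}_loc` and
`√(m†_s) ∈ W^{1,2}(ℝˡ)`. -/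
theorem averaged_system_solution_exists
    (l n : ℕ) (t : ℝ) (ht : 0 ≤ t) (z : EuclideanSpace ℝ (Fin n))
    (A : ℝ → EuclideanSpace ℝ (Fin n) → EuclideanSpace ℝ (Fin l) →
      EuclideanSpace ℝ (Fin n))
    (a : ℝ → EuclideanSpace ℝ (Fin n) → EuclideanSpace ℝ (Fin l) →
      EuclideanSpace ℝ (Fin l))
    (c : ℝ → EuclideanSpace ℝ (Fin n) → EuclideanSpace ℝ (Fin l) →
      (EuclideanSpace ℝ (Fin l) →L[ℝ] EuclideanSpace ℝ (Fin l)))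
    -- measurability of the coefficients
    (hA_meas : Measurable
      (fun p : ℝ × EuclideanSpace ℝ (Fin n) × EuclideanSpace ℝ (Fin l) =>
        A p.1 p.2.1 p.2.2))
    (ha_meas : Measurable
      (fun p : ℝ × EuclideanSpace ℝ (Fin n) × EuclideanSpace ℝ (Fin l) =>
        a p.1 p.2.1 p.2.2))
    (hc_meas : ∀ y, Measurable
      (fun p : ℝ × EuclideanSpace ℝ (Fin n) × EuclideanSpace ℝ (Fin l) =>
        (c p.1 p.2.1 p.2.2) y))
    -- conditions on `A`
    (hA_cont : ∀ s, Continuous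
      (fun q : EuclideanSpace ℝ (Fin n) × EuclideanSpace ℝ (Fin l) => A s q.1 q.2))
    (hA_bd : ∀ T N : ℝ, ∃ C : ℝ, ∀ s ∈ Set.Icc (0 : ℝ) T, ∀ u, ‖u‖ ≤ N → ∀ x,
      ‖A s u x‖ ≤ C)
    (hA_growth : ∀ T : ℝ, ∃ C : ℝ, ∀ s ∈ Set.Icc (0 : ℝ) T, ∀ u x,
      ⟪u, A s u x⟫ ≤ C * (1 + ‖u‖ ^ 2))
    -- conditions on `a`
    (ha_locbd : ∀ T N R : ℝ, ∃ C : ℝ, ∀ s ∈ Set.Icc (0 : ℝ) T, ∀ u, ‖u‖ ≤ N → ∀ x,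
      ‖x‖ ≤ R → ‖a s u x‖ ≤ C)
    (ha_lip : ∀ T N : ℝ, ∃ K : NNReal, ∀ s ∈ Set.Icc (0 : ℝ) T, ∀ u, ‖u‖ ≤ N →
      LipschitzWith K (a s u))
    (ha_contu : ∀ T : ℝ, ∀ u₀ : EuclideanSpace ℝ (Fin n), ∀ ε : ℝ, 0 < ε →
      ∃ δ : ℝ, 0 < δ ∧ ∀ s ∈ Set.Icc (0 : ℝ) T, ∀ u, ‖u - u₀‖ < δ → ∀ x,
        ‖a s u x - a s u₀ x‖ < ε)
    (ha_stab : ∀ T N C : ℝ, ∃ R : ℝ, ∀ x : EuclideanSpace ℝ (Fin l), R ≤ ‖x‖ →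
      ∀ s ∈ Set.Icc (0 : ℝ) T, ∀ u, ‖u‖ ≤ N → ⟪a s u x, x⟫ ≤ -C * ‖x‖)
    -- conditions on `c`
    (hc_symm : ∀ s u x y y', ⟪c s u x y, y'⟫ = ⟪y, c s u x y'⟫)
    (hc_bd : ∀ T N : ℝ, ∃ C : ℝ, ∀ s ∈ Set.Icc (0 : ℝ) T, ∀ u, ‖u‖ ≤ N → ∀ x,
      ‖c s u x‖ ≤ C)
    (hc_pos : ∀ T N : ℝ, ∃ θ : ℝ, 0 < θ ∧ ∀ s ∈ Set.Icc (0 : ℝ) T, ∀ u, ‖u‖ ≤ N →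
      ∀ x y, θ * ‖y‖ ^ 2 ≤ ⟪c s u x y, y⟫)
    (hc_contu : ∀ T : ℝ, ∀ u₀ : EuclideanSpace ℝ (Fin n), ∀ ε : ℝ, 0 < ε →
      ∃ δ : ℝ, 0 < δ ∧ ∀ s ∈ Set.Icc (0 : ℝ) T, ∀ u, ‖u - u₀‖ < δ → ∀ x,
        ‖c s u x - c s u₀ x‖ < ε)
    (hc_C1 : ∀ s u, ContDiff ℝ 1 (c s u))
    (hc_deriv : ∀ T N : ℝ, ∃ K : ℝ, ∀ s ∈ Set.Icc (0 : ℝ) T, ∀ u, ‖u‖ ≤ N →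
      (∀ x, ‖fderiv ℝ (c s u) x‖ ≤ K) ∧
        LipschitzWith (Real.toNNReal K) (fderiv ℝ (c s u))) :
    ∃ (Xd : ℝ → EuclideanSpace ℝ (Fin n))
      (md : ℝ → EuclideanSpace ℝ (Fin l) → ℝ),
      -- `X†` is locally Lipschitz on `ℝ₊` with `X†₀ = z`
      (∀ T : ℝ, 0 < T → ∃ KX : NNReal, LipschitzOnWith KX Xd (Set.Icc 0 T)) ∧
      Xd 0 = z ∧
      -- `m†` is jointly measurable
      Measurable (fun p : ℝ × EuclideanSpace ℝ (Fin l) => md p.1 p.2) ∧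
      ∀ᵐ s ∂(volume.restrict (Set.Ici (0 : ℝ))),
        -- `m†_s` is a probability density
        ((∀ x, 0 ≤ md s x) ∧ Integrable (md s) volume ∧ (∫ x, md s x) = 1) ∧
        -- `m†_s ∈ W^{1,1}_loc(ℝˡ)`
        (∃ g, HasWeakGrad (md s) g) ∧
        -- `√(m†_s) ∈ W^{1,2}(ℝˡ)`
        (∃ h, HasWeakGrad (fun x => Real.sqrt (md s x)) h ∧
          Integrable (fun x => (Real.sqrt (md s x)) ^ 2) volume ∧
          Integrable (fun x => ‖h x‖ ^ 2) volume) ∧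
        -- the averaged ODE
        HasDerivAt Xd (∫ x, md s x • A (s + t) (Xd s) x) s ∧
        -- the stationarity equation for the fast variable
        (∀ p : EuclideanSpace ℝ (Fin l) → ℝ, ContDiff ℝ (⊤ : ℕ∞) p → HasCompactSupport p →
          (∫ x, (((1 : ℝ) / 2) *
              (LinearMap.trace ℝ (EuclideanSpace ℝ (Fin l))
                ((c (s + t) (Xd s) x).comp (fderiv ℝ (fun y => gradient p y) x)).toLinearMap) +
              ⟪a (s + t) (Xd s) x, gradient p x⟫) * md s x) = 0) := by
  obtain ⟨Xd, md, hlip, h0, hm, hae⟩ := AveragingCoeff.exists_solution (A := A) (a := a) (c := c)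
    { A_meas := hA_meas
      a_meas := ha_meas
      c_meas := hc_meas
      A_cont := hA_cont
      A_bd := hA_bd
      A_growth := hA_growth
      a_locbd := ha_locbd
      a_lip := ha_lip
      a_contu := ha_contu
      a_stab := ha_stab
      c_bd := hc_bd
      c_pos := hc_pos
      c_contu := hc_contu
      c_diff := hc_C1
      c_deriv := fun T N => by
        obtain ⟨K, hK⟩ := hc_deriv T N
        exact ⟨K, fun s hs u hu => (hK s hs u hu).1⟩ } ht z
  refine ⟨Xd, md, fun T _ => hlip T, h0, hm, ?_⟩
  filter_upwards [hae] with s hs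
  exact ⟨⟨hs.1.nonneg, hs.1.integrable, hs.1.integral_eq_one⟩, hs.1.weakGrad,
    hs.1.sqrt_weakGrad, hs.2, hs.1.stationary⟩
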